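/- arXiv:2508.05833 — 2 statements merged into one kernel-verified Lean document; each statement's English description precedes it below -/
import Mathlib

section
/- For all integers n ≥ 0, a_3(25n + 20) ≡ 0 (mod 5), where a_3(n) is the number of partitions of n in which odd parts are unrestricted and even parts come in 3 colors. -/
/-- `genCubic d n` : the number of partitions of `n` in which odd parts are
unrestricted (always color `0`) and even parts may independently receive one of
`d` colors.  A colored partition is a multiset of (part, color) pairs. -/
noncomputable def genCubic (d n : ℕ) : ℕ :=
  Nat.card {m : Multiset (ℕ × ℕ) //
    (∀ p ∈ m, 0 < p.1 ∧ p.2 < d ∧ (Odd p.1 → p.2 = 0)) ∧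
    (m.map Prod.fst).sum = n}


/-! ## Part 1: the generating function of `genCubic 3` -/

namespace Cubic

open PowerSeries
open scoped PowerSeries.WithPiTopology

/-- Multisets of positive integers. -/
abbrev Pos : Type := {s : Multiset ℕ // ∀ p ∈ s, 0 < p}

/-- Counting series of a weighted type. -/
noncomputable def gf (R : Type*) [CommRing R] {α : Type} (wt : α → ℕ) : R⟦X⟧ :=
  PowerSeries.mk fun n => (Nat.card {a // wt a = n} : R)

theorem gf_prod (R : Type*) [CommRing R] {α β : Type} (w : α → ℕ) (v : β → ℕ)
    (hw : ∀ n, Finite {a // w a = n}) (hv : ∀ n, Finite {a // v a = n}) :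
    gf R (fun p : α × β => w p.1 + v p.2) = gf R w * gf R v := by
  ext n
  rw [coeff_mul]
  simp only [gf, coeff_mk]
  let e : {p : α × β // w p.1 + v p.2 = n} ≃
      Σ x : Finset.HasAntidiagonal.antidiagonal n, {a // w a = x.1.1} × {b // v b = x.1.2} :=
    { toFun := fun p => ⟨⟨(w p.1.1, v p.1.2), by simpa using p.2⟩, ⟨p.1.1, rfl⟩, ⟨p.1.2, rfl⟩⟩
      invFun := fun s => ⟨(s.2.1.1, s.2.2.1), by
        rw [s.2.1.2, s.2.2.2]; exact Finset.HasAntidiagonal.mem_antidiagonal.1 s.1.2⟩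
      left_inv := fun p => rfl
      right_inv := by
        rintro ⟨⟨⟨i, j⟩, h⟩, ⟨a, ha⟩, ⟨b, hb⟩⟩
        change w a = i at ha
        change v b = j at hb
        subst ha
        subst hb
        rfl }
  rw [Nat.card_congr e, Nat.card_sigma]
  push_cast
  rw [← Finset.sum_coe_sort (Finset.HasAntidiagonal.antidiagonal n)]
  refine Finset.sum_congr rfl fun x _ => ?_
  rw [Nat.card_prod]
  push_cast
  rfl

theorem gf_prod_finite {α β : Type} (w : α → ℕ) (v : β → ℕ)
    (hw : ∀ n, Finite {a // w a = n}) (hv : ∀ n, Finite {a // v a = n}) (n : ℕ) :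
    Finite {p : α × β // w p.1 + v p.2 = n} := by
  let f : {p : α × β // w p.1 + v p.2 = n} →
      Σ x : Finset.HasAntidiagonal.antidiagonal n, {a // w a = x.1.1} × {b // v b = x.1.2} :=
    fun p => ⟨⟨(w p.1.1, v p.1.2), by simpa using p.2⟩, ⟨p.1.1, rfl⟩, ⟨p.1.2, rfl⟩⟩
  refine Finite.of_injective f ?_
  intro p q h
  have := congrArg (fun s : Σ x : Finset.HasAntidiagonal.antidiagonal n,
      {a // w a = x.1.1} × {b // v b = x.1.2} => (s.2.1.1, s.2.2.1)) h
  exact Subtype.ext this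

/-- Partitions of `n` as multisets. -/
def partEquiv (n : ℕ) : {s : Pos // s.1.sum = n} ≃ n.Partition where
  toFun s := ⟨s.1.1, fun hi => s.1.2 _ hi, s.2⟩
  invFun p := ⟨⟨p.parts, fun _ hi => p.parts_pos hi⟩, p.parts_sum⟩
  left_inv _ := rfl
  right_inv _ := rfl

theorem finite_sum (n : ℕ) : Finite {s : Pos // s.1.sum = n} :=
  Finite.of_equiv _ (partEquiv n).symm

theorem finite_two_sum (n : ℕ) : Finite {s : Pos // 2 * s.1.sum = n} := by
  have := finite_sum (n / 2)
  refine Finite.of_injective (β := {s : Pos // s.1.sum = n / 2}) (fun s => ⟨s.1, by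
    have := s.2; omega⟩) ?_
  intro a b h
  have := congrArg Subtype.val h
  exact Subtype.ext this

/-- The partition generating function. -/
noncomputable def P (R : Type*) [CommRing R] : R⟦X⟧ := gf R (fun s : Pos => s.1.sum)

theorem gf_two (R : Type*) [CommRing R] :
    gf R (fun s : Pos => 2 * s.1.sum) = expand 2 two_ne_zero (P R) := by
  ext n
  rw [coeff_expand]
  split_ifs with h
  · obtain ⟨k, rfl⟩ := h
    simp only [P, gf, coeff_mk]
    rw [Nat.mul_div_cancel_left _ two_pos]
    congr 1
    exact Nat.card_congr (Equiv.subtypeEquivRight fun s => by omega)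
  · simp only [gf, coeff_mk]
    have : IsEmpty {s : Pos // 2 * s.1.sum = n} := ⟨fun s => h ⟨_, s.2.symm⟩⟩
    simp

/-- The pairs that may occur in a coloured partition. -/
abbrev Ok (p : ℕ × ℕ) : Prop := 0 < p.1 ∧ p.2 < 3 ∧ (Odd p.1 → p.2 = 0)

theorem sum_two_mul (s : Multiset ℕ) : (s.map fun x => 2 * x).sum = 2 * s.sum := by
  rw [Multiset.sum_map_mul_left, Multiset.map_id']

/-- Splitting a coloured partition by colours. -/
noncomputable def colEquiv : {m : Multiset (ℕ × ℕ) // ∀ p ∈ m, Ok p} ≃ Pos × (Pos × Pos) where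
  toFun m := (⟨(m.1.filter (fun p => p.2 = 0)).map Prod.fst, by
      intro p hp
      obtain ⟨a, ha, rfl⟩ := Multiset.mem_map.1 hp
      exact (m.2 a (Multiset.mem_filter.1 ha).1).1⟩,
    ⟨(m.1.filter (fun p => p.2 = 1)).map (fun p => p.1 / 2), by
      intro p hp
      obtain ⟨a, ha, rfl⟩ := Multiset.mem_map.1 hp
      obtain ⟨h1, h2⟩ := Multiset.mem_filter.1 ha
      obtain ⟨h3, h4, h5⟩ := m.2 a h1
      rcases Nat.even_or_odd a.1 with h | h
      · obtain ⟨k, hk⟩ := h; omega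
      · have := h5 h; omega⟩,
    ⟨(m.1.filter (fun p => p.2 = 2)).map (fun p => p.1 / 2), by
      intro p hp
      obtain ⟨a, ha, rfl⟩ := Multiset.mem_map.1 hp
      obtain ⟨h1, h2⟩ := Multiset.mem_filter.1 ha
      obtain ⟨h3, h4, h5⟩ := m.2 a h1
      rcases Nat.even_or_odd a.1 with h | h
      · obtain ⟨k, hk⟩ := h; omega
      · have := h5 h; omega⟩)
  invFun t := ⟨t.1.1.map (fun x => (x, 0)) + (t.2.1.1.map (fun x => (2 * x, 1)) +
      t.2.2.1.map (fun x => (2 * x, 2))), by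
    intro p hp
    rw [Multiset.mem_add, Multiset.mem_add, Multiset.mem_map, Multiset.mem_map,
      Multiset.mem_map] at hp
    rcases hp with ⟨a, ha, rfl⟩ | ⟨a, ha, rfl⟩ | ⟨a, ha, rfl⟩
    · exact ⟨t.1.2 a ha, by simp, fun _ => rfl⟩
    · have := t.2.1.2 a ha
      exact ⟨by simpa using this, by simp, fun h => absurd h (by simp)⟩
    · have := t.2.2.2 a ha
      exact ⟨by simpa using this, by simp, fun h => absurd h (by simp)⟩⟩
  left_inv := by
    rintro ⟨m, hm⟩
    apply Subtype.ext
    simp only [Multiset.map_map, Function.comp_def]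
    induction m using Multiset.induction with
    | empty => simp
    | cons a s ih =>
      have ih' := ih (fun p hp => hm p (Multiset.mem_cons_of_mem hp))
      obtain ⟨h3, h4, h5⟩ := hm a (Multiset.mem_cons_self a s)
      obtain ⟨x, c⟩ := a
      simp only at h3 h4 h5
      interval_cases c
      · simp [ih']
      · have hx : 2 * (x / 2) = x := by
          rcases Nat.even_or_odd x with h | h
          · obtain ⟨k, hk⟩ := h; omega
          · have := h5 h; omega
        simp [ih', hx]
      · have hx : 2 * (x / 2) = x := by
          rcases Nat.even_or_odd x with h | h
          · obtain ⟨k, hk⟩ := h; omega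
          · have := h5 h; omega
        simp [ih', hx]
  right_inv := by
    rintro ⟨⟨A, hA⟩, ⟨B, hB⟩, ⟨D, hD⟩⟩
    simp [Multiset.filter_add, Multiset.filter_map]

theorem genCubic_eq (R : Type*) [CommRing R] (n : ℕ) :
    (genCubic 3 n : R) =
      coeff n (P R * (expand 2 two_ne_zero (P R) * expand 2 two_ne_zero (P R))) := by
  rw [← gf_two, ← gf_prod R _ _ finite_two_sum finite_two_sum, P,
    ← gf_prod R _ _ finite_sum (gf_prod_finite _ _ finite_two_sum finite_two_sum)]
  simp only [gf, coeff_mk, genCubic]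
  congr 1
  refine Nat.card_congr (((Equiv.subtypeSubtypeEquivSubtypeInter _ _).symm).trans ?_)
  refine Equiv.subtypeEquiv colEquiv.symm.symm ?_
  intro m
  obtain ⟨t, rfl⟩ := colEquiv.symm.surjective m
  simp only [Equiv.symm_symm, Equiv.apply_symm_apply]
  simp [colEquiv, sum_two_mul, Multiset.map_map]

theorem P_mul_euler (R : Type*) [CommRing R] [NoZeroDivisors R] :
    P R * pentagonalSeries R = 1 := by
  nontriviality R
  let _ : TopologicalSpace R := ⊥
  have _ : DiscreteTopology R := ⟨rfl⟩
  have h1 := Nat.Partition.hasProd_powerSeriesMk_card_restricted R (fun _ => True)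
  have h2 := PowerSeries.WithPiTopology.hasProd_one_sub_X_pow R
  have h3 := h1.mul h2
  have e : (PowerSeries.mk fun n ↦ ((Nat.Partition.restricted n (fun _ => True)).card : R)) = P R := by
    ext n
    simp only [P, gf, coeff_mk]
    rw [Nat.card_congr (partEquiv n), Nat.card_eq_fintype_card]
    simp [Nat.Partition.restricted]
  rw [e] at h3
  refine h3.unique ?_
  convert hasProd_one using 2 with i
  simp only [if_true, pow_mul]
  exact PowerSeries.WithPiTopology.tsum_pow_mul_one_sub_of_constantCoeff_eq_zero (by simp)

end Cubic

/-! ## Part 2: the finite Jacobi triple product -/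

namespace Cubic

/-- Triangular numbers, for all integers. -/
def T (n : ℤ) : ℕ := (n * (n + 1) / 2).toNat

theorem two_T (n : ℤ) : 2 * (T n : ℤ) = n * (n + 1) := by
  have h : (0 : ℤ) ≤ n * (n + 1) := by
    rcases le_or_gt 0 n with h | h
    · positivity
    · nlinarith
  have h2 : (2 : ℤ) ∣ n * (n + 1) := (Int.even_mul_succ_self n).two_dvd
  unfold T
  rw [Int.toNat_of_nonneg (by omega)]
  omega

theorem T_step (n : ℤ) : (T n : ℤ) = T (n - 1) + n := by
  have h1 := two_T n
  have h2 := two_T (n - 1)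
  have : (n - 1) * (n - 1 + 1) = n * (n + 1) - 2 * n := by ring
  omega

theorem T_neg (n : ℤ) : T (-1 - n) = T n := by
  have h1 := two_T n
  have h2 := two_T (-1 - n)
  have : (-1 - n) * (-1 - n + 1) = n * (n + 1) := by ring
  omega

theorem abs_le_T (n : ℤ) : n ≤ T n ∧ -n ≤ T n + 1 := by
  have h1 := two_T n
  constructor <;> nlinarith [sq_nonneg n, sq_nonneg (n - 1), sq_nonneg (n + 1), sq_nonneg (n + 2)]

variable {A : Type*} [CommRing A]

/-- Weights in Ramanujan's theta function `f(a, b)`. -/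
def W (a b : A) (n : ℤ) : A := a ^ T n * b ^ T (n - 1)

theorem W_up (a b : A) (N : ℕ) (n : ℤ) (k : ℕ) (h : (k : ℤ) = N + 1 - n) :
    a * (a * b) ^ N * W a b (n - 1) = (a * b) ^ k * W a b n := by
  have h1 := T_step n
  have h2 := T_step (n - 1)
  unfold W
  have e1 : T (n - 1) + N + 1 = k + T n := by omega
  have e2 : T (n - 1 - 1) + N = k + T (n - 1) := by omega
  calc _ = a ^ (T (n - 1) + N + 1) * b ^ (T (n - 1 - 1) + N) := by ring
    _ = a ^ (k + T n) * b ^ (k + T (n - 1)) := by rw [e1, e2]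
    _ = _ := by ring

theorem W_down (a b : A) (N : ℕ) (n : ℤ) (k : ℕ) (h : (k : ℤ) = N + 1 + n) :
    b * (a * b) ^ N * W a b (n + 1) = (a * b) ^ k * W a b n := by
  have h1 := T_step (n + 1)
  have h2 := T_step n
  rw [add_sub_cancel_right] at h1
  unfold W
  have e1 : T (n + 1) + N = k + T n := by omega
  have e2 : T n + N + 1 = k + T (n - 1) := by omega
  rw [add_sub_cancel_right]
  calc _ = a ^ (T (n + 1) + N) * b ^ (T n + N + 1) := by ring
    _ = a ^ (k + T n) * b ^ (k + T (n - 1)) := by rw [e1, e2]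
    _ = _ := by ring

/-- `u k` behaves like `1 / (q; q)_k`. -/
structure IsInvPoch (q : A) (u : ℤ → A) : Prop where
  neg : ∀ k, k < 0 → u k = 0
  zero : u 0 = 1
  step : ∀ k : ℕ, (1 - q ^ (k + 1)) * u (k + 1) = u k

theorem IsInvPoch.pred {q : A} {u : ℤ → A} (hu : IsInvPoch q u) (k : ℕ) :
    u (k - 1) = (1 - q ^ k) * u k := by
  rcases k with _ | k
  · simp [hu.neg]
  · have := hu.step k
    push_cast
    rw [add_sub_cancel_right, this]

/-- The summand identity behind the induction. -/
theorem key_step {q : A} {u : ℤ → A} (hu : IsInvPoch q u) (N : ℕ) (x y : ℕ)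
    (h : x + y = 2 * N + 2) :
    (1 + q ^ (2 * N + 1)) * (u (x - 1) * u (y - 1)) + q ^ y * (u (x - 2) * u y)
      + q ^ x * (u x * u (y - 2)) =
    (1 - q ^ (2 * N + 1)) * (1 - q ^ (2 * N + 2)) * (u x * u y) := by
  have aux : u ((2 * N + 2 : ℕ) - 2) =
      (1 - q ^ (2 * N + 1)) * ((1 - q ^ (2 * N + 2)) * u (2 * N + 2 : ℕ)) := by
    rw [← hu.pred (2 * N + 2), show ((2 * N + 2 : ℕ) : ℤ) - 1 = (2 * N + 1 : ℕ) by push_cast; ring,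
      ← hu.pred (2 * N + 1)]
    congr 1
    push_cast
    ring
  rcases x with _ | x
  · have hy : y = 2 * N + 2 := by omega
    subst hy
    rw [aux, hu.neg (((0 : ℕ) : ℤ) - 1) (by norm_num), hu.neg (((0 : ℕ) : ℤ) - 2) (by norm_num)]
    ring
  rcases y with _ | y
  · have hx : x + 1 = 2 * N + 2 := by omega
    rw [hx, aux, hu.neg (((0 : ℕ) : ℤ) - 1) (by norm_num),
      hu.neg (((0 : ℕ) : ℤ) - 2) (by norm_num)]
    ring
  have e : ∀ k : ℕ, u ((k + 1 : ℕ) - 1) = (1 - q ^ (k + 1)) * u (k + 1 : ℕ) ∧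
      u ((k + 1 : ℕ) - 2) = (1 - q ^ k) * ((1 - q ^ (k + 1)) * u (k + 1 : ℕ)) := by
    intro k
    refine ⟨hu.pred (k + 1), ?_⟩
    rw [← hu.pred (k + 1), show ((k + 1 : ℕ) : ℤ) - 1 = k by push_cast; ring, ← hu.pred k]
    congr 1
    push_cast
    ring
  rw [(e x).1, (e x).2, (e y).1, (e y).2]
  have e2 : q ^ (2 * N) = q ^ x * q ^ y := by
    rw [← pow_add]; congr 1; omega
  rw [pow_succ q (2 * N), show 2 * N + 2 = 2 * N + 1 + 1 by ring, pow_succ q (2 * N + 1),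
    pow_succ q (2 * N), e2, pow_succ q x, pow_succ q y]
  ring

/-- The finite theta sum. -/
noncomputable def S (a b : A) (u : ℤ → A) (N : ℕ) : A :=
  ∑ᶠ n : ℤ, W a b n * (u (N + n) * u (N - n))

theorem fin_supp {q : A} {u : ℤ → A} (hu : IsInvPoch q u) (w : ℤ → A) (N : ℤ) :
    (Function.support fun n : ℤ => w n * (u (N + n) * u (N - n))).Finite := by
  refine (Set.finite_Icc (-N) N).subset ?_
  intro n hn
  by_contra hc
  apply hn
  rw [Set.mem_Icc, not_and_or] at hc
  rcases hc with h | h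
  · simp [hu.neg (N + n) (by omega)]
  · simp [hu.neg (N - n) (by omega)]

theorem S_succ {a b : A} {u : ℤ → A} (hu : IsInvPoch (a * b) u) (N : ℕ) :
    (1 + a * (a * b) ^ N) * (1 + b * (a * b) ^ N) * S a b u N =
    (1 - (a * b) ^ (2 * N + 1)) * (1 - (a * b) ^ (2 * N + 2)) * S a b u (N + 1) := by
  have f1 := fin_supp hu (W a b) N
  have f2 := fin_supp hu (W a b) (N + 1 : ℕ)
  set g : ℤ → A := fun n => W a b n * (u (N + n) * u (N - n)) with hg
  have sh1 : S a b u N = ∑ᶠ n : ℤ, g (n - 1) :=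
    (finsum_comp_equiv (Equiv.subRight (1 : ℤ)) (f := g)).symm
  have sh2 : S a b u N = ∑ᶠ n : ℤ, g (n + 1) :=
    (finsum_comp_equiv (Equiv.addRight (1 : ℤ)) (f := g)).symm
  have f3 : (Function.support fun n : ℤ => g (n - 1)).Finite :=
    Set.Finite.preimage ((Equiv.subRight (1 : ℤ)).injective.injOn) f1
  have f4 : (Function.support fun n : ℤ => g (n + 1)).Finite :=
    Set.Finite.preimage ((Equiv.addRight (1 : ℤ)).injective.injOn) f1
  have l0 : (1 + a * (a * b) ^ N) * (1 + b * (a * b) ^ N) * S a b u N =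
      (1 + (a * b) ^ (2 * N + 1)) * ∑ᶠ n : ℤ, g n + a * (a * b) ^ N * ∑ᶠ n : ℤ, g (n - 1)
        + b * (a * b) ^ N * ∑ᶠ n : ℤ, g (n + 1) := by
    rw [← sh1, ← sh2]
    change _ = (1 + (a * b) ^ (2 * N + 1)) * S a b u N + _ + _
    ring
  rw [l0, S, mul_finsum' _ _ f2, mul_finsum' _ _ f1, mul_finsum' _ _ f3, mul_finsum' _ _ f4,
    ← finsum_add_distrib, ← finsum_add_distrib]
  · refine finsum_congr fun n => ?_
    simp only [hg]
    by_cases hx : (N : ℤ) + 1 + n < 0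
    · rw [hu.neg (N + n) (by omega), hu.neg (N + (n - 1)) (by omega),
        hu.neg (N + (n + 1)) (by omega), hu.neg ((N + 1 : ℕ) + n) (by push_cast; omega)]
      ring
    by_cases hy : (N : ℤ) + 1 - n < 0
    · rw [hu.neg (N - n) (by omega), hu.neg (N - (n - 1)) (by omega),
        hu.neg (N - (n + 1)) (by omega), hu.neg ((N + 1 : ℕ) - n) (by push_cast; omega)]
      ring
    obtain ⟨x, hx'⟩ := Int.eq_ofNat_of_zero_le (not_lt.1 hx)
    obtain ⟨y, hy'⟩ := Int.eq_ofNat_of_zero_le (not_lt.1 hy)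
    have key := key_step hu N x y (by omega)
    have w1 := W_up a b N n y hy'.symm
    have w2 := W_down a b N n x hx'.symm
    rw [show (N : ℤ) + n = x - 1 by omega, show (N : ℤ) - n = y - 1 by omega,
      show (N : ℤ) + (n - 1) = x - 2 by omega, show (N : ℤ) - (n - 1) = y by omega,
      show (N : ℤ) + (n + 1) = x by omega, show (N : ℤ) - (n + 1) = y - 2 by omega,
      show ((N + 1 : ℕ) : ℤ) + n = x by push_cast; omega,
      show ((N + 1 : ℕ) : ℤ) - n = y by push_cast; omega]
    linear_combination W a b n * key + (u (x - 2) * u y) * w1 + (u x * u (y - 2)) * w2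
  · exact ((f1.subset (Function.support_mul_subset_right _ _)).union
      (f3.subset (Function.support_mul_subset_right _ _))).subset (Function.support_add _ _)
  · exact (f4.subset (Function.support_mul_subset_right _ _))
  · exact (f1.subset (Function.support_mul_subset_right _ _))
  · exact (f3.subset (Function.support_mul_subset_right _ _))

theorem finite_jtp {a b : A} {u : ℤ → A} (hu : IsInvPoch (a * b) u) (N : ℕ) :
    ∏ k ∈ Finset.range N, ((1 + a * (a * b) ^ k) * (1 + b * (a * b) ^ k)) =
      (∏ k ∈ Finset.range (2 * N), (1 - (a * b) ^ (k + 1))) * S a b u N := by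
  induction N with
  | zero =>
    have : S a b u 0 = 1 := by
      unfold S
      rw [finsum_eq_single _ 0]
      · simp [hu.zero, W, T]
      · intro n hn
        rcases lt_or_gt_of_ne hn with h | h
        · simp [hu.neg n h]
        · simp [hu.neg (-n) (by omega)]
    simp [this]
  | succ N ih =>
    rw [Finset.prod_range_succ, ih, show 2 * (N + 1) = 2 * N + 1 + 1 by ring,
      Finset.prod_range_succ, Finset.prod_range_succ]
    linear_combination (∏ k ∈ Finset.range (2 * N), (1 - (a * b) ^ (k + 1))) * S_succ hu N

end Cubic

/-! ## Part 3: passing to the limit -/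

namespace Cubic

open PowerSeries

variable {K : Type*} [Field K]

/-- Reduction modulo `X ^ m`. -/
noncomputable abbrev pr (K : Type*) [Field K] (m : ℕ) :
    K⟦X⟧ →+* K⟦X⟧ ⧸ Ideal.span {(X : K⟦X⟧) ^ m} :=
  Ideal.Quotient.mk (Ideal.span {(X : K⟦X⟧) ^ m})

theorem pr_eq {m : ℕ} {f g : K⟦X⟧} : pr K m f = pr K m g ↔ X ^ m ∣ f - g := by
  rw [Ideal.Quotient.eq, Ideal.mem_span_singleton]

theorem pr_zero {m : ℕ} {f : K⟦X⟧} : pr K m f = 0 ↔ X ^ m ∣ f := by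
  rw [Ideal.Quotient.eq_zero_iff_mem, Ideal.mem_span_singleton]

theorem eq_of_pr {f g : K⟦X⟧} (h : ∀ m, pr K m f = pr K m g) : f = g := by
  ext n
  have := pr_eq.1 (h (n + 1))
  rw [X_pow_dvd_iff] at this
  have := this n (by omega)
  rwa [map_sub, sub_eq_zero] at this

/-- Finite Euler products. -/
noncomputable def poch (K : Type*) [Field K] (r N : ℕ) : K⟦X⟧ :=
  ∏ k ∈ Finset.range N, (1 - (X ^ r) ^ (k + 1))

/-- Euler's function `f_r`. -/
noncomputable def E (K : Type*) [Field K] (r : ℕ) (hr : r ≠ 0) : K⟦X⟧ :=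
  expand r hr (pentagonalSeries K)

theorem expand_poch (r N : ℕ) (hr : r ≠ 0) : expand r hr (poch K 1 N) = poch K r N := by
  simp [poch, map_prod]

theorem poch_one_stable (m N : ℕ) (h : m ≤ N) : pr K (m + 1) (poch K 1 N) = pr K (m + 1) (poch K 1 m) := by
  induction N, h using Nat.le_induction with
  | base => rfl
  | succ N hN ih =>
    rw [poch, Finset.prod_range_succ, ← poch, map_mul, ih]
    have : pr K (m + 1) ((X ^ 1) ^ (N + 1)) = 0 := by
      rw [pr_zero, pow_one]
      exact pow_dvd_pow _ (by omega)
    rw [map_sub, this, map_one]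
    ring

theorem poch_one_lim (m N : ℕ) (h : m ≤ N) :
    pr K (m + 1) (poch K 1 N) = pr K (m + 1) (pentagonalSeries K) := by
  rw [pr_eq, X_pow_dvd_iff]
  intro j hj
  rw [map_sub, sub_eq_zero]
  have h1 := coeff_prod_one_sub_X_pow_eventually_eq K j
  rw [Filter.eventually_atTop] at h1
  obtain ⟨s, hs⟩ := h1
  obtain ⟨M, hM⟩ := s.exists_nat_subset_range
  have h2 := hs (Finset.range (max M N)) (hM.trans (by simp))
  rw [← h2]
  have h3 : poch K 1 (max M N) = ∏ n ∈ Finset.range (max M N), (1 - X ^ (n + 1)) := by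
    simp [poch]
  rw [← h3]
  have h4 := (poch_one_stable (K := K) m N h).trans
    (poch_one_stable m (max M N) (by omega)).symm
  rw [pr_eq, X_pow_dvd_iff] at h4
  have := h4 j hj
  rwa [map_sub, sub_eq_zero] at this

theorem poch_lim {r : ℕ} (hr : r ≠ 0) (m N : ℕ) (h : m ≤ N) :
    pr K m (poch K r N) = pr K m (E K r hr) := by
  have := pr_eq.1 (poch_one_lim (K := K) m N h)
  obtain ⟨g, hg⟩ := this
  rw [pr_eq, E, ← expand_poch r N hr, ← map_sub, hg, map_mul, map_pow, expand_X, ← pow_mul]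
  refine Dvd.dvd.mul_right (pow_dvd_pow _ ?_) _
  have : 1 ≤ r := Nat.one_le_iff_ne_zero.2 hr
  nlinarith

theorem poch_const {r : ℕ} (hr : r ≠ 0) (N : ℕ) : constantCoeff (poch K r N) = 1 := by
  simp [poch, map_prod, hr]

theorem E_const {r : ℕ} (hr : r ≠ 0) : constantCoeff (E K r hr) = 1 := by
  have := pr_eq.1 (poch_lim (K := K) hr 1 1 le_rfl)
  rw [X_pow_dvd_iff] at this
  have := this 0 (by norm_num)
  rw [map_sub, sub_eq_zero, coeff_zero_eq_constantCoeff, poch_const hr] at this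
  exact this.symm

theorem E_mul_inv {r : ℕ} (hr : r ≠ 0) : E K r hr * (E K r hr)⁻¹ = 1 :=
  PowerSeries.mul_inv_cancel _ (by rw [E_const]; exact one_ne_zero)

theorem E_ne {r : ℕ} (hr : r ≠ 0) : E K r hr ≠ 0 := by
  intro h
  have := E_const (K := K) hr
  simp [h] at this

/-- Inverse Euler products. -/
noncomputable def ui (K : Type*) [Field K] (r : ℕ) (k : ℤ) : K⟦X⟧ :=
  if 0 ≤ k then (poch K r k.toNat)⁻¹ else 0

theorem poch_mul_inv {r : ℕ} (hr : r ≠ 0) (N : ℕ) : poch K r N * (poch K r N)⁻¹ = 1 :=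
  PowerSeries.mul_inv_cancel _ (by rw [poch_const hr]; exact one_ne_zero)

theorem ui_inv {r : ℕ} (hr : r ≠ 0) : IsInvPoch ((X : K⟦X⟧) ^ r) (ui K r) where
  neg k hk := by simp [ui, hk]
  zero := by simp [ui, poch]
  step k := by
    have h1 := poch_mul_inv (K := K) hr k
    have h2 := poch_mul_inv (K := K) hr (k + 1)
    have h3 : poch K r (k + 1) = poch K r k * (1 - (X ^ r) ^ (k + 1)) := Finset.prod_range_succ _ _
    have e1 : ui K r k = (poch K r k)⁻¹ := by simp [ui]
    have e2 : ui K r (k + 1) = (poch K r (k + 1))⁻¹ := by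
      rw [ui, if_pos (by positivity)]; rfl
    rw [e1, e2]
    have h4 : poch K r k ≠ 0 := left_ne_zero_of_mul_eq_one h1
    apply mul_left_cancel₀ h4
    rw [h1]
    linear_combination h2 - (poch K r (k + 1))⁻¹ * h3

theorem ui_lim {r : ℕ} (hr : r ≠ 0) (m : ℕ) (k : ℤ) (h : (m : ℤ) ≤ k) :
    pr K m (ui K r k) = pr K m (E K r hr)⁻¹ := by
  have h1 := poch_lim (K := K) hr m k.toNat (by omega)
  have h2 := congrArg (pr K m) (poch_mul_inv (K := K) hr k.toNat)
  have h3 := congrArg (pr K m) (E_mul_inv (K := K) hr)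
  rw [map_mul] at h2 h3
  rw [ui, if_pos (by omega)]
  rw [h1, map_one] at h2
  rw [map_one] at h3
  calc _ = pr K m (poch K r k.toNat)⁻¹ * (pr K m (E K r hr) * pr K m (E K r hr)⁻¹) := by
        rw [h3, mul_one]
    _ = (pr K m (E K r hr) * pr K m (poch K r k.toNat)⁻¹) * pr K m (E K r hr)⁻¹ := by ring
    _ = _ := by rw [h2, one_mul]

theorem jtp_limit {r : ℕ} (hr : r ≠ 0) (w : ℤ → K⟦X⟧)
    (hw : ∀ n : ℤ, ∃ d : ℕ, |n| ≤ (d : ℤ) + 1 ∧ X ^ d ∣ w n) (Θ : K⟦X⟧)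
    (hΘ : ∀ m : ℕ, pr K m Θ = pr K m (∑ n ∈ Finset.Icc (-(m + 1 : ℤ)) (m + 1), w n))
    (Q : K⟦X⟧) (Qn : ℕ → K⟦X⟧) (hQ : ∀ m N : ℕ, m + 1 ≤ N → pr K m (Qn N) = pr K m Q)
    (h : ∀ N, Qn N = poch K r (2 * N) * ∑ᶠ n : ℤ, w n * (ui K r (N + n) * ui K r (N - n))) :
    E K r hr * Q = Θ := by
  refine eq_of_pr fun m => ?_
  set N := 2 * m + 2 with hN
  have h1 : ∑ᶠ n : ℤ, w n * (ui K r (N + n) * ui K r (N - n)) =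
      ∑ n ∈ Finset.Icc (-(N : ℤ)) N, w n * (ui K r (N + n) * ui K r (N - n)) := by
    apply finsum_eq_sum_of_support_subset
    intro n hn
    by_contra hc
    apply hn
    rw [Finset.coe_Icc, Set.mem_Icc, not_and_or] at hc
    rcases hc with h | h
    · simp [(ui_inv (K := K) hr).neg (N + n) (by omega)]
    · simp [(ui_inv (K := K) hr).neg (N - n) (by omega)]
  have h2 : pr K m (∑ n ∈ Finset.Icc (-(N : ℤ)) N, w n * (ui K r (N + n) * ui K r (N - n))) =
      pr K m Θ * (pr K m (E K r hr)⁻¹ * pr K m (E K r hr)⁻¹) := by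
    rw [hΘ, map_sum, map_sum, Finset.sum_mul]
    symm
    apply Finset.sum_subset_zero_on_sdiff
    · apply Finset.Icc_subset_Icc <;> omega
    · intro n hn
      rw [Finset.mem_sdiff, Finset.mem_Icc, Finset.mem_Icc] at hn
      obtain ⟨d, hd, hx⟩ := hw n
      rw [abs_le] at hd
      have : pr K m (w n) = 0 := pr_zero.2 ((pow_dvd_pow _ (by omega)).trans hx)
      rw [map_mul, this, zero_mul]
    · intro n hn
      rw [Finset.mem_Icc] at hn
      rw [map_mul, map_mul, ui_lim hr m _ (by omega), ui_lim hr m _ (by omega)]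
  have h3 := congrArg (pr K m) (h N)
  rw [hQ m N (by omega), map_mul, h1, h2, poch_lim hr m (2 * N) (by omega)] at h3
  have h4 := congrArg (pr K m) (E_mul_inv (K := K) hr)
  rw [map_mul, map_one] at h4
  rw [map_mul, h3]
  linear_combination pr K m Θ * (pr K m (E K r hr) * pr K m (E K r hr)⁻¹ + 1) * h4

/-- Theta series. -/
noncomputable def theta (c : ℤ → K) (e : ℤ → ℕ) : K⟦X⟧ :=
  PowerSeries.mk fun k => ∑ᶠ n ∈ {n : ℤ | e n = k}, c n

theorem theta_lim (c : ℤ → K) (e : ℤ → ℕ) (he : ∀ n, |n| ≤ e n + 1) (m : ℕ) :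
    pr K m (theta c e) =
      pr K m (∑ n ∈ Finset.Icc (-(m + 1 : ℤ)) (m + 1), C (c n) * X ^ e n) := by
  rw [pr_eq, X_pow_dvd_iff]
  intro k hk
  rw [map_sub, sub_eq_zero, theta, coeff_mk, map_sum]
  simp only [coeff_C_mul, coeff_X_pow]
  have h1 : ∑ᶠ n ∈ {n : ℤ | e n = k}, c n =
      ∑ n ∈ (Finset.Icc (-(m + 1 : ℤ)) (m + 1)).filter (fun n => e n = k), c n := by
    apply finsum_mem_eq_sum_of_subset
    · rintro n ⟨hn, -⟩
      have hn' : e n = k := hn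
      have := abs_le.1 (he n)
      rw [Finset.coe_filter]
      refine ⟨Finset.mem_Icc.2 ⟨by omega, by omega⟩, hn'⟩
    · intro n hn
      exact (Finset.mem_filter.1 hn).2
  rw [h1, Finset.sum_filter]
  refine Finset.sum_congr rfl fun n _ => ?_
  by_cases h : e n = k
  · simp [h]
  · simp [h, Ne.symm h]

theorem theta_mul (c c' : ℤ → K) (e e' : ℤ → ℕ) (he : ∀ n, |n| ≤ e n + 1)
    (he' : ∀ n, |n| ≤ e' n + 1) (N : ℕ) :
    coeff N (theta c e * theta c' e') =
      ∑ᶠ p ∈ {p : ℤ × ℤ | e p.1 + e' p.2 = N}, c p.1 * c' p.2 := by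
  set B := Finset.Icc (-((N + 1 : ℕ) + 1 : ℤ)) ((N + 1 : ℕ) + 1) with hB
  have h0 : pr K (N + 1) (theta c e * theta c' e') =
      pr K (N + 1) ((∑ n ∈ B, C (c n) * X ^ e n) * (∑ n ∈ B, C (c' n) * X ^ e' n)) := by
    rw [map_mul, map_mul, theta_lim c e he, theta_lim c' e' he']
  rw [pr_eq, X_pow_dvd_iff] at h0
  have h2 := h0 N (by omega)
  rw [map_sub, sub_eq_zero] at h2
  rw [h2, Finset.sum_mul_sum, ← Finset.sum_product', map_sum]
  have h1 : ∑ᶠ p ∈ {p : ℤ × ℤ | e p.1 + e' p.2 = N}, c p.1 * c' p.2 =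
      ∑ p ∈ (B ×ˢ B).filter (fun p => e p.1 + e' p.2 = N), c p.1 * c' p.2 := by
    apply finsum_mem_eq_sum_of_subset
    · rintro ⟨n, n'⟩ ⟨hn, -⟩
      have hn' : e n + e' n' = N := hn
      have h3 := abs_le.1 (he n)
      have h4 := abs_le.1 (he' n')
      rw [Finset.coe_filter]
      refine ⟨Finset.mem_product.2 ⟨Finset.mem_Icc.2 ⟨?_, ?_⟩, Finset.mem_Icc.2 ⟨?_, ?_⟩⟩, hn'⟩ <;>
      push_cast <;> omega
    · intro n hn
      exact (Finset.mem_filter.1 hn).2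
  rw [h1, Finset.sum_filter]
  refine Finset.sum_congr rfl fun p _ => ?_
  rw [show C (c p.1) * X ^ e p.1 * (C (c' p.2) * X ^ e' p.2) =
    C (c p.1 * c' p.2) * X ^ (e p.1 + e' p.2) by rw [map_mul]; ring, coeff_C_mul, coeff_X_pow]
  by_cases h : e p.1 + e' p.2 = N
  · simp [h]
  · simp [h, Ne.symm h]

theorem theta_mul_finite (e e' : ℤ → ℕ) (he : ∀ n, |n| ≤ e n + 1)
    (he' : ∀ n, |n| ≤ e' n + 1) (N : ℕ) : {p : ℤ × ℤ | e p.1 + e' p.2 = N}.Finite := by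
  refine ((Set.finite_Icc (-(N + 1 : ℤ)) (N + 1)).prod
    (Set.finite_Icc (-(N + 1 : ℤ)) (N + 1))).subset ?_
  rintro ⟨n, n'⟩ hn
  have hn' : e n + e' n' = N := hn
  have h3 := abs_le.1 (he n)
  have h4 := abs_le.1 (he' n')
  refine ⟨Set.mem_Icc.2 ⟨?_, ?_⟩, Set.mem_Icc.2 ⟨?_, ?_⟩⟩ <;> dsimp only <;> omega

end Cubic

/-! ## Part 4: the theta function identities -/

namespace Cubic

open PowerSeries

variable {K : Type*} [Field K]

theorem T_add (n : ℤ) : ((T n + T (n - 1) : ℕ) : ℤ) = n * n := by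
  have h1 := two_T n
  have h2 := two_T (n - 1)
  have h3 : (n - 1) * (n - 1 + 1) = n * n - n := by ring
  have h4 : n * (n + 1) = n * n + n := by ring
  push_cast
  omega

theorem sq_le (n : ℤ) : |n| ≤ ((T n + T (n - 1) : ℕ) : ℤ) + 1 := by
  rw [T_add, abs_le]
  constructor <;> nlinarith [sq_nonneg (n - 1), sq_nonneg (n + 1)]

theorem T_le (n : ℤ) : |n| ≤ (T n : ℤ) + 1 := by
  have := abs_le_T n
  rw [abs_le]
  constructor <;> omega

theorem neg_one_T (n : ℤ) : (-1 : K) ^ (T n + T (n - 1)) = (-1) ^ n := by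
  rw [← zpow_natCast, T_add]
  rcases Int.even_or_odd n with h | h
  · rw [h.neg_one_zpow, (h.mul_left n).neg_one_zpow]
  · rw [h.neg_one_zpow, (h.mul h).neg_one_zpow]

theorem pow_dvd_C_mul (c : K) (d : ℕ) : (X : K⟦X⟧) ^ d ∣ C c * X ^ d := Dvd.intro_left _ rfl

/-- Euler's pentagonal number theorem as a theta series. -/
theorem euler_theta : pentagonalSeries K = theta (fun n => (-1) ^ n) pentagonal := by
  ext k
  rw [theta, coeff_mk]
  by_cases h : k ∈ Set.range pentagonal
  · obtain ⟨n, rfl⟩ := h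
    rw [coeff_pentagonalSeries_pentagonal]
    have : {j : ℤ | pentagonal j = pentagonal n} = {n} := by
      ext j
      simp [pentagonal_inj]
    rw [this, finsum_mem_singleton, Int.negOnePow_def]
    rcases Int.even_or_odd n with h | h
    · rw [h.neg_one_zpow, h.neg_one_zpow]; simp
    · rw [h.neg_one_zpow, h.neg_one_zpow]; simp
  · rw [coeff_pentagonalSeries_eq_zero K h]
    have : {j : ℤ | pentagonal j = k} = ∅ := by
      ext j
      simp only [Set.mem_ofPred_eq, Set.mem_empty_iff_false, iff_false]
      exact fun hj => h ⟨j, hj⟩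
    rw [this, finsum_mem_empty]

/-- `2 ψ(q)`. -/
noncomputable def Psi (K : Type*) [Field K] : K⟦X⟧ := theta (fun _ => 1) T

/-- `φ(-q)`. -/
noncomputable def Phi (K : Type*) [Field K] : K⟦X⟧ :=
  theta (fun n => (-1) ^ n) (fun n => T n + T (n - 1))

/-- Jacobi's series for `f_1 ^ 3`. -/
noncomputable def Jac (K : Type*) [Field K] : K⟦X⟧ := theta (fun n : ℤ => -((-1 : K) ^ n * (n : K))) T

theorem prod_plus (N : ℕ) :
    (∏ k ∈ Finset.range N, (1 + (X : K⟦X⟧) ^ (k + 1))) * poch K 1 N = poch K 2 N := by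
  rw [poch, poch, ← Finset.prod_mul_distrib]
  refine Finset.prod_congr rfl fun k _ => ?_
  ring

theorem poch_double (N : ℕ) :
    poch K 1 (2 * N) = poch K 2 N * ∏ k ∈ Finset.range N, (1 - (X : K⟦X⟧) ^ (2 * k + 1)) := by
  induction N with
  | zero => simp [poch]
  | succ N ih =>
    have h1 : poch K 1 (2 * (N + 1)) = poch K 1 (2 * N) * (1 - (X ^ 1) ^ (2 * N + 1)) *
        (1 - (X ^ 1) ^ (2 * N + 1 + 1)) := by
      rw [poch, show 2 * (N + 1) = 2 * N + 1 + 1 by ring, Finset.prod_range_succ,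
        Finset.prod_range_succ, ← poch]
    have h2 : poch K 2 (N + 1) = poch K 2 N * (1 - (X ^ 2) ^ (N + 1)) :=
      Finset.prod_range_succ _ _
    rw [h1, h2, Finset.prod_range_succ, ih]
    ring

theorem psi_eq : E K 1 one_ne_zero * Psi K = 2 * E K 2 two_ne_zero ^ 2 := by
  have hE := E_mul_inv (K := K) one_ne_zero
  have main : E K 1 one_ne_zero *
      (2 * E K 2 two_ne_zero ^ 2 * ((E K 1 one_ne_zero)⁻¹) ^ 2) = Psi K := by
    refine jtp_limit (r := 1) one_ne_zero (fun n => C 1 * X ^ T n)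
      (fun n => ⟨T n, T_le n, pow_dvd_C_mul _ _⟩) _ (theta_lim _ _ T_le) _
      (fun N => ∏ k ∈ Finset.range N, ((1 + X * (X * 1) ^ k) * (1 + 1 * (X * 1) ^ k))) ?_ ?_
    · intro m N hN
      obtain ⟨M, rfl⟩ : ∃ M, N = M + 1 := ⟨N - 1, by omega⟩
      have h1 : (∏ k ∈ Finset.range (M + 1), ((1 + X * (X * 1) ^ k) * (1 + 1 * (X * 1) ^ k))) *
          (poch K 1 (M + 1) * poch K 1 M) = 2 * (poch K 2 (M + 1) * poch K 2 M) := by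
        rw [← prod_plus, ← prod_plus, Finset.prod_mul_distrib,
          Finset.prod_range_succ' (fun k => 1 + 1 * (X * 1) ^ k)]
        simp only [mul_one, one_mul, pow_zero, ← pow_succ']
        ring
      have h2 := congrArg (pr K m) h1
      rw [map_mul, map_mul, map_mul, map_mul, poch_lim one_ne_zero m _ (by omega),
        poch_lim one_ne_zero m _ (by omega), poch_lim two_ne_zero m _ (by omega),
        poch_lim two_ne_zero m _ (by omega)] at h2
      have h4 := congrArg (pr K m) hE
      rw [map_mul, map_one] at h4
      simp only [map_mul, map_pow]
      generalize pr K m (∏ k ∈ Finset.range (M + 1),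
        ((1 + X * (X * 1) ^ k) * (1 + 1 * (X * 1) ^ k))) = Q at *
      linear_combination (pr K m (E K 1 one_ne_zero)⁻¹) ^ 2 * h2 -
        Q * (pr K m (E K 1 one_ne_zero) * pr K m (E K 1 one_ne_zero)⁻¹ + 1) * h4
    · intro N
      have hu : IsInvPoch ((X : K⟦X⟧) * 1) (ui K 1) := by
        have := ui_inv (K := K) one_ne_zero
        rwa [pow_one, ← mul_one X] at this
      have := finite_jtp hu N
      rw [this]
      simp [S, W, poch]
  rw [← main]
  linear_combination 2 * E K 2 two_ne_zero ^ 2 *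
    (E K 1 one_ne_zero * (E K 1 one_ne_zero)⁻¹ + 1) * hE

theorem phi_eq : E K 2 two_ne_zero * Phi K = E K 1 one_ne_zero ^ 2 := by
  have hE := E_mul_inv (K := K) two_ne_zero
  have main : E K 2 two_ne_zero *
      (E K 1 one_ne_zero ^ 2 * ((E K 2 two_ne_zero)⁻¹) ^ 2) = Phi K := by
    refine jtp_limit (r := 2) two_ne_zero (fun n => C ((-1) ^ n) * X ^ (T n + T (n - 1)))
      (fun n => ⟨T n + T (n - 1), sq_le n, pow_dvd_C_mul _ _⟩) _ (theta_lim _ _ sq_le) _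
      (fun N => ∏ k ∈ Finset.range N, ((1 + -X * (-X * -X) ^ k) * (1 + -X * (-X * -X) ^ k))) ?_ ?_
    · intro m N hN
      have h1 : (∏ k ∈ Finset.range N, ((1 + -X * (-X * -X) ^ k) * (1 + -X * (-X * -X) ^ k))) *
          (poch K 2 N * poch K 2 N) = poch K 1 (2 * N) * poch K 1 (2 * N) := by
        rw [poch_double, Finset.prod_mul_distrib]
        have : ∀ k : ℕ, 1 + -(X : K⟦X⟧) * (-X * -X) ^ k = 1 - X ^ (2 * k + 1) := by
          intro k
          rw [neg_mul_neg, ← sq, ← pow_mul]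
          ring
        simp only [this]
        ring
      have h2 := congrArg (pr K m) h1
      rw [map_mul, map_mul, map_mul, poch_lim one_ne_zero m _ (by omega),
        poch_lim two_ne_zero m _ (by omega)] at h2
      have h4 := congrArg (pr K m) hE
      rw [map_mul, map_one] at h4
      simp only [map_mul, map_pow]
      generalize pr K m (∏ k ∈ Finset.range N,
        ((1 + -X * (-X * -X) ^ k) * (1 + -X * (-X * -X) ^ k))) = Q at *
      linear_combination (pr K m (E K 2 two_ne_zero)⁻¹) ^ 2 * h2 -
        Q * (pr K m (E K 2 two_ne_zero) * pr K m (E K 2 two_ne_zero)⁻¹ + 1) * h4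
    · intro N
      have hu : IsInvPoch (-(X : K⟦X⟧) * -X) (ui K 2) := by
        have := ui_inv (K := K) two_ne_zero
        rwa [sq, ← neg_mul_neg] at this
      have := finite_jtp hu N
      rw [this]
      have hW : ∀ n : ℤ, W (-(X : K⟦X⟧)) (-X) n = C ((-1) ^ n) * X ^ (T n + T (n - 1)) := by
        intro n
        rw [W, ← pow_add, neg_pow, ← neg_one_T, map_pow, map_neg, map_one]
      simp only [S, hW, poch]
      rw [neg_mul_neg, ← sq]
  rw [← main]
  linear_combination E K 1 one_ne_zero ^ 2 *
    (E K 2 two_ne_zero * (E K 2 two_ne_zero)⁻¹ + 1) * hE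

/-- The dual number `(-1 + ε) X`. -/
noncomputable def da (K : Type*) [Field K] : DualNumber K⟦X⟧ :=
  (-1 + DualNumber.eps) * TrivSqZeroExt.inl X

/-- The dual number `-1 - ε`. -/
noncomputable def db (K : Type*) [Field K] : DualNumber K⟦X⟧ := -1 - DualNumber.eps

open TrivSqZeroExt in
theorem dual_W (n : ℤ) :
    TrivSqZeroExt.snd (W (da K) (db K) n) = C (-((-1 : K) ^ n * (n : K))) * X ^ T n := by
  have h1 : ∀ j : ℕ, (-1 + DualNumber.eps : DualNumber K⟦X⟧) ^ j =
      (inl ((-1 : K⟦X⟧) ^ j) + inr (-((-1 : K⟦X⟧) ^ j * (j : K⟦X⟧))) : DualNumber K⟦X⟧) := by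
    intro j
    induction j with
    | zero => apply TrivSqZeroExt.ext <;> simp
    | succ j ih =>
      rw [pow_succ, ih]
      apply TrivSqZeroExt.ext
      · simp [pow_succ]
      · simp [pow_succ]; ring
  have h2 : ∀ j : ℕ, (-1 - DualNumber.eps : DualNumber K⟦X⟧) ^ j =
      (inl ((-1 : K⟦X⟧) ^ j) + inr ((-1 : K⟦X⟧) ^ j * (j : K⟦X⟧)) : DualNumber K⟦X⟧) := by
    intro j
    induction j with
    | zero => apply TrivSqZeroExt.ext <;> simp
    | succ j ih =>
      rw [pow_succ, ih]
      apply TrivSqZeroExt.ext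
      · simp [pow_succ]
      · simp [pow_succ]; ring
  have h3 := T_step n
  have h4 : (T n : K⟦X⟧) = T (n - 1) + (n : K⟦X⟧) := by
    exact_mod_cast congrArg (Int.cast : ℤ → K⟦X⟧) h3
  have h5 : C ((-1 : K) ^ n) = (-1 : K⟦X⟧) ^ T n * (-1) ^ T (n - 1) := by
    rw [← neg_one_T, map_pow, map_neg, map_one, pow_add]
  have h6 : C (-((-1 : K) ^ n * (n : K))) =
      -((-1 : K⟦X⟧) ^ T n * (-1) ^ T (n - 1) * (n : K⟦X⟧)) := by
    rw [map_neg, map_mul, h5, map_intCast]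
  rw [W, da, db, mul_pow, h1, h2, h6, ← inl_pow]
  simp
  rw [h4]
  ring

open TrivSqZeroExt in
theorem da_mul_db : da K * db K = inl X := by
  apply TrivSqZeroExt.ext
  · simp [da, db]
  · simp [da, db]

open TrivSqZeroExt in
theorem jac_eq : E K 1 one_ne_zero ^ 3 = - Jac K := by
  have main : E K 1 one_ne_zero * (- E K 1 one_ne_zero ^ 2) = Jac K := by
    refine jtp_limit (r := 1) one_ne_zero
      (fun n : ℤ => C (-((-1 : K) ^ n * (n : K))) * X ^ T n)
      (fun n => ⟨T n, T_le n, pow_dvd_C_mul _ _⟩) _ (theta_lim _ _ T_le) _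
      (fun N => snd (∏ k ∈ Finset.range N,
        ((1 + da K * (da K * db K) ^ k) * (1 + db K * (da K * db K) ^ k)))) ?_ ?_
    · intro m N hN
      obtain ⟨M, rfl⟩ : ∃ M, N = M + 1 := ⟨N - 1, by omega⟩
      have h1 : snd (∏ k ∈ Finset.range (M + 1),
        ((1 + da K * (da K * db K) ^ k) * (1 + db K * (da K * db K) ^ k))) =
          - (poch K 1 (M + 1) * poch K 1 M) := by
        have e : ∀ y : DualNumber K⟦X⟧, snd (y * -DualNumber.eps) =
            - fstHom K⟦X⟧ K⟦X⟧ K⟦X⟧ y := by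
          intro y; simp
        have e2 : (1 + db K : DualNumber K⟦X⟧) = -DualNumber.eps := by rw [db]; ring
        rw [Finset.prod_mul_distrib, Finset.prod_range_succ'
          (fun k => 1 + db K * (da K * db K) ^ k),
          pow_zero, mul_one, e2, ← mul_assoc, e, map_mul, map_prod, map_prod]
        congr 2
        · refine Finset.prod_congr rfl fun k _ => ?_
          rw [da_mul_db]
          simp [pow_succ', da]
          ring
        · refine Finset.prod_congr rfl fun k _ => ?_
          rw [da_mul_db]
          simp [db]
          ring
      simp only [h1, map_neg, map_mul, map_pow]
      rw [poch_lim one_ne_zero m _ (by omega), poch_lim one_ne_zero m _ (by omega)]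
      ring
    · intro N
      have h0 := ui_inv (K := K) one_ne_zero
      rw [pow_one] at h0
      have hu : IsInvPoch (da K * db K) (fun k => (inl (ui K 1 k) : DualNumber K⟦X⟧)) := by
        rw [da_mul_db]
        refine ⟨fun k hk => by rw [h0.neg k hk, inl_zero], by rw [h0.zero, inl_one], fun k => ?_⟩
        rw [← h0.step k]
        apply TrivSqZeroExt.ext <;> simp
      have h1 := finite_jtp hu N
      rw [h1, da_mul_db, S]
      have h2 : ∏ k ∈ Finset.range (2 * N), (1 - (inl (X : K⟦X⟧) : DualNumber K⟦X⟧) ^ (k + 1)) =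
          (inl (poch K 1 (2 * N)) : DualNumber K⟦X⟧) := by
        rw [poch]
        change _ = inlHom K⟦X⟧ K⟦X⟧ _
        rw [map_prod]
        simp
      have h3 : snd (∑ᶠ n : ℤ, W (da K) (db K) n *
          ((inl (ui K 1 (N + n)) : DualNumber K⟦X⟧) * inl (ui K 1 (N - n)))) =
          ∑ᶠ n : ℤ, snd (W (da K) (db K) n *
          ((inl (ui K 1 (N + n)) : DualNumber K⟦X⟧) * inl (ui K 1 (N - n)))) :=
        AddMonoidHom.map_finsum (sndHom K⟦X⟧ K⟦X⟧).toAddMonoidHom (fin_supp hu _ _)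
      rw [h2, snd_mul, h3]
      simp only [fst_inl, snd_inl, smul_eq_mul, smul_zero, add_zero]
      congr 1
      refine finsum_congr fun n => ?_
      rw [← dual_W, ← inl_mul, snd_mul, snd_inl, fst_inl]
      simp
  rw [← main]
  ring

end Cubic

/-! ## Part 5: the lattice identity -/

namespace Cubic

open PowerSeries

variable {K : Type*} [Field K]

/-- Exponents in the series of `f_2`. -/
def e2 (m : ℤ) : ℕ := 2 * pentagonal m

theorem e2_eq (m : ℤ) : (e2 m : ℤ) = m * (3 * m - 1) := by
  rw [e2]
  push_cast
  exact two_mul_natCast_pentagonal m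

theorem pent_le (m : ℤ) : |m| ≤ (pentagonal m : ℤ) + 1 := by
  have h := two_mul_natCast_pentagonal m
  rw [abs_le]
  constructor <;> nlinarith [sq_nonneg (m - 1), sq_nonneg (m + 1)]

theorem e2_le (m : ℤ) : |m| ≤ (e2 m : ℤ) + 1 := by
  have := pent_le m
  rw [e2]
  push_cast
  omega

theorem E_one_theta : E K 1 one_ne_zero = theta (fun n => (-1 : K) ^ n) pentagonal := by
  rw [E, expand_one_apply, euler_theta]

theorem E_two_theta : E K 2 two_ne_zero = theta (fun n => (-1 : K) ^ n) e2 := by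
  rw [E, euler_theta]
  ext k
  by_cases h : 2 ∣ k
  · obtain ⟨j, rfl⟩ := h
    rw [coeff_expand_mul, theta, theta, coeff_mk, coeff_mk]
    congr 1
    ext n
    have : (pentagonal n = j) ↔ e2 n = 2 * j := by rw [e2]; omega
    simp [this]
  · rw [coeff_expand_of_not_dvd _ _ _ h, theta, coeff_mk]
    have : {n : ℤ | e2 n = k} = ∅ := by
      ext n
      simp only [Set.mem_ofPred_eq, Set.mem_empty_iff_false, iff_false]
      rintro rfl
      exact h ⟨_, rfl⟩
    rw [this, finsum_mem_empty]

theorem zpow_par {a b : ℤ} (h : Even (a - b)) : (-1 : K) ^ a = (-1) ^ b := by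
  have : a = (a - b) + b := by ring
  rw [this, zpow_add₀ (by simp), h.neg_one_zpow, one_mul]

theorem zpow_par' {a b : ℤ} (h : Odd (a - b)) : (-1 : K) ^ a = -(-1) ^ b := by
  have : a = (a - b) + b := by ring
  rw [this, zpow_add₀ (by simp), h.neg_one_zpow, neg_one_mul]

/-- The first half of the solutions. -/
def A1 (N : ℕ) : Set (ℤ × ℤ) := {p | T p.1 + e2 p.2 = 5 * N ∧ (5 : ℤ) ∣ 2 * p.2 - p.1}

/-- The second half of the solutions. -/
def A2 (N : ℕ) : Set (ℤ × ℤ) := {p | T p.1 + e2 p.2 = 5 * N ∧ (5 : ℤ) ∣ 2 * p.2 + 1 + p.1}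

theorem A_union (N : ℕ) : {p : ℤ × ℤ | T p.1 + e2 p.2 = 5 * N} = A1 N ∪ A2 N := by
  ext ⟨n, m⟩
  constructor
  · intro h
    have h : T n + e2 m = 5 * N := h
    have h1 := two_T n
    have h2 := e2_eq m
    have h3 : (5 : ℤ) ∣ (2 * m - n) * (2 * m + 1 + n) := by
      refine ⟨2 * m * m - 2 * N, ?_⟩
      have h4 : (T n : ℤ) + e2 m = 5 * N := by exact_mod_cast h
      linear_combination (-2) * h4 + h1 + 2 * h2
    rcases (Int.prime_iff_natAbs_prime.2 (by norm_num : Nat.Prime (Int.natAbs 5))).dvd_or_dvd h3 with h5 | h5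
    · exact Or.inl ⟨h, h5⟩
    · exact Or.inr ⟨h, h5⟩
  · rintro (h | h)
    · exact h.1
    · exact h.1

theorem sum_A2 (N : ℕ) :
    ∑ᶠ p ∈ A2 N, (1 : K) * (-1) ^ p.2 = ∑ᶠ p ∈ A1 N, (1 : K) * (-1) ^ p.2 := by
  refine finsum_mem_eq_of_bijOn (fun p => (-1 - p.1, p.2)) ⟨?_, ?_, ?_⟩ ?_
  · rintro ⟨n, m⟩ ⟨h1, h2⟩
    refine ⟨?_, ?_⟩
    · dsimp only at *
      rw [T_neg]; exact h1
    · dsimp only at *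
      omega
  · rintro ⟨n, m⟩ - ⟨n', m'⟩ - h
    simp only [Prod.mk.injEq] at h ⊢
    omega
  · rintro ⟨n, m⟩ ⟨h1, h2⟩
    refine ⟨(-1 - n, m), ⟨?_, ?_⟩, ?_⟩
    · dsimp only at *
      rw [T_neg]; exact h1
    · dsimp only at *
      omega
    · simp
  · intro p _
    rfl

theorem sum_A1 (N : ℕ) :
    ∑ᶠ p ∈ A1 N, (1 : K) * (-1) ^ p.2 = coeff N (E K 1 one_ne_zero * Phi K) := by
  rw [E_one_theta, Phi, theta_mul _ _ _ _ pent_le sq_le]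
  symm
  have key : ∀ l w : ℤ, ((T (2 * w - 3 * l) + e2 (l + w) : ℕ) : ℤ) =
      5 * ((pentagonal l + (T w + T (w - 1)) : ℕ) : ℤ) := by
    intro l w
    have h1 := two_T (2 * w - 3 * l)
    have h2 := e2_eq (l + w)
    have h3 := T_add w
    have h4 := two_mul_natCast_pentagonal l
    push_cast at *
    have : (2 : ℤ) * (T (2 * w - 3 * l) + e2 (l + w)) =
        2 * (5 * (pentagonal l + (T w + T (w - 1)))) := by
      linear_combination h1 + 2 * h2 - 10 * h3 - 5 * h4
    omega
  refine finsum_mem_eq_of_bijOn (fun p => (2 * p.2 - 3 * p.1, p.1 + p.2)) ⟨?_, ?_, ?_⟩ ?_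
  · rintro ⟨l, w⟩ h
    have h : pentagonal l + (T w + T (w - 1)) = N := h
    have := key l w
    refine ⟨?_, ?_⟩ <;> dsimp only <;> omega
  · rintro ⟨n, m⟩ - ⟨n', m'⟩ - h
    simp only [Prod.mk.injEq] at h ⊢
    omega
  · rintro ⟨n, m⟩ ⟨h1, ⟨l, h2⟩⟩
    dsimp only at h1 h2
    have := key l (m - l)
    have e1 : 2 * (m - l) - 3 * l = n := by omega
    have e3 : l + (m - l) = m := by omega
    refine ⟨(l, m - l), ?_, ?_⟩
    · change pentagonal l + (T (m - l) + T (m - l - 1)) = N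
      rw [e1, e3] at this
      omega
    · simp only [e1, e3]
  · rintro ⟨l, w⟩ _
    dsimp only
    rw [one_mul, zpow_add₀ (by simp)]

theorem sum_A0 (N : ℕ) :
    ∑ᶠ p ∈ A1 N ∩ A2 N, (1 : K) * (-1) ^ p.2 =
      - coeff N (X * expand 5 (by norm_num) (Psi K * E K 2 two_ne_zero)) := by
  have key : ∀ n m : ℤ, ((T (5 * n + 2) + e2 (1 - 5 * m) : ℕ) : ℤ) =
      5 * (5 * (T n + e2 m : ℕ) + 1) := by
    intro n m
    have h1 := two_T (5 * n + 2)
    have h2 := e2_eq (1 - 5 * m)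
    have h3 := two_T n
    have h4 := e2_eq m
    push_cast at *
    have : (2 : ℤ) * (T (5 * n + 2) + e2 (1 - 5 * m)) = 2 * (5 * (5 * (T n + e2 m) + 1)) := by
      linear_combination h1 + 2 * h2 - 25 * h3 - 50 * h4
    omega
  have key2 : ∀ p ∈ A1 N ∩ A2 N, ∃ n m : ℤ, p = (5 * n + 2, 1 - 5 * m) ∧
      N = 5 * (T n + e2 m) + 1 := by
    rintro ⟨n, m⟩ ⟨⟨h1, h2⟩, ⟨-, h3⟩⟩
    dsimp only at h1 h2 h3
    obtain ⟨n', rfl⟩ : ∃ n', n = 5 * n' + 2 := ⟨(n - 2) / 5, by omega⟩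
    obtain ⟨m', rfl⟩ : ∃ m', m = 1 - 5 * m' := ⟨(1 - m) / 5, by omega⟩
    refine ⟨n', m', rfl, ?_⟩
    have := key n' m'
    omega
  by_cases hN : ∃ k, N = 5 * k + 1
  · obtain ⟨k, rfl⟩ := hN
    rw [coeff_succ_X_mul, coeff_expand_mul, E_two_theta, Psi, theta_mul _ _ _ _ T_le e2_le,
      ← finsum_mem_neg_distrib]
    · symm
      refine finsum_mem_eq_of_bijOn (fun p => (5 * p.1 + 2, 1 - 5 * p.2)) ⟨?_, ?_, ?_⟩ ?_
      · rintro ⟨n, m⟩ h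
        have h : T n + e2 m = k := h
        have := key n m
        refine ⟨⟨?_, ?_⟩, ⟨?_, ?_⟩⟩ <;> dsimp only <;> omega
      · rintro ⟨n, m⟩ - ⟨n', m'⟩ - h
        simp only [Prod.mk.injEq] at h ⊢
        omega
      · intro p hp
        obtain ⟨n, m, rfl, h⟩ := key2 p hp
        refine ⟨(n, m), ?_, rfl⟩
        change T n + e2 m = k
        omega
      · rintro ⟨n, m⟩ _
        dsimp only
        rw [zpow_par' (a := 1 - 5 * m) (b := m) ⟨-3 * m, by ring⟩]
        ring
    · exact theta_mul_finite _ _ T_le e2_le _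
  · have h0 : A1 N ∩ A2 N = ∅ := by
      rw [Set.eq_empty_iff_forall_notMem]
      intro p hp
      obtain ⟨n, m, -, h⟩ := key2 p hp
      exact hN ⟨_, h⟩
    rw [h0, finsum_mem_empty]
    rcases N with _ | j
    · simp
    · rw [coeff_succ_X_mul, coeff_expand_of_not_dvd, neg_zero]
      rintro ⟨k, rfl⟩
      exact hN ⟨k, rfl⟩

theorem lattice (N : ℕ) :
    coeff (5 * N) (Psi K * E K 2 two_ne_zero) =
      2 * coeff N (E K 1 one_ne_zero * Phi K) +
        coeff N (X * expand 5 (by norm_num) (Psi K * E K 2 two_ne_zero)) := by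
  have hf := theta_mul_finite _ _ T_le e2_le (5 * N)
  have h1 : coeff (5 * N) (Psi K * E K 2 two_ne_zero) =
      ∑ᶠ p ∈ A1 N ∪ A2 N, (1 : K) * (-1) ^ p.2 := by
    rw [E_two_theta, Psi, theta_mul _ _ _ _ T_le e2_le, ← A_union]
  rw [A_union] at hf
  have h2 := finsum_mem_union_inter (f := fun p : ℤ × ℤ => (1 : K) * (-1) ^ p.2)
    (hf.subset Set.subset_union_left) (hf.subset Set.subset_union_right)
  rw [sum_A0, sum_A2, sum_A1] at h2
  rw [h1]
  linear_combination h2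

/-! ## Part 6: dissection modulo 5 -/

/-- The operator extracting every fifth coefficient. -/
noncomputable def U5 (f : K⟦X⟧) : K⟦X⟧ := PowerSeries.mk fun n => coeff (5 * n) f

theorem U5_mul (f g : K⟦X⟧) : U5 (f * expand 5 (by norm_num) g) = U5 f * g := by
  ext n
  rw [U5, coeff_mk, coeff_mul, coeff_mul]
  symm
  refine Finset.sum_of_injOn (fun p => (5 * p.1, 5 * p.2)) ?_ ?_ ?_ ?_
  · rintro ⟨a, b⟩ - ⟨c, d⟩ - h
    simp only [Prod.mk.injEq] at h ⊢
    omega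
  · rintro ⟨a, b⟩ h
    have h := Finset.HasAntidiagonal.mem_antidiagonal.1 (Finset.mem_coe.1 h)
    refine Finset.mem_coe.2 (Finset.HasAntidiagonal.mem_antidiagonal.2 ?_)
    dsimp only at h ⊢
    omega
  · rintro ⟨a, b⟩ h h2
    have h := Finset.HasAntidiagonal.mem_antidiagonal.1 h
    dsimp only at h ⊢
    rw [coeff_expand_of_not_dvd, mul_zero]
    rintro ⟨d, rfl⟩
    refine h2 ⟨(a / 5, d), Finset.mem_coe.2 (Finset.HasAntidiagonal.mem_antidiagonal.2 ?_), ?_⟩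
    · dsimp only
      omega
    · simp only [Prod.mk.injEq, and_true]
      omega
  · rintro ⟨a, b⟩ _
    simp only [U5, coeff_mk]
    rw [coeff_expand_mul]

instance fact5 : Fact (Nat.Prime 5) := ⟨by norm_num⟩

theorem frob (f : (ZMod 5)⟦X⟧) : f ^ 5 = expand 5 (by norm_num) f := by
  have h := MvPowerSeries.map_frobenius_expand (R := ZMod 5) 5 (by norm_num) (f := f)
  rw [ZMod.frobenius_zmod] at h
  rw [← h, MvPowerSeries.map_id]
  rfl

/-- `f` is supported on exponents whose residue lies in `S`. -/
def Supp (f : (ZMod 5)⟦X⟧) (S : Finset (ZMod 5)) : Prop :=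
  ∀ n : ℕ, (n : ZMod 5) ∉ S → coeff n f = 0

open Pointwise in
theorem Supp.mul {f g : (ZMod 5)⟦X⟧} {S S' : Finset (ZMod 5)} (hf : Supp f S) (hg : Supp g S') :
    Supp (f * g) (S + S') := by
  intro n hn
  rw [coeff_mul]
  refine Finset.sum_eq_zero fun p hp => ?_
  have hp := Finset.HasAntidiagonal.mem_antidiagonal.1 hp
  by_cases h1 : (p.1 : ZMod 5) ∈ S
  · by_cases h2 : (p.2 : ZMod 5) ∈ S'
    · refine absurd ?_ hn
      rw [← hp, Nat.cast_add]
      exact Finset.add_mem_add h1 h2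
    · rw [hg _ h2, mul_zero]
  · rw [hf _ h1, zero_mul]

theorem Supp.two {f : (ZMod 5)⟦X⟧} {S : Finset (ZMod 5)} (hf : Supp f S) :
    Supp (expand 2 two_ne_zero f) (S.image (2 * ·)) := by
  intro n hn
  by_cases h : 2 ∣ n
  · obtain ⟨k, rfl⟩ := h
    rw [coeff_expand_mul]
    apply hf
    intro hk
    apply hn
    rw [Finset.mem_image]
    exact ⟨_, hk, by push_cast; rfl⟩
  · exact coeff_expand_of_not_dvd _ _ _ h

theorem Supp.five (f : (ZMod 5)⟦X⟧) : Supp (expand 5 (by norm_num) f) {0} := by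
  intro n hn
  apply coeff_expand_of_not_dvd
  rw [← ZMod.natCast_eq_zero_iff]
  simpa using hn

theorem Supp.X : Supp PowerSeries.X {1} := by
  intro n hn
  rw [coeff_X, if_neg]
  rintro rfl
  simp at hn

theorem supp_pent : Supp (pentagonalSeries (ZMod 5)) {0, 1, 2} := by
  intro n hn
  apply coeff_pentagonalSeries_eq_zero
  rintro ⟨j, rfl⟩
  apply hn
  have h := congrArg (Int.cast : ℤ → ZMod 5) (two_mul_natCast_pentagonal j)
  push_cast at h
  have h2 : ∀ a b : ZMod 5, 2 * a = b * (3 * b - 1) → a ∈ ({0, 1, 2} : Finset (ZMod 5)) := by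
    decide
  exact h2 _ _ h

theorem supp_cube : Supp (pentagonalSeries (ZMod 5) ^ 3) {0, 1} := by
  intro n hn
  have h0 := jac_eq (K := ZMod 5)
  rw [E, expand_one_apply] at h0
  rw [h0, map_neg, neg_eq_zero, Jac, theta, coeff_mk]
  have h1 : ∀ j ∈ {j : ℤ | T j = n}, (j : ZMod 5) = 2 := by
    intro j hj
    have hj : T j = n := hj
    have h := congrArg (Int.cast : ℤ → ZMod 5) (two_T j)
    push_cast at h
    rw [hj] at h
    have h2 : ∀ a b : ZMod 5, 2 * a = b * (b + 1) → a ∉ ({0, 1} : Finset (ZMod 5)) → b = 2 := by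
      decide
    exact h2 _ _ h hn
  have hfin : {j : ℤ | T j = n}.Finite := by
    refine (Set.finite_Icc (-(n + 1 : ℤ)) (n + 1)).subset ?_
    intro j hj
    have hj : T j = n := hj
    have := abs_le.1 (T_le j)
    exact Set.mem_Icc.2 ⟨by omega, by omega⟩
  have h3 : ∑ᶠ j ∈ {j : ℤ | T j = n}, -((-1 : ZMod 5) ^ j * (j : ZMod 5)) =
      ∑ᶠ j ∈ {j : ℤ | T j = n}, -(-((-1 : ZMod 5) ^ j * (j : ZMod 5))) := by
    refine finsum_mem_eq_of_bijOn (fun j => -1 - j) ⟨?_, ?_, ?_⟩ ?_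
    · intro j hj
      change T (-1 - j) = n
      rw [T_neg]; exact hj
    · intro a _ b _ h
      dsimp only at h
      omega
    · intro j hj
      refine ⟨-1 - j, ?_, by ring⟩
      change T (-1 - j) = n
      rw [T_neg]; exact hj
    · intro j hj
      have hj' : -1 - j ∈ {j : ℤ | T j = n} := by
        change T (-1 - j) = n
        rw [T_neg]; exact hj
      rw [h1 j hj, h1 _ hj', zpow_par' (a := -1 - j) (b := j) ⟨-1 - j, by ring⟩]
      ring
  rw [finsum_mem_neg_distrib (f := fun j : ℤ => -((-1 : ZMod 5) ^ j * (j : ZMod 5))) hfin] at h3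
  generalize ∑ᶠ j ∈ {j : ℤ | T j = n}, -((-1 : ZMod 5) ^ j * (j : ZMod 5)) = x at h3
  revert x
  decide

open Pointwise in
theorem final (n : ℕ) : (genCubic 3 (25 * n + 20) : ZMod 5) = 0 := by
  rw [genCubic_eq (ZMod 5)]
  set p := P (ZMod 5) with hp
  set s := expand 2 two_ne_zero p with hs
  set a := pentagonalSeries (ZMod 5) with ha
  set b := expand 2 two_ne_zero a with hb
  have hE1 : E (ZMod 5) 1 one_ne_zero = a := by rw [E, expand_one_apply]
  have hE2 : E (ZMod 5) 2 two_ne_zero = b := rfl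
  have i1 : p * a = 1 := P_mul_euler (ZMod 5)
  have i2 : s * b = 1 := by rw [hs, hb, ← map_mul, i1, map_one]
  have i3 := psi_eq (K := ZMod 5)
  have i4 := phi_eq (K := ZMod 5)
  have i5 := lattice (K := ZMod 5)
  rw [hE1, hE2] at i3 i4
  simp only [hE1, hE2] at i5
  have j1 : Psi (ZMod 5) * b = (2 * (p * (s * s))) * expand 5 (by norm_num) b := by
    rw [← frob]
    linear_combination (-Psi (ZMod 5) * b) * i1 + p * b * i3 -
      2 * p * b ^ 3 * (s * b + 1) * i2
  have j2 : U5 (2 * (p * (s * s))) * b = 2 * (a * Phi (ZMod 5)) +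
      X * expand 5 (by norm_num) (Psi (ZMod 5) * b) := by
    rw [← U5_mul, ← j1]
    ext N
    rw [U5, coeff_mk, i5 N, map_add]
    congr 1
    rw [two_mul, two_mul, map_add]
  set h := expand 5 (by norm_num) (Psi (ZMod 5) * b) with hh
  set t := expand 5 (by norm_num) s with ht
  have j3 : t * b ^ 5 = 1 := by rw [frob, ht, ← map_mul, i2, map_one]
  have j4 : U5 (2 * (p * (s * s))) = (a ^ 3 * b ^ 3) * (2 * t) + ((X * b) * b ^ 3) * (h * t) := by
    linear_combination (-U5 (2 * (p * (s * s)))) * j3 + t * b ^ 4 * j2 + 2 * t * a * b ^ 3 * i4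
  have s1 : Supp (a ^ 3) {0, 1} := supp_cube
  have s0 : Supp a {0, 1, 2} := supp_pent
  have s2 : Supp (b ^ 3) (({0, 1} : Finset (ZMod 5)).image (2 * ·)) := by
    have := s1.two
    rwa [map_pow] at this
  have s3 : Supp b (({0, 1, 2} : Finset (ZMod 5)).image (2 * ·)) := s0.two
  have s4 : Supp (2 * t) {0} := by
    rw [ht, show (2 : (ZMod 5)⟦X⟧) * expand 5 (by norm_num) s = expand 5 (by norm_num) (2 * s) by
      rw [map_mul, map_ofNat]]
    exact Supp.five _
  have s5 : Supp (h * t) {0} := by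
    rw [hh, ht, ← map_mul]
    exact Supp.five _
  have r1 := ((s1.mul s2).mul s4) (5 * n + 4) (by
    have : ((5 * n + 4 : ℕ) : ZMod 5) = 4 := by
      push_cast
      rw [show (5 : ZMod 5) = 0 by decide]
      ring
    rw [this]
    decide)
  have r2 := (((Supp.X.mul s3).mul s2).mul s5) (5 * n + 4) (by
    have : ((5 * n + 4 : ℕ) : ZMod 5) = 4 := by
      push_cast
      rw [show (5 : ZMod 5) = 0 by decide]
      ring
    rw [this]
    decide)
  have r3 := congrArg (coeff (5 * n + 4)) j4
  rw [map_add, r1, r2, add_zero, U5, coeff_mk, two_mul, map_add] at r3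
  rw [show 25 * n + 20 = 5 * (5 * n + 4) by ring]
  generalize coeff (5 * (5 * n + 4)) (p * (s * s)) = x at r3
  revert x
  decide

end Cubic

theorem stmt_0 : ∀ n : ℕ, 5 ∣ genCubic 3 (25 * n + 20) := by
  intro n
  exact (ZMod.natCast_eq_zero_iff _ 5).1 (Cubic.final n)
end

section
/- For all α ≥ 1 and all n ≥ 0, a_3(5^{2α} n + γ_α) ≡ 0 (mod 5^α), where γ_α = 20 + 19·25(25^{α-1}-1)/24. -/
/-- `γ_α = 20 + 19·25·(25^(α-1) - 1)/24` (the division is exact for `α ≥ 1`). -/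
def gammaA (α : ℕ) : ℕ := 20 + 19 * 25 * (25 ^ (α - 1) - 1) / 24

noncomputable section

section
open PowerSeries
namespace C5

abbrev R := PowerSeries ℤ

/-- the operator picking coefficients with index divisible by five -/
def U : R →ₗ[ℤ] R where
  toFun h := PowerSeries.mk fun n => coeff (5 * n) h
  map_add' a b := by ext n; simp
  map_smul' a b := by ext n; simp only [coeff_mk, map_zsmul, RingHom.id_apply]

lemma coeff_U (h : R) (n : ℕ) : coeff n (U h) = coeff (5 * n) h := by
  simp [U]

lemma U_one : U 1 = 1 := by
  ext n
  rw [coeff_U, coeff_one, coeff_one]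
  simp

lemma U_dvd (h : R) (K : ℕ) (hh : X ^ (5 * K) ∣ h) : X ^ K ∣ U h := by
  rw [X_pow_dvd_iff] at *
  intro m hm
  rw [coeff_U]
  exact hh _ (by omega)

/-- X-adic closure of the span of a set -/
def cl (S : Set R) : Submodule ℤ R where
  carrier := {h | ∀ K : ℕ, ∃ p ∈ Submodule.span ℤ S, X ^ K ∣ h - p}
  zero_mem' := fun K => ⟨0, Submodule.zero_mem _, by simp⟩
  add_mem' := by
    intro a b ha hb K
    obtain ⟨p, hp, hp'⟩ := ha K
    obtain ⟨r, hr, hr'⟩ := hb K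
    refine ⟨p + r, Submodule.add_mem _ hp hr, ?_⟩
    have := dvd_add hp' hr'
    convert this using 1; ring
  smul_mem' := by
    intro c a ha K
    obtain ⟨p, hp, hp'⟩ := ha K
    refine ⟨c • p, Submodule.smul_mem _ c hp, ?_⟩
    rw [← smul_sub, zsmul_eq_mul]
    exact Dvd.dvd.mul_left hp' _

lemma mem_cl {S : Set R} {h : R} :
    h ∈ cl S ↔ ∀ K : ℕ, ∃ p ∈ Submodule.span ℤ S, X ^ K ∣ h - p := Iff.rfl

lemma subset_cl {S : Set R} {h : R} (hh : h ∈ S) : h ∈ cl S := fun K =>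
  ⟨h, Submodule.subset_span hh, by simp⟩

lemma cl_closed {S : Set R} {h : R} (hh : ∀ K : ℕ, ∃ p ∈ cl S, X ^ K ∣ h - p) : h ∈ cl S := by
  intro K
  obtain ⟨p, hp, hp'⟩ := hh K
  obtain ⟨r, hr, hr'⟩ := hp K
  refine ⟨r, hr, ?_⟩
  have := dvd_add hp' hr'
  convert this using 1; ring

lemma cl_map {S S' : Set R} (F : R →ₗ[ℤ] R)
    (hF : ∀ K : ℕ, ∃ K' : ℕ, ∀ h, X ^ K' ∣ h → X ^ K ∣ F h)
    (hS : ∀ s ∈ S, F s ∈ cl S') {h : R} (hh : h ∈ cl S) : F h ∈ cl S' := by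
  apply cl_closed
  intro K
  obtain ⟨K', hK'⟩ := hF K
  obtain ⟨p, hp, hp'⟩ := hh K'
  refine ⟨F p, ?_, ?_⟩
  · have : Submodule.span ℤ S ≤ (cl S').comap F := by
      rw [Submodule.span_le]
      intro s hs
      exact hS s hs
    exact this hp
  · rw [← map_sub]
    exact hK' _ hp'

lemma cl_mono {S S' : Set R} (hS : ∀ s ∈ S, s ∈ cl S') {h : R} (hh : h ∈ cl S) : h ∈ cl S' :=
  cl_map LinearMap.id (fun K => ⟨K, fun _ hh => hh⟩) hS hh

lemma cl_mul {S S' : Set R} (g : R) (hS : ∀ s ∈ S, g * s ∈ cl S') {h : R} (hh : h ∈ cl S) :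
    g * h ∈ cl S' :=
  cl_map (LinearMap.mulLeft ℤ g) (fun K => ⟨K, fun _ hh => Dvd.dvd.mul_left hh _⟩) hS hh

lemma cl_U {S S' : Set R} (hS : ∀ s ∈ S, U s ∈ cl S') {h : R} (hh : h ∈ cl S) : U h ∈ cl S' :=
  cl_map U (fun K => ⟨5 * K, fun h hh => U_dvd h K hh⟩) hS hh

/-- generators of the filtration -/
def gens (t : R) (k : ℕ) (e : ℤ) : Set R :=
  {h | ∃ v m : ℕ, 5 * (m : ℤ) - e ≤ 6 * v ∧ h = 5 ^ (v + k) * t ^ m}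

/-- filtration -/
def G (t : R) (k : ℕ) (e : ℤ) : Submodule ℤ R := cl (gens t k e)

variable {t : R}

lemma mono_mem (v m k : ℕ) (e : ℤ) (h : 5 * (m : ℤ) - e ≤ 6 * v) :
    (5 : R) ^ (v + k) * t ^ m ∈ G t k e := subset_cl ⟨v, m, h, rfl⟩

lemma G_le {k : ℕ} {e e' : ℤ} (he : e ≤ e') {h : R} (hh : h ∈ G t k e) : h ∈ G t k e' := by
  refine cl_mono ?_ hh
  rintro s ⟨v, m, h1, rfl⟩
  exact mono_mem _ _ _ _ (by omega)

lemma G_mul {k k' : ℕ} {e e' : ℤ} {g h : R} (hg : g ∈ G t k e) (hh : h ∈ G t k' e') :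
    g * h ∈ G t (k + k') (e + e') := by
  refine cl_mul g ?_ hh
  rintro s ⟨v, m, h1, rfl⟩
  rw [mul_comm]
  refine cl_mul _ ?_ hg
  rintro s ⟨v', m', h2, rfl⟩
  have : (5 : R) ^ (v + k') * t ^ m * (5 ^ (v' + k) * t ^ m') =
      5 ^ (v + v' + (k + k')) * t ^ (m + m') := by ring
  rw [this]
  exact mono_mem _ _ _ _ (by push_cast; omega)

lemma G_five {k : ℕ} {e : ℤ} {h : R} (hh : h ∈ G t k e) : 5 * h ∈ G t (k + 1) e := by
  refine cl_mul _ ?_ hh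
  rintro s ⟨v, m, h1, rfl⟩
  have : (5 : R) * (5 ^ (v + k) * t ^ m) = 5 ^ (v + (k + 1)) * t ^ m := by ring
  rw [this]
  exact mono_mem _ _ _ _ (by omega)

lemma G_drop {k : ℕ} {e : ℤ} {h : R} (hh : h ∈ G t (k + 1) e) : h ∈ G t k (e - 6) := by
  refine cl_mono ?_ hh
  rintro s ⟨v, m, h1, rfl⟩
  have : (5 ^ (v + (k + 1)) * t ^ m : R) = 5 ^ (v + 1 + k) * t ^ m := by ring
  rw [this]
  exact mono_mem _ _ _ _ (by push_cast; omega)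

lemma one_mem_G {e : ℤ} (he : 0 ≤ e) : (1 : R) ∈ G t 0 e := by
  simpa using mono_mem (t := t) 0 0 0 e (by omega)

lemma t_mem_G {e : ℤ} (he : 5 ≤ e) : t ∈ G t 0 e := by
  simpa using mono_mem (t := t) 0 1 0 e (by omega)

lemma int_mul_mem {k : ℕ} {e : ℤ} {h : R} (c : ℤ) (hh : h ∈ G t k e) : (c : R) * h ∈ G t k e := by
  rw [← zsmul_eq_mul]
  exact Submodule.smul_mem _ _ hh

/-- evaluation of an integer polynomial given by its coefficient list -/
def ev {A : Type*} [CommRing A] (t : A) : List ℤ → A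
  | [] => 0
  | a :: l => (a : A) + t * ev t l

/-- divisibility check -/
def ok (k : ℕ) : ℤ → List ℤ → Bool
  | _, [] => true
  | e, a :: l => decide (((5 : ℤ) ^ (k + ((5 - e) / 6).toNat)) ∣ a) && ok k (e - 5) l

lemma ev_mem {k : ℕ} (l : List ℤ) : ∀ {e : ℤ}, ok k e l = true → ev t l ∈ G t k e := by
  induction l with
  | nil => intro e _; exact Submodule.zero_mem _
  | cons a l ih =>
    intro e h
    simp only [ok, Bool.and_eq_true, decide_eq_true_eq] at h
    obtain ⟨⟨c, rfl⟩, h2⟩ := h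
    refine Submodule.add_mem _ ?_ ?_
    · have : (((5 : ℤ) ^ (k + ((5 - e) / 6).toNat) * c : ℤ) : R) =
        (c : R) * (5 ^ (((5 - e) / 6).toNat + k) * t ^ 0) := by push_cast; ring
      rw [this]
      apply int_mul_mem
      apply mono_mem
      push_cast
      omega
    · have := G_mul (t_mem_G (t := t) (le_refl 5)) (ih h2)
      simpa using this

lemma G_div {e : ℤ} {g w : R} (hw : w ∈ G t 0 0) (hX : X ∣ w)
    (hg : g * (1 - w) ∈ G t 0 e) : g ∈ G t 0 e := by
  apply cl_closed
  intro K
  have hpow : ∀ i : ℕ, w ^ i ∈ G t 0 0 := by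
    intro i
    induction i with
    | zero => simpa using one_mem_G (t := t) (le_refl 0)
    | succ i ih =>
      rw [pow_succ]
      have := G_mul ih hw
      simpa only [add_zero] using this
  refine ⟨g * (1 - w) * ∑ i ∈ Finset.range K, w ^ i, ?_, ?_⟩
  · have := G_mul hg (Submodule.sum_mem (G t 0 0) (t := Finset.range K) (fun i _ => hpow i))
    rw [add_zero, add_zero] at this
    exact this
  · have h1 : g - g * (1 - w) * ∑ i ∈ Finset.range K, w ^ i = g * w ^ K := by
      have := mul_neg_geom_sum w K
      rw [mul_assoc, this]; ring
    rw [h1]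
    exact Dvd.dvd.mul_left (pow_dvd_pow_of_dvd hX K) _

lemma G_coeff {k : ℕ} {e : ℤ} {h : R} (hh : h ∈ G t k e) (n : ℕ) : (5 : ℤ) ^ k ∣ coeff n h := by
  obtain ⟨p, hp, hp'⟩ := hh (n + 1)
  rw [X_pow_dvd_iff] at hp'
  have h1 := hp' n (by omega)
  rw [map_sub, sub_eq_zero] at h1
  rw [h1]
  have : ∀ p ∈ Submodule.span ℤ (gens t k e), (5 : ℤ) ^ k ∣ coeff n p := by
    intro p hp
    induction hp using Submodule.span_induction with
    | mem x hx =>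
      obtain ⟨v, m, _, rfl⟩ := hx
      have : (5 ^ (v + k) * t ^ m : R) = C ((5 : ℤ) ^ k) * (5 ^ v * t ^ m) := by
        simp only [map_pow, map_ofNat]; ring
      rw [this, coeff_C_mul]
      exact dvd_mul_right _ _
    | zero => simp
    | add x y _ _ hx hy => rw [map_add]; exact dvd_add hx hy
    | smul a x _ hx => rw [map_smul, smul_eq_mul]; exact Dvd.dvd.mul_left hx _
  exact this p hp

end C5
end

section
open PowerSeries
namespace C5

def A4 : List ℤ := [0, 41, 860, 6800, 24000, 32000]
def A3 : List ℤ := [0, 43, 895, 7000, 24400, 32000]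
def A2 : List ℤ := [0, 17, 350, 2705, 9300, 12000]
def A1 : List ℤ := [0, 3, 61, 465, 1575, 2000]
def A0 : List ℤ := [0, 1, 20, 150, 500, 625]
def B0 : List ℤ := [0,1,-210,-12490,-229200,-1992375,-8843750,-16625000,10500000,90000000,100000000]
def B1 : List ℤ := [0,1,-2585,-135325,-2428875,-20991000,-92350000,-164500000,170000000,1100000000,1200000000]
def B2 : List ℤ := [0,1,-9080,-471775,-8462250,-73014500,-317530000,-524000000,852000000,4480000000,4800000000]
def B3 : List ℤ := [0,-9,-10735,-544050,-9755000,-83990000,-359160000,-528800000,1360000000,6080000000,6400000000]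
def B4 : List ℤ := [0,51,1580,6000,-8000,-40000]
def DD : List ℤ := [1,55,1100,11250,65625,221875,406250,312500]

structure Dat (t Φ : R) : Prop where
  ht : X ∣ t
  hu1 : U t = ev t A4
  hu2 : U (t ^ 2) = 5 * ev t A4 * U t + 2 * ev t A3
  hu3 : U (t ^ 3) = 5 * ev t A4 * U (t ^ 2) + 5 * ev t A3 * U t + 3 * ev t A2
  hu4 : U (t ^ 4) = 5 * ev t A4 * U (t ^ 3) + 5 * ev t A3 * U (t ^ 2) + 5 * ev t A2 * U t
    + 4 * ev t A1
  hrec : ∀ n : ℕ, U (t ^ (n + 5)) = ev t A0 * U (t ^ n) + 5 * ev t A1 * U (t ^ (n + 1))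
    + 5 * ev t A2 * U (t ^ (n + 2)) + 5 * ev t A3 * U (t ^ (n + 3)) + 5 * ev t A4 * U (t ^ (n + 4))
  hΦ : ∀ n : ℕ, ev t DD * U (Φ * t ^ n) = ev t B0 * U (t ^ n) + ev t B1 * U (t ^ (n + 1))
    + ev t B2 * U (t ^ (n + 2)) + ev t B3 * U (t ^ (n + 3)) + ev t B4 * U (t ^ (n + 4))

variable {t Φ : R}

/-- product membership with five in front -/
lemma fmul {e e' e'' : ℤ} {g h : R} (hg : g ∈ G t 0 e) (hh : h ∈ G t 0 e') (he : e + e' ≤ e'') :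
    5 * g * h ∈ G t 1 e'' := by
  have h1 := G_five (G_mul hg hh)
  rw [← mul_assoc] at h1
  exact G_le he h1

lemma gmul {e e' e'' : ℤ} {g h : R} (hg : g ∈ G t 0 e) (hh : h ∈ G t 0 e')
    (he : e + e' ≤ e'') : g * h ∈ G t 0 e'' := by
  have := G_mul hg hh
  rw [zero_add] at this
  exact G_le he this

lemma gmul10 {e e' e'' : ℤ} {g h : R} (hg : g ∈ G t 1 e) (hh : h ∈ G t 0 e')
    (he : e + e' ≤ e'') : g * h ∈ G t 1 e'' := by
  have := G_mul hg hh
  rw [add_zero] at this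
  exact G_le he this

lemma gmul01 {e e' e'' : ℤ} {g h : R} (hg : g ∈ G t 0 e) (hh : h ∈ G t 1 e')
    (he : e + e' ≤ e'') : g * h ∈ G t 1 e'' := by
  have := G_mul hg hh
  rw [zero_add] at this
  exact G_le he this

lemma drop1 {e e' : ℤ} {h : R} (hh : h ∈ G t 1 e) (he : e - 6 ≤ e') : h ∈ G t 0 e' :=
  G_le he (G_drop (k := 0) hh)

lemma mA4 : ev t A4 ∈ G t 0 7 := ev_mem _ (by decide)
lemma mA3 : ev t A3 ∈ G t 0 8 := ev_mem _ (by decide)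
lemma mA2 : ev t A2 ∈ G t 0 9 := ev_mem _ (by decide)
lemma mA1 : ev t A1 ∈ G t 0 10 := ev_mem _ (by decide)
lemma mA0 : ev t A0 ∈ G t 0 5 := ev_mem _ (by decide)
lemma mB0 : ev t B0 - t ∈ G t 1 15 := by
  have : ev t B0 - t = ev t [0,0,-210,-12490,-229200,-1992375,-8843750,-16625000,10500000,90000000,100000000] := by
    simp [ev, B0]; ring
  rw [this]; exact ev_mem _ (by decide)
lemma mB1 : ev t B1 - t ∈ G t 1 14 := by
  have : ev t B1 - t = ev t [0,0,-2585,-135325,-2428875,-20991000,-92350000,-164500000,170000000,1100000000,1200000000] := by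
    simp [ev, B1]; ring
  rw [this]; exact ev_mem _ (by decide)
lemma mB2 : ev t B2 - t ∈ G t 1 13 := by
  have : ev t B2 - t = ev t [0,0,-9080,-471775,-8462250,-73014500,-317530000,-524000000,852000000,4480000000,4800000000] := by
    simp [ev, B2]; ring
  rw [this]; exact ev_mem _ (by decide)
lemma mB3 : ev t B3 - t ∈ G t 1 12 := by
  have : ev t B3 - t = ev t [0,-10,-10735,-544050,-9755000,-83990000,-359160000,-528800000,1360000000,6080000000,6400000000] := by
    simp [ev, B3]; ring
  rw [this]; exact ev_mem _ (by decide)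
lemma mB4 : ev t B4 - t ∈ G t 1 11 := by
  have : ev t B4 - t = ev t [0,50,1580,6000,-8000,-40000] := by
    simp [ev, B4]; ring
  rw [this]; exact ev_mem _ (by decide)
lemma mD : ev t DD - 1 ∈ G t 1 6 := by
  have : ev t DD - 1 = ev t [0,55,1100,11250,65625,221875,406250,312500] := by
    simp [ev, DD]
  rw [this]; exact ev_mem _ (by decide)

lemma mu (d : Dat t Φ) : ∀ n : ℕ, U (t ^ n) ∈ G t 0 (n + 6) := by
  have h0 : U (t ^ 0) ∈ G t 0 6 := by
    rw [pow_zero, U_one]; exact one_mem_G (by norm_num)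
  have h1 : U t ∈ G t 0 7 := by rw [d.hu1]; exact mA4
  have h2 : U (t ^ 2) ∈ G t 0 8 := by
    rw [d.hu2]
    exact Submodule.add_mem _ (drop1 (fmul mA4 h1 le_rfl) (by norm_num)) (int_mul_mem 2 mA3)
  have h3 : U (t ^ 3) ∈ G t 0 9 := by
    rw [d.hu3]
    exact Submodule.add_mem _ (Submodule.add_mem _ (drop1 (fmul mA4 h2 le_rfl) (by norm_num))
      (drop1 (fmul mA3 h1 le_rfl) (by norm_num))) (int_mul_mem 3 mA2)
  have h4 : U (t ^ 4) ∈ G t 0 10 := by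
    rw [d.hu4]
    exact Submodule.add_mem _ (Submodule.add_mem _ (Submodule.add_mem _
      (drop1 (fmul mA4 h3 le_rfl) (by norm_num))
      (drop1 (fmul mA3 h2 le_rfl) (by norm_num))) (drop1 (fmul mA2 h1 le_rfl) (by norm_num)))
      (int_mul_mem 4 mA1)
  intro n
  induction n using Nat.strong_induction_on with
  | _ n ih =>
    match n, ih with
    | 0, _ => exact h0
    | 1, _ => rw [pow_one]; exact h1
    | 2, _ => exact h2
    | 3, _ => exact h3
    | 4, _ => exact h4
    | n + 5, ih =>
      rw [d.hrec]
      have i0 := ih n (by omega)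
      have i1 := ih (n + 1) (by omega)
      have i2 := ih (n + 2) (by omega)
      have i3 := ih (n + 3) (by omega)
      have i4 := ih (n + 4) (by omega)
      refine Submodule.add_mem _ (Submodule.add_mem _ (Submodule.add_mem _ (Submodule.add_mem _
        (gmul mA0 i0 ?_) (drop1 (fmul mA1 i1 le_rfl) ?_)) (drop1 (fmul mA2 i2 le_rfl) ?_))
        (drop1 (fmul mA3 i3 le_rfl) ?_)) (drop1 (fmul mA4 i4 le_rfl) ?_) <;> push_cast <;> omega

lemma tmem {e : ℤ} {h : R} (hh : h ∈ G t 1 e) {e' : ℤ} (he : e - 6 ≤ e') (ht : 5 ≤ e')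
    {b : R} (hb : b - t = h) : b ∈ G t 0 e' := by
  have : b = h + t := by rw [← hb]; ring
  rw [this]
  exact Submodule.add_mem _ (drop1 hh he) (t_mem_G ht)

lemma mw (d : Dat t Φ) (n : ℕ) : U (Φ * t ^ n) ∈ G t 0 (n + 15) := by
  apply G_div (w := 1 - ev t DD)
  · have : (1 - ev t DD : R) = -(ev t DD - 1) := by ring
    rw [this]
    exact Submodule.neg_mem _ (drop1 mD (by norm_num))
  · have : (1 - ev t DD : R) = t * (- ev t [55,1100,11250,65625,221875,406250,312500]) := by
      simp [ev, DD]; ring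
    rw [this]
    exact Dvd.dvd.mul_right d.ht _
  · have : U (Φ * t ^ n) * (1 - (1 - ev t DD)) = ev t DD * U (Φ * t ^ n) := by ring
    rw [this, d.hΦ]
    have i0 := mu d n
    have i1 := mu d (n + 1)
    have i2 := mu d (n + 2)
    have i3 := mu d (n + 3)
    have i4 := mu d (n + 4)
    refine Submodule.add_mem _ (Submodule.add_mem _ (Submodule.add_mem _ (Submodule.add_mem _
      (gmul (tmem (e' := 9) mB0 ?_ ?_ rfl) i0 ?_) (gmul (tmem (e' := 8) mB1 ?_ ?_ rfl) i1 ?_))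
      (gmul (tmem (e' := 7) mB2 ?_ ?_ rfl) i2 ?_))
      (gmul (tmem (e' := 6) mB3 ?_ ?_ rfl) i3 ?_)) (gmul (tmem (e' := 5) mB4 ?_ ?_ rfl) i4 ?_)
      <;> push_cast <;> omega

/-- residues of the first few values -/
def res (t : R) : ℕ → R
  | 0 => 1
  | 1 => t
  | 2 => t
  | 3 => t
  | 4 => 2 * t + 4 * t ^ 2
  | 5 => t
  | 6 => t ^ 2
  | 7 => t ^ 2
  | _ => 0

lemma mres (d : Dat t Φ) (n : ℕ) (hn : n ≤ 7) : U (t ^ n) - res t n ∈ G t 1 (n + 12) := by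
  have m1 := mu d 1
  have m2 := mu d 2
  have m3 := mu d 3
  have m4 := mu d 4
  have m5 := mu d 5
  have m6 := mu d 6
  rw [pow_one] at m1
  push_cast at m1 m2 m3 m4 m5 m6
  have l1 : U t - t ∈ G t 1 13 := by
    have : U t - t = ev t [0, 40, 860, 6800, 24000, 32000] := by
      rw [d.hu1]; simp [ev, A4]; ring
    rw [this]; exact ev_mem _ (by decide)
  have l2 : U (t ^ 2) - t ∈ G t 1 14 := by
    have : U (t ^ 2) - t = 5 * ev t A4 * U t + ev t [0, 85, 1790, 14000, 48800, 64000] := by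
      rw [d.hu2]; simp [ev, A3]; ring
    rw [this]; exact Submodule.add_mem _ (fmul mA4 m1 (by norm_num)) (ev_mem _ (by decide))
  have l3 : U (t ^ 3) - t ∈ G t 1 15 := by
    have : U (t ^ 3) - t = 5 * ev t A4 * U (t ^ 2) + 5 * ev t A3 * U t
        + ev t [0, 50, 1050, 8115, 27900, 36000] := by
      rw [d.hu3]; simp [ev, A2]; ring
    rw [this]
    exact Submodule.add_mem _ (Submodule.add_mem _ (fmul mA4 m2 (by norm_num))
      (fmul mA3 m1 (by norm_num))) (ev_mem _ (by decide))
  have l4 : U (t ^ 4) - (2 * t + 4 * t ^ 2) ∈ G t 1 16 := by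
    have : U (t ^ 4) - (2 * t + 4 * t ^ 2) = 5 * ev t A4 * U (t ^ 3) + 5 * ev t A3 * U (t ^ 2)
        + 5 * ev t A2 * U t + ev t [0, 10, 240, 1860, 6300, 8000] := by
      rw [d.hu4]; simp [ev, A1]; ring
    rw [this]
    exact Submodule.add_mem _ (Submodule.add_mem _ (Submodule.add_mem _ (fmul mA4 m3 (by norm_num))
      (fmul mA3 m2 (by norm_num))) (fmul mA2 m1 (by norm_num))) (ev_mem _ (by decide))
  have l5 : U (t ^ 5) - t ∈ G t 1 17 := by
    have : U (t ^ 5) - t = ev t [0, 0, 20, 150, 500, 625] + 5 * ev t A1 * U t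
        + 5 * ev t A2 * U (t ^ 2) + 5 * ev t A3 * U (t ^ 3) + 5 * ev t A4 * U (t ^ 4) := by
      have := d.hrec 0
      simp only [zero_add, pow_zero, U_one, pow_one] at this
      rw [this]; simp [ev, A0]; ring
    rw [this]
    exact Submodule.add_mem _ (Submodule.add_mem _ (Submodule.add_mem _ (Submodule.add_mem _
      (ev_mem _ (by decide)) (fmul mA1 m1 (by norm_num))) (fmul mA2 m2 (by norm_num)))
      (fmul mA3 m3 (by norm_num))) (fmul mA4 m4 (by norm_num))
  have l6 : U (t ^ 6) - t ^ 2 ∈ G t 1 18 := by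
    have : U (t ^ 6) - t ^ 2 = ev t [0, 0, 0, 20, 150, 500, 625] + ev t A0 * (U t - t)
        + 5 * ev t A1 * U (t ^ 2)
        + 5 * ev t A2 * U (t ^ 3) + 5 * ev t A3 * U (t ^ 4) + 5 * ev t A4 * U (t ^ 5) := by
      have := d.hrec 1
      simp only [pow_one, Nat.reduceAdd] at this
      rw [this]; simp [ev, A0]; ring
    rw [this]
    exact Submodule.add_mem _ (Submodule.add_mem _ (Submodule.add_mem _ (Submodule.add_mem _
      (Submodule.add_mem _ (ev_mem _ (by decide)) (gmul01 mA0 l1 (by norm_num)))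
      (fmul mA1 m2 (by norm_num))) (fmul mA2 m3 (by norm_num)))
      (fmul mA3 m4 (by norm_num))) (fmul mA4 m5 (by norm_num))
  have l7 : U (t ^ 7) - t ^ 2 ∈ G t 1 19 := by
    have : U (t ^ 7) - t ^ 2 = ev t [0, 0, 0, 20, 150, 500, 625] + ev t A0 * (U (t ^ 2) - t)
        + 5 * ev t A1 * U (t ^ 3)
        + 5 * ev t A2 * U (t ^ 4) + 5 * ev t A3 * U (t ^ 5) + 5 * ev t A4 * U (t ^ 6) := by
      have := d.hrec 2
      simp only [Nat.reduceAdd] at this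
      rw [this]; simp [ev, A0]; ring
    rw [this]
    exact Submodule.add_mem _ (Submodule.add_mem _ (Submodule.add_mem _ (Submodule.add_mem _
      (Submodule.add_mem _ (ev_mem _ (by decide)) (gmul01 mA0 l2 (by norm_num)))
      (fmul mA1 m3 (by norm_num))) (fmul mA2 m4 (by norm_num)))
      (fmul mA3 m5 (by norm_num))) (fmul mA4 m6 (by norm_num))
  interval_cases n
  · simp [res, U_one]
  · rw [pow_one]; exact l1
  · exact l2
  · exact l3
  · exact l4
  · exact l5
  · exact l6
  · exact l7

lemma mwres (d : Dat t Φ) (n : ℕ) (hn : n ≤ 3) :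
    U (Φ * t ^ n) - t * (res t n + res t (n + 1) + res t (n + 2) + res t (n + 3) + res t (n + 4))
      ∈ G t 1 24 := by
  have i0 := mu d n
  have i1 := mu d (n + 1)
  have i2 := mu d (n + 2)
  have i3 := mu d (n + 3)
  have i4 := mu d (n + 4)
  have j0 := mres d n (by omega)
  have j1 := mres d (n + 1) (by omega)
  have j2 := mres d (n + 2) (by omega)
  have j3 := mres d (n + 3) (by omega)
  have j4 := mres d (n + 4) (by omega)
  have tm : t ∈ G t 0 5 := t_mem_G le_rfl
  have key : U (Φ * t ^ n)
      - t * (res t n + res t (n + 1) + res t (n + 2) + res t (n + 3) + res t (n + 4)) =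
      ((ev t B0 - t) * U (t ^ n) + (ev t B1 - t) * U (t ^ (n + 1))
      + (ev t B2 - t) * U (t ^ (n + 2)) + (ev t B3 - t) * U (t ^ (n + 3))
      + (ev t B4 - t) * U (t ^ (n + 4)))
      + (t * (U (t ^ n) - res t n) + t * (U (t ^ (n + 1)) - res t (n + 1))
      + t * (U (t ^ (n + 2)) - res t (n + 2)) + t * (U (t ^ (n + 3)) - res t (n + 3))
      + t * (U (t ^ (n + 4)) - res t (n + 4))) - (ev t DD - 1) * U (Φ * t ^ n) := by
    linear_combination d.hΦ n
  rw [key]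
  push_cast at *
  refine Submodule.sub_mem _ (Submodule.add_mem _ (Submodule.add_mem _ (Submodule.add_mem _
    (Submodule.add_mem _ (Submodule.add_mem _ (gmul10 mB0 i0 ?_) (gmul10 mB1 i1 ?_))
    (gmul10 mB2 i2 ?_)) (gmul10 mB3 i3 ?_)) (gmul10 mB4 i4 ?_))
    (Submodule.add_mem _ (Submodule.add_mem _ (Submodule.add_mem _ (Submodule.add_mem _
    (gmul01 tm j0 ?_) (gmul01 tm j1 ?_)) (gmul01 tm j2 ?_)) (gmul01 tm j3 ?_)) (gmul01 tm j4 ?_)))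
    (gmul10 mD (mw d n) ?_) <;> omega

/-- generators for odd steps -/
def odds (t : R) (k : ℕ) : Set R :=
  gens t (k + 1) 24 ∪ {5 ^ k * (t - t ^ 2), 5 ^ k * (t ^ 2 - t ^ 3)}

lemma G_pow {e : ℤ} {k : ℕ} {h : R} (hh : h ∈ G t k e) (j : ℕ) : 5 ^ j * h ∈ G t (k + j) e := by
  refine cl_mul _ ?_ hh
  rintro s ⟨v, m, h1, rfl⟩
  have : (5 : R) ^ j * (5 ^ (v + k) * t ^ m) = 5 ^ (v + (k + j)) * t ^ m := by ring
  rw [this]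
  exact mono_mem _ _ _ _ (by omega)

lemma U_five (k : ℕ) (h : R) : U (5 ^ k * h) = 5 ^ k * U h := by
  have h1 : ∀ h : R, (5 : R) ^ k * h = ((5 : ℤ) ^ k) • h := by
    intro h; rw [zsmul_eq_mul]; push_cast; rfl
  rw [h1, map_smul, h1]

lemma G_odds {k : ℕ} {h : R} (hh : h ∈ G t (k + 1) 24) : h ∈ cl (odds t k) :=
  cl_mono (fun _ hs => subset_cl (Or.inl hs)) hh

lemma step1 (d : Dat t Φ) (k : ℕ) {h : R} (hh : h ∈ G t k 15) : U (Φ * h) ∈ cl (odds t k) := by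
  refine cl_map (S := gens t k 15) (U ∘ₗ LinearMap.mulLeft ℤ Φ) (fun K => ⟨5 * K, fun h hh =>
    U_dvd _ K (Dvd.dvd.mul_left hh _)⟩) ?_ hh
  rintro s ⟨v, m, h1, rfl⟩
  simp only [LinearMap.comp_apply, LinearMap.mulLeft_apply]
  have e1 : Φ * (5 ^ (v + k) * t ^ m) = 5 ^ (v + k) * (Φ * t ^ m) := by ring
  rw [e1, U_five]
  rcases Nat.eq_zero_or_pos v with rfl | hv
  · have hm : m ≤ 3 := by omega
    have h2 := G_pow (mwres d m hm) k
    rw [add_comm 1 k] at h2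
    have h3 := G_odds h2
    have o1 : 5 ^ k * (t - t ^ 2) ∈ cl (odds t k) := subset_cl (Or.inr (Or.inl rfl))
    have o2 : 5 ^ k * (t ^ 2 - t ^ 3) ∈ cl (odds t k) := subset_cl (Or.inr (Or.inr rfl))
    have g2 : 5 ^ (k + 1) * t ^ 2 ∈ cl (odds t k) := by
      have := mono_mem (t := t) 0 2 (k + 1) 24 (by norm_num)
      rw [zero_add] at this
      exact G_odds this
    have g3 : 5 ^ (k + 1) * t ^ 3 ∈ cl (odds t k) := by
      have := mono_mem (t := t) 0 3 (k + 1) 24 (by norm_num)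
      rw [zero_add] at this
      exact G_odds this
    rw [zero_add]
    interval_cases m
    · have : 5 ^ k * U (Φ * t ^ 0) = 5 ^ k * (U (Φ * t ^ 0) - t * (res t 0 + res t (0 + 1)
          + res t (0 + 2) + res t (0 + 3) + res t (0 + 4))) + (5 ^ k * (t - t ^ 2))
          + (5 ^ k * (t ^ 2 - t ^ 3)) + 5 ^ (k + 1) * t ^ 2 + 5 ^ (k + 1) * t ^ 3 := by
        simp only [res]; ring
      rw [this]
      exact Submodule.add_mem _ (Submodule.add_mem _ (Submodule.add_mem _
        (Submodule.add_mem _ h3 o1) o2) g2) g3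
    · have : 5 ^ k * U (Φ * t ^ 1) = 5 ^ k * (U (Φ * t ^ 1) - t * (res t 1 + res t (1 + 1)
          + res t (1 + 2) + res t (1 + 3) + res t (1 + 4)))
          + (5 ^ k * (t ^ 2 - t ^ 3)) + 5 ^ (k + 1) * t ^ 2 + 5 ^ (k + 1) * t ^ 3 := by
        simp only [res]; ring
      rw [this]
      exact Submodule.add_mem _ (Submodule.add_mem _ 
        (Submodule.add_mem _ h3 o2) g2) g3
    · have : 5 ^ k * U (Φ * t ^ 2) = 5 ^ k * (U (Φ * t ^ 2) - t * (res t 2 + res t (2 + 1)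
          + res t (2 + 2) + res t (2 + 3) + res t (2 + 4)))
          + 5 ^ (k + 1) * t ^ 2 + 5 ^ (k + 1) * t ^ 3 := by
        simp only [res]; ring
      rw [this]
      exact Submodule.add_mem _ (Submodule.add_mem _ h3 g2) g3
    · have : 5 ^ k * U (Φ * t ^ 3) = 5 ^ k * (U (Φ * t ^ 3) - t * (res t 3 + res t (3 + 1)
          + res t (3 + 2) + res t (3 + 3) + res t (3 + 4)))
          - (5 ^ k * (t ^ 2 - t ^ 3)) + 5 ^ (k + 1) * t ^ 2 + 5 ^ (k + 1) * t ^ 3 := by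
        simp only [res]; ring
      rw [this]
      exact Submodule.add_mem _ (Submodule.add_mem _ 
        (Submodule.sub_mem _ h3 o2) g2) g3
  · obtain ⟨w, rfl⟩ : ∃ w, v = w + 1 := ⟨v - 1, by omega⟩
    apply G_odds
    refine cl_mul (S := gens t 0 (m + 15)) _ ?_ (mw d m)
    rintro s ⟨v', m', h2, rfl⟩
    have : (5 ^ (w + 1 + k) * (5 ^ (v' + 0) * t ^ m') : R) = 5 ^ (w + v' + (k + 1)) * t ^ m' := by
      ring
    rw [this]
    refine mono_mem _ _ _ _ ?_
    push_cast at *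
    omega

lemma step2 (d : Dat t Φ) (k : ℕ) {h : R} (hh : h ∈ cl (odds t k)) : U h ∈ G t (k + 1) 15 := by
  refine cl_U ?_ hh
  have l1 := mres d 1 (by norm_num)
  have l2 := mres d 2 (by norm_num)
  have l3 := mres d 3 (by norm_num)
  simp only [res, pow_one] at l1 l2 l3
  push_cast at l1 l2 l3
  have l1' : U t - t ∈ G t 1 15 := G_le (by norm_num) l1
  have l2' : U (t ^ 2) - t ∈ G t 1 15 := G_le (by norm_num) l2
  have l3' : U (t ^ 3) - t ∈ G t 1 15 := G_le (by norm_num) l3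
  rintro s (⟨v, m, h1, rfl⟩ | rfl | rfl)
  · rw [U_five]
    refine cl_mul (S := gens t 0 (m + 6)) _ ?_ (mu d m)
    rintro s ⟨v', m', h2, rfl⟩
    have : (5 ^ (v + (k + 1)) * (5 ^ (v' + 0) * t ^ m') : R) = 5 ^ (v + v' + (k + 1)) * t ^ m' := by
      ring
    rw [this]
    refine mono_mem _ _ _ _ ?_
    push_cast at *
    omega
  · rw [U_five, map_sub]
    have := G_pow (Submodule.sub_mem _ l1' l2') k
    have e : U t - U (t ^ 2) = U t - t - (U (t ^ 2) - t) := by ring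
    rw [add_comm 1 k, ← e] at this
    exact this
  · rw [U_five, map_sub]
    have := G_pow (Submodule.sub_mem _ l2' l3') k
    have e : U (t ^ 2) - U (t ^ 3) = U (t ^ 2) - t - (U (t ^ 3) - t) := by ring
    rw [add_comm 1 k, ← e] at this
    exact this

/-- the sequence of functions -/
def LL (Φ : R) : ℕ → R
  | 0 => 1
  | k + 1 => U (U (Φ * LL Φ k))

lemma LL_mem (d : Dat t Φ) (k : ℕ) : LL Φ k ∈ G t k 15 := by
  induction k with
  | zero => exact one_mem_G (by norm_num)
  | succ k ih => exact step2 d k (step1 d k ih)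

lemma LL_coeff (d : Dat t Φ) (k n : ℕ) : (5 : ℤ) ^ k ∣ coeff n (LL Φ k) := G_coeff (LL_mem d k) n

end C5
end

section
open PowerSeries
namespace C5

abbrev e5 : R →ₐ[ℤ] R := expand 5 (by norm_num)

lemma U_expand (g h : R) : U (e5 g * h) = g * U h := by
  ext n
  rw [coeff_U, coeff_mul, coeff_mul]
  symm
  refine Finset.sum_of_injOn (fun p => (5 * p.1, 5 * p.2)) ?_ ?_ ?_ ?_
  · rintro ⟨a, b⟩ _ ⟨c, d⟩ _ h
    simp only [Prod.mk.injEq] at h ⊢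
    omega
  · rintro ⟨a, b⟩ h
    simp only [Finset.mem_coe, Finset.HasAntidiagonal.mem_antidiagonal] at h ⊢
    omega
  · rintro ⟨a, b⟩ h h'
    rw [Finset.HasAntidiagonal.mem_antidiagonal] at h
    by_cases ha : 5 ∣ a
    · exfalso
      apply h'
      obtain ⟨c, rfl⟩ := ha
      refine ⟨(c, n - c), ?_, ?_⟩
      · simp only [Finset.mem_coe, Finset.HasAntidiagonal.mem_antidiagonal]
        dsimp only at h
        omega
      · simp only [Prod.mk.injEq, true_and]
        dsimp only at h
        omega
    · dsimp only
      rw [coeff_expand_of_not_dvd _ _ _ ha, zero_mul]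
  · rintro ⟨a, b⟩ _
    dsimp only
    rw [coeff_expand_mul, coeff_U]

lemma e5_inj {a b : R} (h : e5 a = e5 b) : a = b := by
  have h2 : U (e5 a * 1) = U (e5 b * 1) := by rw [h]
  rw [U_expand, U_expand, U_one, mul_one, mul_one] at h2
  exact h2

lemma map_ev {A B : Type*} [CommRing A] [CommRing B] (f : A →+* B) (t : A) (l : List ℤ) :
    f (ev t l) = ev (f t) l := by
  induction l with
  | nil => simp [ev]
  | cons a l ih => simp [ev, ih]

lemma e5_ev (t : R) (l : List ℤ) : e5 (ev t l) = ev (e5 t) l :=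
  map_ev (e5 : R →+* R) t l

/-- Newton identities for five distinct roots -/
lemma newton {K : Type*} [CommRing K] [IsDomain K] (s : Fin 5 → K) (hs : Function.Injective s)
    (a0 a1 a2 a3 a4 : K)
    (h : ∀ i, s i ^ 5 = a0 + a1 * s i + a2 * s i ^ 2 + a3 * s i ^ 3 + a4 * s i ^ 4) :
    (∑ i, s i) = a4 ∧ (∑ i, s i ^ 2) = a4 * (∑ i, s i) + 2 * a3 ∧
    (∑ i, s i ^ 3) = a4 * (∑ i, s i ^ 2) + a3 * (∑ i, s i) + 3 * a2 ∧
    (∑ i, s i ^ 4) = a4 * (∑ i, s i ^ 3) + a3 * (∑ i, s i ^ 2) + a2 * (∑ i, s i) + 4 * a1 := by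
  set x0 := s 0 with hx0
  set x1 := s 1 with hx1
  set x2 := s 2 with hx2
  set x3 := s 3 with hx3
  set x4 := s 4 with hx4
  have hv := Matrix.eq_zero_of_forall_index_sum_pow_mul_eq_zero (f := s)
    (v := ![x0*x1*x2*x3*x4 - a0,
      -(x0*x1*x2*x3 + x0*x1*x2*x4 + x0*x1*x3*x4 + x0*x2*x3*x4 + x1*x2*x3*x4) - a1,
      (x0*x1*x2 + x0*x1*x3 + x0*x1*x4 + x0*x2*x3 + x0*x2*x4 + x0*x3*x4 + x1*x2*x3 + x1*x2*x4
        + x1*x3*x4 + x2*x3*x4) - a2,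
      -(x0*x1 + x0*x2 + x0*x3 + x0*x4 + x1*x2 + x1*x3 + x1*x4 + x2*x3 + x2*x4 + x3*x4) - a3,
      (x0 + x1 + x2 + x3 + x4) - a4]) hs (by
    intro j
    have hj := h j
    have hz : (s j - x0) * (s j - x1) * (s j - x2) * (s j - x3) * (s j - x4) = 0 := by
      fin_cases j <;> simp [hx0, hx1, hx2, hx3, hx4]
    simp [Fin.sum_univ_succ]
    linear_combination hj - hz)
  have c0 := congrFun hv 0
  have c1 := congrFun hv 1
  have c2 := congrFun hv 2
  have c3 := congrFun hv 3
  have c4 := congrFun hv 4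
  simp at c0 c1 c2 c3 c4
  have d1 : a1 = -(x0*x1*x2*x3 + x0*x1*x2*x4 + x0*x1*x3*x4 + x0*x2*x3*x4 + x1*x2*x3*x4) := by
    linear_combination -c1
  have d2 : a2 = (x0*x1*x2 + x0*x1*x3 + x0*x1*x4 + x0*x2*x3 + x0*x2*x4 + x0*x3*x4 + x1*x2*x3
      + x1*x2*x4 + x1*x3*x4 + x2*x3*x4) := by
    linear_combination -c2
  have d3 : a3 = -(x0*x1 + x0*x2 + x0*x3 + x0*x4 + x1*x2 + x1*x3 + x1*x4 + x2*x3 + x2*x4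
      + x3*x4) := by
    linear_combination -c3
  have d4 : a4 = x0 + x1 + x2 + x3 + x4 := by linear_combination -c4
  have S : ∀ k : ℕ, ∑ i, s i ^ k = x0 ^ k + x1 ^ k + x2 ^ k + x3 ^ k + x4 ^ k := by
    intro k; rw [Fin.sum_univ_five]
  have S1 : ∑ i, s i = x0 + x1 + x2 + x3 + x4 := by rw [Fin.sum_univ_five]
  rw [S, S, S, S1, d1, d2, d3, d4]
  refine ⟨rfl, ?_, ?_, ?_⟩ <;> ring

abbrev RC := PowerSeries ℂ

/-- map to complex series after expanding -/
def NN : R →+* RC := (PowerSeries.map (Int.castRingHom ℂ)).comp (e5 : R →+* R)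

lemma coeff_NN (g : R) (n : ℕ) : coeff n (NN g) = ((coeff n (e5 g) : ℤ) : ℂ) := by
  rw [NN, RingHom.comp_apply, coeff_map]; rfl

lemma NN_inj {a b : R} (h : NN a = NN b) : a = b := by
  apply e5_inj
  ext n
  have := congrArg (coeff n) h
  rw [coeff_NN, coeff_NN] at this
  exact_mod_cast this

/-- conjugates -/
def sg (z : ℂ) (i : ℕ) : R →+* RC :=
  (PowerSeries.rescale (z ^ i)).comp (PowerSeries.map (Int.castRingHom ℂ))

lemma coeff_sg (z : ℂ) (i : ℕ) (g : R) (n : ℕ) :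
    coeff n (sg z i g) = (z ^ i) ^ n * ((coeff n g : ℤ) : ℂ) := by
  simp [sg, coeff_rescale]

lemma sg_e5 {z : ℂ} (hz : z ^ 5 = 1) (i : ℕ) (g : R) : sg z i (e5 g) = NN g := by
  ext n
  rw [coeff_sg, coeff_NN]
  by_cases h : 5 ∣ n
  · obtain ⟨m, rfl⟩ := h
    have : (z ^ i) ^ (5 * m) = 1 := by
      rw [← pow_mul, show i * (5 * m) = 5 * (i * m) by ring, pow_mul, hz, one_pow]
    rw [this, one_mul]
  · rw [coeff_expand_of_not_dvd _ _ _ h]; simp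

lemma sg_trace {z : ℂ} (hz : IsPrimitiveRoot z 5) (h : R) :
    ∑ i : Fin 5, sg z i h = 5 * NN (U h) := by
  ext n
  rw [map_sum]
  have h5 : (5 : RC) * NN (U h) = C (5 : ℂ) * NN (U h) := by rw [map_ofNat]
  rw [h5, coeff_C_mul, coeff_NN]
  simp only [coeff_sg]
  rw [← Finset.sum_mul]
  by_cases hn : 5 ∣ n
  · obtain ⟨m, rfl⟩ := hn
    rw [coeff_expand_mul, coeff_U]
    congr 1
    have : ∀ i : ℕ, (z ^ i) ^ (5 * m) = 1 := by
      intro i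
      rw [← pow_mul, show i * (5 * m) = 5 * (i * m) by ring, pow_mul, hz.pow_eq_one, one_pow]
    simp [this]
  · rw [coeff_expand_of_not_dvd _ _ _ hn]
    have hp : IsPrimitiveRoot (z ^ n) 5 := by
      apply hz.pow_of_coprime
      rw [Nat.coprime_comm]
      exact (Nat.Prime.coprime_iff_not_dvd (by norm_num)).2 hn
    have hg := hp.geom_sum_eq_zero (by norm_num)
    rw [Finset.sum_range] at hg
    have : ∑ i : Fin 5, (z ^ (i : ℕ)) ^ n = 0 := by
      rw [← hg]
      apply Finset.sum_congr rfl
      intro i _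
      rw [← pow_mul, ← pow_mul, mul_comm]
    rw [this]; simp

lemma cancel5 {a b : RC} (h : 5 * a = 5 * b) : a = b := by
  have h5 : (5 : RC) ≠ 0 := by
    intro h0
    have := congrArg (coeff 0) h0
    rw [← map_ofNat (C : ℂ →+* RC) 5, coeff_zero_C, map_zero] at this
    norm_num at this
  exact mul_left_cancel₀ h5 h

theorem mkDat {t Φ : R} (ht : X ∣ t) (ht1 : coeff 1 t = 1)
    (hE : t ^ 5 = ev (e5 t) A0 + 5 * ev (e5 t) A1 * t + 5 * ev (e5 t) A2 * t ^ 2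
      + 5 * ev (e5 t) A3 * t ^ 3 + 5 * ev (e5 t) A4 * t ^ 4)
    (hΦ : ev (e5 t) DD * Φ = ev (e5 t) B0 + ev (e5 t) B1 * t + ev (e5 t) B2 * t ^ 2
      + ev (e5 t) B3 * t ^ 3 + ev (e5 t) B4 * t ^ 4) : Dat t Φ := by
  have hz : IsPrimitiveRoot (Complex.exp (2 * Real.pi * Complex.I / 5)) 5 := by
    have := Complex.isPrimitiveRoot_exp 5 (by norm_num)
    exact_mod_cast this
  set z := Complex.exp (2 * Real.pi * Complex.I / 5)
  have hN := newton (fun i : Fin 5 => sg z i t) (by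
    intro i j hij
    have := congrArg (coeff 1) hij
    simp only [coeff_sg, ht1] at this
    simp only [pow_one, Int.cast_one, mul_one] at this
    exact Fin.ext (hz.pow_inj i.2 j.2 this))
    (NN (ev t A0)) (5 * NN (ev t A1)) (5 * NN (ev t A2)) (5 * NN (ev t A3)) (5 * NN (ev t A4)) (by
    intro i
    have := congrArg (sg z i) hE
    simp only [map_pow, map_add, map_mul, ← e5_ev, sg_e5 hz.pow_eq_one, map_ofNat] at this
    exact this)
  simp only [← map_pow, sg_trace hz] at hN
  obtain ⟨n1, n2, n3, n4⟩ := hN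
  have u1 : U t = ev t A4 := NN_inj (cancel5 n1)
  refine ⟨ht, u1, ?_, ?_, ?_, ?_, ?_⟩
  · apply NN_inj
    apply cancel5
    simp only [map_add, map_mul, map_ofNat]
    linear_combination n2
  · apply NN_inj
    apply cancel5
    simp only [map_add, map_mul, map_ofNat]
    linear_combination n3
  · apply NN_inj
    apply cancel5
    simp only [map_add, map_mul, map_ofNat]
    linear_combination n4
  · intro n
    have : t ^ (n + 5) = e5 (ev t A0) * t ^ n + e5 (5 * ev t A1) * t ^ (n + 1)
        + e5 (5 * ev t A2) * t ^ (n + 2) + e5 (5 * ev t A3) * t ^ (n + 3)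
        + e5 (5 * ev t A4) * t ^ (n + 4) := by
      simp only [map_mul, map_ofNat, e5_ev]
      linear_combination t ^ n * hE
    rw [this]
    simp only [map_add U, U_expand]
  · intro n
    have : e5 (ev t DD) * (Φ * t ^ n) = e5 (ev t B0) * t ^ n + e5 (ev t B1) * t ^ (n + 1)
        + e5 (ev t B2) * t ^ (n + 2) + e5 (ev t B3) * t ^ (n + 3)
        + e5 (ev t B4) * t ^ (n + 4) := by
      simp only [e5_ev]
      linear_combination t ^ n * hΦ
    rw [← U_expand, this]
    simp only [map_add U, U_expand]

end C5
end

section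
open PowerSeries
namespace C5

lemma alg_S1 {K : Type*} [CommRing K] (t T : K)
    (hE : t ^ 5 = ev T A0 + 5 * ev T A1 * t + 5 * ev T A2 * t ^ 2
      + 5 * ev T A3 * t ^ 3 + 5 * ev T A4 * t ^ 4) :
    (ev T B0 + ev T B1 * t + ev T B2 * t ^ 2 + ev T B3 * t ^ 3 + ev T B4 * t ^ 4) * (1 + 5 * t) =
    ((1 * T ^ 1 + 45 * T ^ 2 + 510 * T ^ 3 - 2950 * T ^ 4 - 119875 * T ^ 5 - 1234375 * T ^ 6 - 6687500 * T ^ 7 - 20750000 * T ^ 8 - 35000000 * T ^ 9 - 25000000 * T ^ 10) * t ^ 0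
      + (6 * T ^ 1 + 190 * T ^ 2 - 1500 * T ^ 3 - 122500 * T ^ 4 - 2027250 * T ^ 5 - 17256250 * T ^ 6 - 86375000 * T ^ 7 - 257500000 * T ^ 8 - 425000000 * T ^ 9 - 300000000 * T ^ 10) * t ^ 1
      + (6 * T ^ 1 - 330 * T ^ 2 - 30650 * T ^ 3 - 782750 * T ^ 4 - 10164500 * T ^ 5 - 77880000 * T ^ 6 - 368500000 * T ^ 7 - 1063000000 * T ^ 8 - 1720000000 * T ^ 9 - 1200000000 * T ^ 10) * t ^ 2
      + (- 4 * T ^ 1 - 1310 * T ^ 2 - 63300 * T ^ 3 - 1338750 * T ^ 4 - 15802500 * T ^ 5 - 114210000 * T ^ 6 - 519800000 * T ^ 7 - 1460000000 * T ^ 8 - 2320000000 * T ^ 9 - 1600000000 * T ^ 10) * t ^ 3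
      + (6 * T ^ 1 + 180 * T ^ 2 + 1750 * T ^ 3 + 7000 * T ^ 4 + 10000 * T ^ 5) * t ^ 4) := by
  simp only [ev, A0, A1, A2, A3, A4, B0, B1, B2, B3, B4] at *
  push_cast at *
  linear_combination (255 * T ^ 1 + 7900 * T ^ 2 + 30000 * T ^ 3 - 40000 * T ^ 4 - 200000 * T ^ 5) * hE

lemma alg_S2 {K : Type*} [CommRing K] (t T : K)
    (hE : t ^ 5 = ev T A0 + 5 * ev T A1 * t + 5 * ev T A2 * t ^ 2
      + 5 * ev T A3 * t ^ 3 + 5 * ev T A4 * t ^ 4) :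
    ((1 * T ^ 1 + 45 * T ^ 2 + 510 * T ^ 3 - 2950 * T ^ 4 - 119875 * T ^ 5 - 1234375 * T ^ 6 - 6687500 * T ^ 7 - 20750000 * T ^ 8 - 35000000 * T ^ 9 - 25000000 * T ^ 10) * t ^ 0
      + (6 * T ^ 1 + 190 * T ^ 2 - 1500 * T ^ 3 - 122500 * T ^ 4 - 2027250 * T ^ 5 - 17256250 * T ^ 6 - 86375000 * T ^ 7 - 257500000 * T ^ 8 - 425000000 * T ^ 9 - 300000000 * T ^ 10) * t ^ 1
      + (6 * T ^ 1 - 330 * T ^ 2 - 30650 * T ^ 3 - 782750 * T ^ 4 - 10164500 * T ^ 5 - 77880000 * T ^ 6 - 368500000 * T ^ 7 - 1063000000 * T ^ 8 - 1720000000 * T ^ 9 - 1200000000 * T ^ 10) * t ^ 2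
      + (- 4 * T ^ 1 - 1310 * T ^ 2 - 63300 * T ^ 3 - 1338750 * T ^ 4 - 15802500 * T ^ 5 - 114210000 * T ^ 6 - 519800000 * T ^ 7 - 1460000000 * T ^ 8 - 2320000000 * T ^ 9 - 1600000000 * T ^ 10) * t ^ 3
      + (6 * T ^ 1 + 180 * T ^ 2 + 1750 * T ^ 3 + 7000 * T ^ 4 + 10000 * T ^ 5) * t ^ 4) ^ 2 = ev T DD ^ 2 * T ^ 2 * (1 + 4 * T) * (1 + 4 * t) ^ 3 := by
  simp only [ev, A0, A1, A2, A3, A4, DD] at *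
  push_cast at *
  linear_combination ((24 * T ^ 2 + 2140 * T ^ 3 + 78000 * T ^ 4 + 1504900 * T ^ 5 + 16111000 * T ^ 6 + 75552500 * T ^ 7 - 339100000 * T ^ 8 - 8174062500 * T ^ 9 - 64675000000 * T ^ 10 - 304168750000 * T ^ 11 - 922375000000 * T ^ 12 - 1780000000000 * T ^ 13 - 2000000000000 * T ^ 14 - 1000000000000 * T ^ 15) * t ^ 0
      + (88 * T ^ 2 + 6580 * T ^ 3 + 171100 * T ^ 4 + 1021000 * T ^ 5 - 42372000 * T ^ 6 - 1206837500 * T ^ 7 - 16188462500 * T ^ 8 - 136897000000 * T ^ 9 - 787228750000 * T ^ 10 - 3142100000000 * T ^ 11 - 8612500000000 * T ^ 12 - 15520000000000 * T ^ 13 - 16600000000000 * T ^ 14 - 8000000000000 * T ^ 15) * t ^ 1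
      + (- 48 * T ^ 2 - 9780 * T ^ 3 - 647600 * T ^ 4 - 22035000 * T ^ 5 - 457800000 * T ^ 6 - 6337672500 * T ^ 7 - 61359600000 * T ^ 8 - 426234000000 * T ^ 9 - 2143890000000 * T ^ 10 - 7762900000000 * T ^ 11 - 19766000000000 * T ^ 12 - 33640000000000 * T ^ 13 - 34400000000000 * T ^ 14 - 16000000000000 * T ^ 15) * t ^ 2
      + (36 * T ^ 2 + 2160 * T ^ 3 + 53400 * T ^ 4 + 714000 * T ^ 5 + 5702500 * T ^ 6 + 28100000 * T ^ 7 + 84000000 * T ^ 8 + 140000000 * T ^ 9 + 100000000 * T ^ 10) * t ^ 3) * hE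


lemma alg_E {K : Type*} [CommRing K] [IsDomain K] (t T : K)
    (hne : 5 * (1 + 4 * T) * t + (1 + 5 * T) ≠ 0)
    (h : T * (1 + 5 * T) ^ 5 * (1 + 4 * t) ^ 5 = (1 + 4 * T) * (1 + 5 * t) * t ^ 5) :
    t ^ 5 = ev T A0 + 5 * ev T A1 * t + 5 * ev T A2 * t ^ 2
      + 5 * ev T A3 * t ^ 3 + 5 * ev T A4 * t ^ 4 := by
  have : (t ^ 5 - (ev T A0 + 5 * ev T A1 * t + 5 * ev T A2 * t ^ 2
      + 5 * ev T A3 * t ^ 3 + 5 * ev T A4 * t ^ 4)) * (5 * (1 + 4 * T) * t + (1 + 5 * T)) = 0 := by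
    simp only [ev, A0, A1, A2, A3, A4]
    push_cast
    linear_combination - h
  rcases mul_eq_zero.1 this with h1 | h1
  · exact sub_eq_zero.1 h1
  · exact absurd h1 hne

lemma monos {K : Type*} [Field K] (x f1 f2 f5 f10 f25 f50 t T Φ : K)
    (h1 : f1 ≠ 0) (h2 : f2 ≠ 0) (h5 : f5 ≠ 0) (h10 : f10 ≠ 0) (h25 : f25 ≠ 0) (h50 : f50 ≠ 0)
    (ht : t * (f1 ^ 3 * f5) = x * f2 * f10 ^ 3) (hT : T * (f5 ^ 3 * f25) = x ^ 5 * f10 * f50 ^ 3)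
    (hΦ : Φ * (f1 * f2 ^ 2) = x ^ 5 * (f25 * f50 ^ 2))
    (p : (1 + 4 * t) * (f1 ^ 4 * f10 ^ 2) = f5 ^ 4 * f2 ^ 2)
    (r : (1 + 5 * t) * (f1 ^ 5 * f10) = f2 ^ 5 * f5)
    (P : (1 + 4 * T) * (f5 ^ 4 * f50 ^ 2) = f25 ^ 4 * f10 ^ 2)
    (S : (1 + 5 * T) * (f5 ^ 5 * f50) = f10 ^ 5 * f25) :
    T * (1 + 5 * T) ^ 5 * (1 + 4 * t) ^ 5 = (1 + 4 * T) * (1 + 5 * t) * t ^ 5 ∧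
    Φ ^ 2 * (1 + 5 * t) ^ 2 = T ^ 2 * (1 + 4 * T) * (1 + 4 * t) ^ 3 := by
  have ht' : t = x * f2 * f10 ^ 3 / (f1 ^ 3 * f5) := by rw [eq_div_iff (by positivity)]; exact ht
  have hT' : T = x ^ 5 * f10 * f50 ^ 3 / (f5 ^ 3 * f25) := by
    rw [eq_div_iff (by positivity)]; exact hT
  have hΦ' : Φ = x ^ 5 * (f25 * f50 ^ 2) / (f1 * f2 ^ 2) := by
    rw [eq_div_iff (by positivity)]; exact hΦ
  have p' : 1 + 4 * t = f5 ^ 4 * f2 ^ 2 / (f1 ^ 4 * f10 ^ 2) := by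
    rw [eq_div_iff (by positivity)]; exact p
  have r' : 1 + 5 * t = f2 ^ 5 * f5 / (f1 ^ 5 * f10) := by
    rw [eq_div_iff (by positivity)]; exact r
  have P' : 1 + 4 * T = f25 ^ 4 * f10 ^ 2 / (f5 ^ 4 * f50 ^ 2) := by
    rw [eq_div_iff (by positivity)]; exact P
  have S' : 1 + 5 * T = f10 ^ 5 * f25 / (f5 ^ 5 * f50) := by
    rw [eq_div_iff (by positivity)]; exact S
  constructor
  · rw [p', r', P', S', ht', hT']
    field_simp
  · rw [p', r', P', hΦ', hT']
    field_simp

/-- the functions and identities at level ten -/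
structure Lev (f1 f2 f5 f10 f25 f50 t Φ : R) : Prop where
  c1 : constantCoeff f1 = 1
  c2 : constantCoeff f2 = 1
  e1 : e5 f1 = f5
  e2 : e5 f2 = f10
  e3 : e5 f5 = f25
  e4 : e5 f10 = f50
  ht : t * (f1 ^ 3 * f5) = X * (f2 * f10 ^ 3)
  hΦ : Φ * (f1 * f2 ^ 2) = X ^ 5 * (f25 * f50 ^ 2)
  I1 : f1 ^ 4 * f5 * f10 ^ 2 + 4 * X * f1 * f2 * f10 ^ 5 = f2 ^ 2 * f5 ^ 5
  I2 : f1 ^ 5 * f5 * f10 + 5 * X * f1 ^ 2 * f2 * f10 ^ 4 = f2 ^ 5 * f5 ^ 2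

lemma ne_of_const {f : R} (h : constantCoeff f = 1) : f ≠ 0 := by
  rintro rfl
  simp at h

theorem lev_dat {f1 f2 f5 f10 f25 f50 t Φ : R} (v : Lev f1 f2 f5 f10 f25 f50 t Φ) : Dat t Φ := by
  obtain ⟨c1, c2, e1, e2, e3, e4, ht, hΦ, I1, I2⟩ := v
  have cc : ∀ g : R, constantCoeff (e5 g) = constantCoeff g := fun g => constantCoeff_expand _ _ _
  have c5 : constantCoeff f5 = 1 := by rw [← e1, cc, c1]
  have c10 : constantCoeff f10 = 1 := by rw [← e2, cc, c2]
  have c25 : constantCoeff f25 = 1 := by rw [← e3, cc, c5]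
  have c50 : constantCoeff f50 = 1 := by rw [← e4, cc, c10]
  have n1 := ne_of_const c1
  have n2 := ne_of_const c2
  have n5 := ne_of_const c5
  have n10 := ne_of_const c10
  have n25 := ne_of_const c25
  have n50 := ne_of_const c50
  -- factor out X
  have hXt : X ∣ t := by
    have h1 : (X : R) ∣ t * (f1 ^ 3 * f5) := by rw [ht]; exact dvd_mul_right _ _
    rcases (X_prime (R := ℤ)).dvd_or_dvd h1 with h2 | h2
    · exact h2
    · rw [X_dvd_iff] at h2
      simp [c1, c5] at h2
  obtain ⟨u, hu⟩ := hXt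
  have cu : constantCoeff u = 1 := by
    have h1 : X * (u * (f1 ^ 3 * f5)) = X * (f2 * f10 ^ 3) := by rw [← ht, hu]; ring
    have h2 := mul_left_cancel₀ X_ne_zero h1
    have h3 := congrArg constantCoeff h2
    simpa [c1, c2, c5, c10] using h3
  set T := e5 t with hTdef
  have hTu : T = X ^ 5 * e5 u := by
    rw [hTdef, hu, map_mul, expand_X]
  have p : (1 + 4 * t) * (f1 ^ 4 * f10 ^ 2) = f5 ^ 4 * f2 ^ 2 := by
    apply mul_right_cancel₀ n5
    linear_combination I1 + 4 * f1 * f10 ^ 2 * ht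
  have r : (1 + 5 * t) * (f1 ^ 5 * f10) = f2 ^ 5 * f5 := by
    apply mul_right_cancel₀ n5
    linear_combination I2 + 5 * f1 ^ 2 * f10 * ht
  have hT : T * (f5 ^ 3 * f25) = X ^ 5 * (f10 * f50 ^ 3) := by
    have := congrArg e5 ht
    simpa only [map_mul, map_pow, e1, e2, e3, e4, expand_X] using this
  have P : (1 + 4 * T) * (f5 ^ 4 * f50 ^ 2) = f25 ^ 4 * f10 ^ 2 := by
    have := congrArg e5 p
    simpa only [map_mul, map_pow, map_add, map_one, map_ofNat, e1, e2, e3, e4] using this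
  have S : (1 + 5 * T) * (f5 ^ 5 * f50) = f10 ^ 5 * f25 := by
    have := congrArg e5 r
    simpa only [map_mul, map_pow, map_add, map_one, map_ofNat, e1, e2, e3, e4] using this
  let ι := algebraMap R (FractionRing R)
  have ιinj : Function.Injective ι := IsFractionRing.injective R (FractionRing R)
  have ιn : ∀ {g : R}, g ≠ 0 → ι g ≠ 0 := fun {g} hg h0 => hg (ιinj (by rw [h0, map_zero]))
  have i4 : ι 4 = 4 := map_ofNat ι 4
  have i5 : ι 5 = 5 := map_ofNat ι 5
  have M := monos (ι X) (ι f1) (ι f2) (ι f5) (ι f10) (ι f25) (ι f50) (ι t) (ι T) (ι Φ)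
    (ιn n1) (ιn n2) (ιn n5) (ιn n10) (ιn n25) (ιn n50)
    (by simpa [mul_assoc] using congrArg ι ht) (by simpa [mul_assoc] using congrArg ι hT)
    (by simpa using congrArg ι hΦ)
    (by simpa [i4, i5] using congrArg ι p) (by simpa [i4, i5] using congrArg ι r) (by simpa [i4, i5] using congrArg ι P)
    (by simpa [i4, i5] using congrArg ι S)
  have M1 : T * (1 + 5 * T) ^ 5 * (1 + 4 * t) ^ 5 = (1 + 4 * T) * (1 + 5 * t) * t ^ 5 := by
    apply ιinj
    simpa [i4, i5] using M.1
  have M2 : Φ ^ 2 * (1 + 5 * t) ^ 2 = T ^ 2 * (1 + 4 * T) * (1 + 4 * t) ^ 3 := by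
    apply ιinj
    simpa [i4, i5] using M.2
  have ct : constantCoeff t = 0 := by rw [hu]; simp
  have cT : constantCoeff T = 0 := by rw [hTdef, cc, ct]
  have hE := alg_E t T (ne_of_const (by simp [ct, cT])) M1
  refine mkDat ⟨u, hu⟩ ?_ hE ?_
  · rw [hu, show 1 = 0 + 1 from rfl, coeff_succ_X_mul, coeff_zero_eq_constantCoeff, cu]
  · have s1 := alg_S1 t T hE
    have s2 := alg_S2 t T hE
    rw [← s1] at s2
    set SS := ev T B0 + ev T B1 * t + ev T B2 * t ^ 2 + ev T B3 * t ^ 3 + ev T B4 * t ^ 4 with hSS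
    have n15 : (1 + 5 * t) ^ 2 ≠ 0 := ne_of_const (by simp [ct])
    have hsq : (1 + 5 * t) ^ 2 * (SS - ev T DD * Φ) * (SS + ev T DD * Φ) = 0 := by
      linear_combination s2 - ev T DD ^ 2 * M2
    have hΦX : X ^ 5 ∣ Φ := by
      have h1 : (X : R) ^ 5 ∣ Φ * (f1 * f2 ^ 2) := by rw [hΦ]; exact dvd_mul_right _ _
      apply (X_prime (R := ℤ)).pow_dvd_of_dvd_mul_right 5 _ h1
      rw [X_dvd_iff]
      simp [c1, c2]
    obtain ⟨w, hw⟩ := hΦX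
    have cw : constantCoeff w = 1 := by
      have h1 : X ^ 5 * (w * (f1 * f2 ^ 2)) = X ^ 5 * (f25 * f50 ^ 2) := by rw [← hΦ, hw]; ring
      have h2 := mul_left_cancel₀ (pow_ne_zero 5 X_ne_zero) h1
      have h3 := congrArg constantCoeff h2
      simpa [c1, c2, c25, c50] using h3
    have hplus : SS + ev T DD * Φ ≠ 0 := by
      have : ∃ y : R, constantCoeff y = 2 ∧ SS + ev T DD * Φ = X ^ 5 * y := by
        refine ⟨e5 u * (ev T B0.tail + ev T B1.tail * t + ev T B2.tail * t ^ 2 + ev T B3.tail * t ^ 3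
          + ev T B4.tail * t ^ 4) + ev T DD * w, ?_, ?_⟩
        · rw [map_add, map_mul, map_mul, cc, cu, cw]
          simp [ev, ct, cT, B0, DD]
        · have hB : ∀ l : List ℤ, ev T (0 :: l) = T * ev T l := by intro l; simp [ev]
          have b0 : ev T B0 = T * ev T B0.tail := hB _
          have b1 : ev T B1 = T * ev T B1.tail := hB _
          have b2 : ev T B2 = T * ev T B2.tail := hB _
          have b3 : ev T B3 = T * ev T B3.tail := hB _
          have b4 : ev T B4 = T * ev T B4.tail := hB _
          rw [hSS, b0, b1, b2, b3, b4, hw]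
          generalize ev T B0.tail = x0
          generalize ev T B1.tail = x1
          generalize ev T B2.tail = x2
          generalize ev T B3.tail = x3
          generalize ev T B4.tail = x4
          generalize ev T DD = x5
          rw [hTu]
          ring
      obtain ⟨y, hy, hy'⟩ := this
      rw [hy']
      intro h0
      rcases mul_eq_zero.1 h0 with h0 | h0
      · exact pow_ne_zero 5 X_ne_zero h0
      · rw [h0] at hy; simp at hy
    have := (mul_eq_zero.1 ((mul_eq_zero.1 hsq).resolve_right hplus)).resolve_left n15
    exact (sub_eq_zero.1 this).symm

end C5
end

section
open PowerSeries
namespace C5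

/-- admissible factors of an infinite product -/
def Ad (g : ℕ → R) : Prop := ∀ i, X ^ i ∣ g i

/-- characterization of the infinite product of the one plus g i -/
def IsPr (g : ℕ → R) (h : R) : Prop := ∀ N : ℕ, X ^ N ∣ h - ∏ i ∈ Finset.range N, (1 + g i)

lemma eq_of_dvd {a b : R} (h : ∀ N : ℕ, X ^ N ∣ a - b) : a = b := by
  ext n
  have := h (n + 1)
  rw [X_pow_dvd_iff] at this
  have := this n (by omega)
  rw [map_sub, sub_eq_zero] at this
  exact this

lemma dvd_sub_trans {N : ℕ} {a b c : R} (h1 : X ^ N ∣ a - b) (h2 : X ^ N ∣ b - c) :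
    X ^ N ∣ a - c := by
  have := dvd_add h1 h2
  rwa [sub_add_sub_cancel] at this

lemma dvd_sub_symm {N : ℕ} {a b : R} (h1 : X ^ N ∣ a - b) : X ^ N ∣ b - a := by
  rwa [dvd_sub_comm]

lemma dvd_sub_mul {N : ℕ} {a b a' b' : R} (h1 : X ^ N ∣ a - b) (h2 : X ^ N ∣ a' - b') :
    X ^ N ∣ a * a' - b * b' := by
  have : a * a' - b * b' = (a - b) * a' + b * (a' - b') := by ring
  rw [this]
  exact dvd_add (Dvd.dvd.mul_right h1 _) (Dvd.dvd.mul_left h2 _)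

lemma tail_dvd {g : ℕ → R} (hg : Ad g) {N M : ℕ} (h : N ≤ M) :
    X ^ N ∣ (∏ i ∈ Finset.range M, (1 + g i)) - ∏ i ∈ Finset.range N, (1 + g i) := by
  induction M, h using Nat.le_induction with
  | base => simp
  | succ M hM ih =>
    rw [Finset.prod_range_succ]
    have : (∏ i ∈ Finset.range M, (1 + g i)) * (1 + g M) - ∏ i ∈ Finset.range N, (1 + g i) =
      ((∏ i ∈ Finset.range M, (1 + g i)) - ∏ i ∈ Finset.range N, (1 + g i)) +
      (∏ i ∈ Finset.range M, (1 + g i)) * g M := by ring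
    rw [this]
    exact dvd_add ih (Dvd.dvd.mul_left ((pow_dvd_pow _ hM).trans (hg M)) _)

lemma exists_pr {g : ℕ → R} (hg : Ad g) : ∃ h, IsPr g h := by
  refine ⟨PowerSeries.mk fun n => coeff n (∏ i ∈ Finset.range (n + 1), (1 + g i)), fun N => ?_⟩
  rw [X_pow_dvd_iff]
  intro m hm
  rw [map_sub, coeff_mk, sub_eq_zero]
  have := tail_dvd hg (show m + 1 ≤ N from hm)
  rw [X_pow_dvd_iff] at this
  have := this m (by omega)
  rw [map_sub, sub_eq_zero] at this
  exact this.symm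

lemma IsPr.unique {g : ℕ → R} {h h' : R} (a : IsPr g h) (b : IsPr g h') : h = h' :=
  eq_of_dvd fun N => dvd_sub_trans (a N) (dvd_sub_symm (b N))

lemma IsPr.mul {g g' k : ℕ → R} {h h' : R} (a : IsPr g h) (b : IsPr g' h')
    (hk : ∀ i, (1 + g i) * (1 + g' i) = 1 + k i) : IsPr k (h * h') := by
  intro N
  have := dvd_sub_mul (a N) (b N)
  rw [← Finset.prod_mul_distrib] at this
  simpa only [hk] using this

lemma IsPr.zero_factor {g : ℕ → R} {h : R} (hg : Ad g) (a : IsPr (fun i => g (i + 1)) h) :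
    IsPr g ((1 + g 0) * h) := by
  intro N
  have h1 := a N
  have h2 := tail_dvd hg (show N ≤ N + 1 by omega)
  rw [Finset.prod_range_succ'] at h2
  refine dvd_sub_trans ?_ h2
  have : (1 + g 0) * h - (∏ k ∈ Finset.range N, (1 + g (k + 1))) * (1 + g 0) =
    (1 + g 0) * (h - ∏ k ∈ Finset.range N, (1 + g (k + 1))) := by ring
  rw [this]
  exact Dvd.dvd.mul_left h1 _

lemma prod_range_mul (g : ℕ → R) (m N : ℕ) :
    ∏ i ∈ Finset.range (m * N), g i = ∏ r ∈ Finset.range m, ∏ j ∈ Finset.range N, g (m * j + r) := by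
  rw [Finset.prod_comm]
  induction N with
  | zero => simp
  | succ N ih => rw [Nat.mul_succ, Finset.prod_range_add, ih, Finset.prod_range_succ]

lemma IsPr.split {g : ℕ → R} (hg : Ad g) {m : ℕ} (hm : 0 < m) {h : ℕ → R}
    (a : ∀ r < m, IsPr (fun j => g (m * j + r)) (h r)) : IsPr g (∏ r ∈ Finset.range m, h r) := by
  intro N
  have h2 := tail_dvd hg (show N ≤ m * N from Nat.le_mul_of_pos_left N hm)
  refine dvd_sub_trans ?_ h2
  rw [prod_range_mul]
  have : ∀ M ≤ m, X ^ N ∣ (∏ r ∈ Finset.range M, h r) -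
      ∏ r ∈ Finset.range M, ∏ j ∈ Finset.range N, (1 + g (m * j + r)) := by
    intro M
    induction M with
    | zero => simp
    | succ M ih =>
      intro hM
      rw [Finset.prod_range_succ, Finset.prod_range_succ]
      exact dvd_sub_mul (ih (by omega)) (a M (by omega) N)
  exact this m le_rfl

lemma IsPr.const {g : ℕ → R} {h : R} (a : IsPr g h) (hc : constantCoeff (g 0) = 0) :
    constantCoeff h = 1 := by
  have := a 1
  rw [pow_one, X_dvd_iff] at this
  simp [hc] at this
  linarith

lemma IsPr.expand {g : ℕ → R} {h : R} (a : IsPr g h) (k : ℕ) (hk : k ≠ 0) :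
    IsPr (fun i => expand k hk (g i)) (expand k hk h) := by
  intro N
  obtain ⟨y, hy⟩ := a N
  have := congrArg (PowerSeries.expand k hk) hy
  simp only [map_sub, map_prod, map_add, map_one, map_mul, map_pow, expand_X] at this
  rw [this]
  refine Dvd.dvd.mul_right ?_ _
  rw [← pow_mul]
  exact pow_dvd_pow _ (Nat.le_mul_of_pos_left N (Nat.pos_of_ne_zero hk))


/-- Gaussian binomials -/
def qb (Q : R) : ℕ → ℕ → R
  | _, 0 => 1
  | 0, _ + 1 => 0
  | n + 1, k + 1 => Q ^ (k + 1) * qb Q n (k + 1) + qb Q n k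

/-- finite q-factorial -/
def qf (Q : R) (n : ℕ) : R := ∏ i ∈ Finset.range n, (1 + -Q ^ (i + 1))

lemma qb_zero_right (Q : R) (n : ℕ) : qb Q n 0 = 1 := by cases n <;> rfl

lemma qb_succ (Q : R) (n k : ℕ) :
    qb Q (n + 1) (k + 1) = Q ^ (k + 1) * qb Q n (k + 1) + qb Q n k := rfl

lemma qb_gt (Q : R) : ∀ n k : ℕ, n < k → qb Q n k = 0 := by
  intro n
  induction n with
  | zero => intro k hk; obtain ⟨j, rfl⟩ : ∃ j, k = j + 1 := ⟨k - 1, by omega⟩; rfl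
  | succ n ih =>
    intro k hk; obtain ⟨j, rfl⟩ : ∃ j, k = j + 1 := ⟨k - 1, by omega⟩
    rw [qb_succ, ih _ (by omega), ih _ (by omega)]; ring

lemma qf_succ (Q : R) (n : ℕ) : qf Q (n + 1) = qf Q n * (1 - Q ^ (n + 1)) := by
  rw [qf, Finset.prod_range_succ, ← sub_eq_add_neg]; rfl

lemma qb_self (Q : R) : ∀ n : ℕ, qb Q n n = 1 := by
  intro n
  induction n with
  | zero => rfl
  | succ n ih => rw [qb_succ, ih, qb_gt _ _ _ (by omega)]; ring

lemma qb_formula (Q : R) : ∀ n a b : ℕ, a + b = n → qb Q n a * qf Q a * qf Q b = qf Q n := by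
  intro n
  induction n with
  | zero =>
    intro a b h
    obtain rfl : a = 0 := by omega
    obtain rfl : b = 0 := by omega
    simp [qb_zero_right, qf]
  | succ n ih =>
    intro a b h
    rcases a with _ | a
    · obtain rfl : b = n + 1 := by omega
      simp [qb_zero_right, qf]
    · rcases b with _ | b
      · obtain rfl : a = n := by omega
        rw [qb_self]; simp [qf]
      · have h1 := ih (a + 1) b (by omega)
        have h2 := ih a (b + 1) (by omega)
        rw [qf_succ] at h1 h2
        rw [qb_succ, qf_succ, qf_succ, qf_succ]
        have e : Q ^ (n + 1) = Q ^ (a + 1) * Q ^ (b + 1) := by rw [← pow_add]; congr 1; omega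
        rw [e]
        linear_combination Q ^ (a + 1) * (1 - Q ^ (b + 1)) * h1 + (1 - Q ^ (a + 1)) * h2

lemma qf_const {Q : R} (hQ : X ∣ Q) (n : ℕ) : constantCoeff (qf Q n) = 1 := by
  rw [X_dvd_iff] at hQ
  simp [qf, hQ]

lemma qb_succ' {Q : R} (hQ : X ∣ Q) (n k : ℕ) (hk : k ≤ n) :
    qb Q (n + 1) (k + 1) = qb Q n (k + 1) + Q ^ (n - k) * qb Q n k := by
  rcases hk.eq_or_lt with rfl | hk
  · rw [qb_self, qb_self, qb_gt _ _ _ (by omega)]; simp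
  · obtain ⟨b, rfl⟩ : ∃ b, n = k + 1 + b := ⟨n - k - 1, by omega⟩
    have h0 := qb_formula Q (k + 1 + b + 1) (k + 1) (b + 1) (by omega)
    have h1 := qb_formula Q (k + 1 + b) (k + 1) b (by omega)
    have h2 := qb_formula Q (k + 1 + b) k (b + 1) (by omega)
    have n1 : qf Q (k + 1) * qf Q (b + 1) ≠ 0 := 
      ne_of_const (by rw [map_mul, qf_const hQ, qf_const hQ, mul_one])
    apply mul_right_cancel₀ n1
    have e : k + 1 + b - k = b + 1 := by omega
    rw [e]
    rw [qf_succ] at h0 h1 h2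
    rw [qf_succ Q (k + 1 + b), qf_succ Q b] at h0
    rw [qf_succ, qf_succ]
    have e : Q ^ (k + 1 + b + 1) = Q ^ (k + 1) * Q ^ (b + 1) := by
      rw [← pow_add]; congr 1
    rw [e] at h0
    linear_combination h0 - (1 - Q ^ (b + 1)) * h1 - Q ^ (b + 1) * (1 - Q ^ (k + 1)) * h2


/-- triangular numbers -/
def tri (n : ℤ) : ℕ := (n * (n + 1) / 2).toNat

lemma tri_cast (n : ℤ) : 2 * (tri n : ℤ) = n * (n + 1) := by
  have h0 : 0 ≤ n * (n + 1) := by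
    rcases le_or_gt 0 n with h | h
    · positivity
    · nlinarith
  have h1 : 2 ∣ n * (n + 1) := even_iff_two_dvd.1 (Int.even_mul_succ_self n)
  rw [tri, Int.toNat_of_nonneg (by omega)]
  omega

lemma tri_ge (n : ℤ) : n.natAbs ≤ tri n + 1 := by
  have := tri_cast n
  zify
  rcases le_or_gt 0 n with h | h
  · rw [abs_of_nonneg h]; nlinarith
  · rw [abs_of_neg h]
    nlinarith

/-- terms of the theta series -/
def th (u v : R) (n : ℤ) : R := u ^ tri n * v ^ tri (-n)

lemma th_up (u v : R) (M : ℕ) (j : ℤ) (m : ℕ) (hm : (m : ℤ) = M - j) :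
    u * (u * v) ^ M * th u v j = (u * v) ^ m * th u v (j + 1) := by
  have e1 : M + 1 + tri j = m + tri (j + 1) := by
    have a := tri_cast j
    have b := tri_cast (j + 1)
    zify
    nlinarith
  have e2 : M + tri (-j) = m + tri (-(j + 1)) := by
    have a := tri_cast (-j)
    have b := tri_cast (-(j + 1))
    zify
    nlinarith
  have l : u * (u * v) ^ M * th u v j = u ^ (M + 1 + tri j) * v ^ (M + tri (-j)) := by
    rw [th]; ring
  rw [l, e1, e2, th]; ring

lemma th_down (u v : R) (N : ℕ) (j : ℤ) (m : ℕ) (hm : (m : ℤ) = N + j) :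
    v * (u * v) ^ N * th u v j = (u * v) ^ m * th u v (j - 1) := by
  have e1 : N + tri j = m + tri (j - 1) := by
    have a := tri_cast j
    have b := tri_cast (j - 1)
    zify
    nlinarith
  have e2 : N + 1 + tri (-j) = m + tri (-(j - 1)) := by
    have a := tri_cast (-j)
    have b := tri_cast (-(j - 1))
    zify
    nlinarith
  have l : v * (u * v) ^ N * th u v j = u ^ (N + tri j) * v ^ (N + 1 + tri (-j)) := by
    rw [th]; ring
  rw [l, e1, e2, th]; ring

lemma finite_jtp {u v : R} (hQ : X ∣ u * v) (M N : ℕ) :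
    (∏ i ∈ Finset.range M, (1 + u * (u * v) ^ i)) * (∏ i ∈ Finset.range N, (1 + v * (u * v) ^ i)) =
    ∑ k ∈ Finset.range (M + N + 1), qb (u * v) (M + N) k * th u v (k - N) := by
  induction N with
  | zero =>
    simp only [Finset.range_zero, Finset.prod_empty, mul_one, add_zero, Nat.cast_zero, sub_zero]
    induction M with
    | zero => simp [qb_zero_right, th, tri]
    | succ M ih =>
      rw [Finset.prod_range_succ, ih, Finset.sum_range_succ' _ (M + 1)]
      have h1 : ∀ k ∈ Finset.range (M + 1), qb (u * v) (M + 1) (k + 1) * th u v ((k + 1 : ℕ) : ℤ) =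
          qb (u * v) M (k + 1) * th u v ((k + 1 : ℕ) : ℤ)
          + (u * (u * v) ^ M) * (qb (u * v) M k * th u v (k : ℤ)) := by
        intro k hk
        have hk' : k ≤ M := by simpa [Nat.lt_succ_iff] using hk
        rw [qb_succ' hQ _ _ hk']
        have := th_up u v M k (M - k) (by omega)
        push_cast
        linear_combination -qb (u * v) M k * this
      rw [Finset.sum_congr rfl h1, Finset.sum_add_distrib, ← Finset.mul_sum]
      have h2 := Finset.sum_range_succ' (fun k : ℕ => qb (u * v) M k * th u v (k : ℤ)) (M + 1)
      rw [Finset.sum_range_succ, qb_gt _ M (M + 1) (by omega)] at h2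
      rw [qb_zero_right] at *
      linear_combination h2
  | succ N ih =>
    rw [Finset.prod_range_succ, ← mul_assoc, ih, ← add_assoc, Finset.sum_range_succ' _ (M + N + 1)]
    have h1 : ∀ k ∈ Finset.range (M + N + 1), qb (u * v) (M + N + 1) (k + 1)
          * th u v (((k + 1 : ℕ) : ℤ) - ((N + 1 : ℕ) : ℤ)) =
          (v * (u * v) ^ N) * (qb (u * v) (M + N) (k + 1) * th u v (((k + 1 : ℕ) : ℤ) - N))
          + qb (u * v) (M + N) k * th u v ((k : ℤ) - N) := by
      intro k hk
      rw [qb_succ]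
      have := th_down u v N (((k + 1 : ℕ) : ℤ) - N) (k + 1) (by push_cast; ring)
      have e1 : ((k + 1 : ℕ) : ℤ) - ((N + 1 : ℕ) : ℤ) = (k : ℤ) - N := by push_cast; ring
      have e2 : ((k + 1 : ℕ) : ℤ) - (N : ℤ) - 1 = (k : ℤ) - N := by push_cast; ring
      rw [e2] at this
      rw [e1]
      linear_combination -qb (u * v) (M + N) (k + 1) * this
    rw [Finset.sum_congr rfl h1, Finset.sum_add_distrib, ← Finset.mul_sum]
    have h2 := Finset.sum_range_succ' (fun k : ℕ => qb (u * v) (M + N) k * th u v ((k : ℤ) - N))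
      (M + N + 1)
    rw [Finset.sum_range_succ, qb_gt _ (M + N) (M + N + 1) (by omega)] at h2
    have h3 := th_down u v N (((0 : ℕ) : ℤ) - N) 0 (by push_cast; ring)
    have e1 : ((0 : ℕ) : ℤ) - ((N + 1 : ℕ) : ℤ) = ((0 : ℕ) : ℤ) - N - 1 := by push_cast; ring
    rw [qb_zero_right] at *
    rw [e1]
    linear_combination h3 + v * (u * v) ^ N * h2

end C5
end

section
open PowerSeries
open scoped PowerSeries.WithPiTopology
namespace C5

lemma dvd_of_const {m : ℕ} {a b : R} (hb : constantCoeff b = 1) (h : X ^ m ∣ a * b) : X ^ m ∣ a := by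
  apply (X_prime (R := ℤ)).pow_dvd_of_dvd_mul_right m _ h
  rw [X_dvd_iff, hb]
  norm_num

lemma th_dvd {u v : R} (hu : X ∣ u) (j : ℤ) : X ^ (j.natAbs - 1) ∣ th u v j := by
  refine Dvd.dvd.mul_right ?_ _
  refine (pow_dvd_pow _ ?_).trans (pow_dvd_pow_of_dvd hu _)
  have := tri_ge j
  omega

lemma E_qb {Q E : R} (hQ : X ∣ Q) (hE : IsPr (fun i => -Q ^ (i + 1)) E) (a b m : ℕ) (ha : m ≤ a)
    (hb : m ≤ b) : X ^ m ∣ E * qb Q (a + b) a - 1 := by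
  have hq : ∀ n, m ≤ n → X ^ m ∣ E - qf Q n := fun n hn => (pow_dvd_pow _ hn).trans (hE n)
  have cE : constantCoeff E = 1 := hE.const (by
    rw [X_dvd_iff] at hQ
    simp [hQ])
  apply dvd_of_const (b := E * E) (by simp [cE])
  have h1 := qb_formula Q (a + b) a b rfl
  have h2 := hq a ha
  have h3 := hq b hb
  have h4 := hq (a + b) (by omega)
  have h5 := dvd_sub_mul h2 h3
  have : (E * qb Q (a + b) a - 1) * (E * E) =
      E * qb Q (a + b) a * (E * E - qf Q a * qf Q b) - E * (E - qf Q (a + b)) := by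
    linear_combination E * h1
  rw [this]
  exact dvd_sub (Dvd.dvd.mul_left h5 _) (Dvd.dvd.mul_left h4 _)

lemma jtp_dvd {u v hu hv E : R} (hX : X ∣ u) (Hu : IsPr (fun i => u * (u * v) ^ i) hu)
    (Hv : IsPr (fun i => v * (u * v) ^ i) hv) (HE : IsPr (fun i => -(u * v) ^ (i + 1)) E) (N : ℕ) :
    X ^ N ∣ hu * hv * E - ∑ k ∈ Finset.range (2 * N + 3), th u v (k - (N + 1 : ℕ)) := by
  have hQ : X ∣ u * v := Dvd.dvd.mul_right hX _
  have h1 := dvd_sub_mul (Hu (N + 1)) (Hv (N + 1))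
  rw [finite_jtp hQ] at h1
  have h2 : X ^ N ∣ hu * hv * E - (∑ k ∈ Finset.range (N + 1 + (N + 1) + 1),
      qb (u * v) (N + 1 + (N + 1)) k * th u v (k - (N + 1 : ℕ))) * E := by
    rw [← sub_mul]
    exact Dvd.dvd.mul_right ((pow_dvd_pow _ (by omega)).trans h1) _
  refine dvd_sub_trans h2 ?_
  rw [show N + 1 + (N + 1) + 1 = 2 * N + 3 by ring, Finset.sum_mul, ← Finset.sum_sub_distrib]
  apply Finset.dvd_sum
  intro k hk
  rw [Finset.mem_range] at hk
  have e : qb (u * v) (N + 1 + (N + 1)) k * th u v (k - (N + 1 : ℕ)) * E - th u v (k - (N + 1 : ℕ)) =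
      (E * qb (u * v) (k + (2 * N + 2 - k)) k - 1) * th u v (k - (N + 1 : ℕ)) := by
    rw [show k + (2 * N + 2 - k) = N + 1 + (N + 1) by omega]; ring
  rw [e]
  have h3 := E_qb hQ HE k (2 * N + 2 - k) (min k (2 * N + 2 - k)) (min_le_left _ _) (min_le_right _ _)
  have h4 := th_dvd (v := v) hX ((k : ℤ) - (N + 1 : ℕ))
  have h5 := mul_dvd_mul h3 h4
  rw [← pow_add] at h5
  refine (pow_dvd_pow _ ?_).trans h5
  omega

theorem jtp {u v hu hv E : R} (hX : X ∣ u) (Hu : IsPr (fun i => u * (u * v) ^ i) hu)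
    (Hv : IsPr (fun i => v * (u * v) ^ i) hv) (HE : IsPr (fun i => -(u * v) ^ (i + 1)) E) :
    HasSum (th u v) (hu * hv * E) := by
  rw [PowerSeries.WithPiTopology.hasSum_iff_hasSum_coeff]
  intro n
  let s : Finset ℤ := (Finset.range (2 * (n + 1) + 3)).image fun k : ℕ => (k : ℤ) - (n + 1 + 1 : ℕ)
  have hs : coeff n (hu * hv * E) = ∑ j ∈ s, coeff n (th u v j) := by
    rw [Finset.sum_image (by intro a _ b _ h; simpa using h), ← map_sum]
    have := jtp_dvd hX Hu Hv HE (n + 1)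
    rw [X_pow_dvd_iff] at this
    have := this n (by omega)
    rw [map_sub, sub_eq_zero] at this
    exact this
  rw [hs]
  apply hasSum_sum_of_ne_finset_zero
  intro j hj
  have h4 := th_dvd (v := v) hX j
  rw [X_pow_dvd_iff] at h4
  apply h4
  by_contra hlt
  apply hj
  simp only [s, Finset.mem_image, Finset.mem_range]
  refine ⟨(j + (n + 1 + 1 : ℕ)).toNat, ?_, ?_⟩ <;> omega

/-- families tending to zero -/
def FS {I : Type*} (h : I → R) : Prop := ∀ N : ℕ, {i | ¬ X ^ N ∣ h i}.Finite

lemma FS.summable {I : Type*} {h : I → R} (hh : FS h) : Summable h := by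
  rw [PowerSeries.WithPiTopology.summable_iff_summable_coeff]
  intro n
  apply summable_of_finite_support
  refine (hh (n + 1)).subset ?_
  intro i hi hd
  rw [X_pow_dvd_iff] at hd
  exact hi (hd n (by omega))

lemma FS.mul {I J : Type*} {h : I → R} {g : J → R} (hh : FS h) (hg : FS g) :
    FS (fun p : I × J => h p.1 * g p.2) := by
  intro N
  refine ((hh N).prod (hg N)).subset ?_
  rintro ⟨i, j⟩ hij
  refine ⟨fun h1 => hij (Dvd.dvd.mul_right h1 _), fun h1 => hij (Dvd.dvd.mul_left h1 _)⟩

lemma th_FS {u v : R} (hu : X ∣ u) : FS (th u v) := by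
  intro N
  refine (Set.finite_Icc (-(N + 1 : ℤ)) (N + 1)).subset ?_
  intro j hj
  have h1 : ¬ (N ≤ j.natAbs - 1) := fun h2 => hj ((pow_dvd_pow _ h2).trans (th_dvd hu j))
  rw [Set.mem_Icc]
  omega

/-- two dimensional product -/
lemma hasSum_two {I J : Type*} {h : I → R} {g : J → R} {a b : R} (hh : FS h) (hg : FS g)
    (ha : HasSum h a) (hb : HasSum g b) : HasSum (fun p : I × J => h p.1 * g p.2) (a * b) :=
  HasSum.mul ha hb (hh.mul hg).summable

end C5
end

section
open PowerSeries
open scoped PowerSeries.WithPiTopology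
namespace C5

lemma lat {F : ℤ × ℤ → R} {s : R} (hF : HasSum F s) (e : Fin 5 → ℤ × ℤ → ℤ × ℤ)
    (he : Function.Bijective (fun p : Fin 5 × (ℤ × ℤ) => e p.1 p.2)) (t : Fin 5 → R)
    (ht : ∀ i, HasSum (fun x => F (e i x)) (t i)) : s = ∑ i, t i := by
  have h1 : HasSum (F ∘ (Equiv.ofBijective _ he)) s := (Equiv.hasSum_iff _).2 hF
  have h2 : HasSum t s := HasSum.prod_fiberwise h1 ht
  exact h2.unique (hasSum_fintype t)

/-- the five classes, first lattice -/
def eA : Fin 5 → ℤ × ℤ → ℤ × ℤ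
  | 0, (a, b) => (2 * a - b, a + 2 * b)
  | 1, (a, b) => (1 + 2 * a - b, a + 2 * b)
  | 2, (a, b) => (-(a + 2 * b), 1 + 2 * a - b)
  | 3, (a, b) => (-(1 + 2 * a - b), -(a + 2 * b))
  | 4, (a, b) => (a + 2 * b, -(1 + 2 * a - b))

/-- the five classes, second lattice -/
def eB : Fin 5 → ℤ × ℤ → ℤ × ℤ
  | 0, (a, b) => (2 * a - b, a + 2 * b + 1)
  | 1, (a, b) => (2 * a - b, a + 2 * b)
  | 2, (a, b) => (-(a + 2 * b) - 1, 2 * a - b)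
  | 3, (a, b) => (-(2 * a - b) - 1, -(a + 2 * b) - 1)
  | 4, (a, b) => (a + 2 * b, -(2 * a - b) - 1)

lemma eA_bij : Function.Bijective (fun p : Fin 5 × (ℤ × ℤ) => eA p.1 p.2) := by
  constructor
  · rintro ⟨i, a, b⟩ ⟨j, c, d⟩ h
    fin_cases i <;> fin_cases j <;> simp [eA] at h ⊢ <;> omega
  · rintro ⟨m, n⟩
    have h5 : (m - 2 * n) % 5 = 0 ∨ (m - 2 * n) % 5 = 1 ∨ (m - 2 * n) % 5 = 2 ∨
      (m - 2 * n) % 5 = 3 ∨ (m - 2 * n) % 5 = 4 := by omega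
    rcases h5 with h | h | h | h | h
    · exact ⟨(0, (2 * m + n) / 5, (2 * n - m) / 5), by simp [eA]; omega⟩
    · exact ⟨(1, (2 * (m - 1) + n) / 5, (2 * n - (m - 1)) / 5), by simp [eA]; omega⟩
    · exact ⟨(4, (2 * (-n - 1) + m) / 5, (2 * m - (-n - 1)) / 5), by simp [eA]; omega⟩
    · exact ⟨(2, (2 * (n - 1) - m) / 5, (2 * (-m) - (n - 1)) / 5), by simp [eA]; omega⟩
    · exact ⟨(3, (2 * (-m - 1) - n) / 5, (2 * (-n) - (-m - 1)) / 5), by simp [eA]; omega⟩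

lemma eB_bij : Function.Bijective (fun p : Fin 5 × (ℤ × ℤ) => eB p.1 p.2) := by
  constructor
  · rintro ⟨i, a, b⟩ ⟨j, c, d⟩ h
    fin_cases i <;> fin_cases j <;> simp [eB] at h ⊢ <;> omega
  · rintro ⟨m, n⟩
    have h5 : (m - 2 * n) % 5 = 0 ∨ (m - 2 * n) % 5 = 1 ∨ (m - 2 * n) % 5 = 2 ∨
      (m - 2 * n) % 5 = 3 ∨ (m - 2 * n) % 5 = 4 := by omega
    rcases h5 with h | h | h | h | h
    · exact ⟨(1, (2 * m + n) / 5, (2 * n - m) / 5), by simp [eB]; omega⟩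
    · exact ⟨(3, (2 * (-m - 1) + (-n - 1)) / 5, (2 * (-n - 1) - (-m - 1)) / 5), by simp [eB]; omega⟩
    · exact ⟨(4, (2 * (-n - 1) + m) / 5, (2 * m - (-n - 1)) / 5), by simp [eB]; omega⟩
    · exact ⟨(0, (2 * m + (n - 1)) / 5, (2 * (n - 1) - m) / 5), by simp [eB]; omega⟩
    · exact ⟨(2, (2 * n + (-m - 1)) / 5, (2 * (-m - 1) - n) / 5), by simp [eB]; omega⟩

lemma th_pow (Y : R) (a b : ℕ) (n : ℤ) : th (Y ^ a) (Y ^ b) n = Y ^ (a * tri n + b * tri (-n)) := by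
  rw [th, ← pow_mul, ← pow_mul, ← pow_add]

lemma latticeA {Y p p5 c d : R} (hY : X ∣ Y) (h1 : HasSum (th (Y ^ 1) (Y ^ 1)) p)
    (h5 : HasSum (th (Y ^ 5) (Y ^ 5)) p5) (hc : HasSum (th (Y ^ 9) (Y ^ 1)) c)
    (hd : HasSum (th (Y ^ 3) (Y ^ 7)) d) : p * p = p5 * p5 + 4 * Y * (c * d) := by
  have fs : ∀ a b : ℕ, 0 < a → FS (th (Y ^ a) (Y ^ b)) := fun a b ha =>
    th_FS (hY.trans (dvd_pow_self _ (by omega)))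
  have H := hasSum_two (fs 1 1 (by norm_num)) (fs 1 1 (by norm_num)) h1 h1
  have H5 := hasSum_two (fs 5 5 (by norm_num)) (fs 5 5 (by norm_num)) h5 h5
  have Hcd : HasSum (fun q : ℤ × ℤ => Y * (th (Y ^ 9) (Y ^ 1) q.1 * th (Y ^ 3) (Y ^ 7) q.2))
      (Y * (c * d)) := (hasSum_two (fs 9 1 (by norm_num)) (fs 3 7 (by norm_num)) hc hd).mul_left Y
  have key := lat H eA eA_bij ![p5 * p5, Y * (c * d), Y * (c * d), Y * (c * d), Y * (c * d)] ?_
  · rw [key]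
    simp [Fin.sum_univ_succ]
    ring
  · simp only [th_pow, ← pow_add, ← pow_succ'] at H5 Hcd ⊢
    refine fun i => match i with | 0 => ?_ | 1 => ?_ | 2 => ?_ | 3 => ?_ | 4 => ?_
    · change HasSum _ (p5 * p5)
      convert H5 using 2 with ⟨a, b⟩
      refine congrArg (Y ^ ·) ?_
      simp only [eA]
      zify
      have := tri_cast (2 * a - b); have := tri_cast (a + 2 * b)
      have := tri_cast (-(2 * a - b)); have := tri_cast (-(a + 2 * b))
      have := tri_cast a; have := tri_cast b; have := tri_cast (-a); have := tri_cast (-b)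
      push_cast
      nlinarith
    all_goals
      change HasSum _ (Y * (c * d))
      convert Hcd using 2 with ⟨a, b⟩
      refine congrArg (Y ^ ·) ?_
      simp only [eA]
      zify
      have := tri_cast (1 + 2 * a - b); have := tri_cast (a + 2 * b)
      have := tri_cast (-(1 + 2 * a - b)); have := tri_cast (-(a + 2 * b))
      have := tri_cast a; have := tri_cast b; have := tri_cast (-a); have := tri_cast (-b)
      try simp only [neg_neg]
      push_cast
      nlinarith

lemma latticeB {Y p p5 c d : R} (hY : X ∣ Y) (h1 : HasSum (th (Y ^ 1) (Y ^ 0)) p)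
    (h5 : HasSum (th (Y ^ 5) (Y ^ 0)) p5) (hc : HasSum (th (Y ^ 4) (Y ^ 1)) c)
    (hd : HasSum (th (Y ^ 3) (Y ^ 2)) d) : p * p = Y * (p5 * p5) + 4 * (c * d) := by
  have fs : ∀ a b : ℕ, 0 < a → FS (th (Y ^ a) (Y ^ b)) := fun a b ha =>
    th_FS (hY.trans (dvd_pow_self _ (by omega)))
  have H := hasSum_two (fs 1 0 (by norm_num)) (fs 1 0 (by norm_num)) h1 h1
  have H5 : HasSum (fun q : ℤ × ℤ => Y * (th (Y ^ 5) (Y ^ 0) q.1 * th (Y ^ 5) (Y ^ 0) q.2))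
      (Y * (p5 * p5)) := (hasSum_two (fs 5 0 (by norm_num)) (fs 5 0 (by norm_num)) h5 h5).mul_left Y
  have Hcd := (hasSum_two (fs 4 1 (by norm_num)) (fs 3 2 (by norm_num)) hc hd)
  have key := lat H eB eB_bij ![Y * (p5 * p5), c * d, c * d, c * d, c * d] ?_
  · rw [key]
    simp [Fin.sum_univ_succ]
    ring
  · simp only [th_pow, ← pow_add, ← pow_succ'] at H5 Hcd ⊢
    refine fun i => match i with | 0 => ?_ | 1 => ?_ | 2 => ?_ | 3 => ?_ | 4 => ?_
    · change HasSum _ (Y * (p5 * p5))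
      convert H5 using 2 with ⟨a, b⟩
      refine congrArg (Y ^ ·) ?_
      simp only [eB]
      zify
      have := tri_cast (2 * a - b); have := tri_cast (a + 2 * b + 1)
      have := tri_cast a; have := tri_cast b; have := tri_cast (-a); have := tri_cast (-b)
      push_cast
      nlinarith
    all_goals
      change HasSum _ (c * d)
      convert Hcd using 2 with ⟨a, b⟩
      refine congrArg (Y ^ ·) ?_
      simp only [eB]
      zify
      have := tri_cast (2 * a - b); have := tri_cast (a + 2 * b)
      have := tri_cast (-(2 * a - b) - 1); have := tri_cast (-(a + 2 * b) - 1)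
      have := tri_cast a; have := tri_cast b; have := tri_cast (-a); have := tri_cast (-b)
      push_cast
      nlinarith

end C5
end

section
open PowerSeries
open scoped PowerSeries.WithPiTopology
namespace C5

lemma Ad_pp (c : R) (a k : ℕ) (hk : 0 < k) : Ad (fun i => c * X ^ (a + k * i)) := fun i =>
  Dvd.dvd.mul_left (pow_dvd_pow _ (by nlinarith)) _

/-- the product of all `1 + c q^(a + k i)` -/
def PP (c : R) (a k : ℕ) : R := Classical.epsilon (IsPr (fun i => c * X ^ (a + k * i)))

lemma PP_spec (c : R) (a k : ℕ) (hk : 0 < k) : IsPr (fun i => c * X ^ (a + k * i)) (PP c a k) :=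
  Classical.epsilon_spec (exists_pr (Ad_pp c a k hk))

/-- Euler products -/
def ff (k : ℕ) : R := PP (-1) k k

lemma ff_spec (k : ℕ) (hk : 0 < k) : IsPr (fun i => -X ^ (k * (i + 1))) (ff k) := by
  have := PP_spec (-1) k k hk
  simpa [ff, mul_add, add_comm] using this

lemma PP_const (c : R) (a k : ℕ) (ha : 0 < a) (hk : 0 < k) : constantCoeff (PP c a k) = 1 :=
  (PP_spec c a k hk).const (by simp [ha.ne'])

lemma ff_const (k : ℕ) (hk : 0 < k) : constantCoeff (ff k) = 1 := PP_const _ _ _ hk hk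

lemma PP_split (c : R) (a k m : ℕ) (hk : 0 < k) (hm : 0 < m) :
    PP c a k = ∏ r ∈ Finset.range m, PP c (a + k * r) (k * m) := by
  refine (PP_spec c a k hk).unique (IsPr.split (Ad_pp c a k hk) hm ?_)
  intro r _
  have := PP_spec c (a + k * r) (k * m) (Nat.mul_pos hk hm)
  convert this using 2 with i
  ring

lemma ff_expand (k : ℕ) (hk : 0 < k) : e5 (ff k) = ff (5 * k) := by
  refine ((ff_spec k hk).expand 5 (by norm_num)).unique ?_
  convert ff_spec (5 * k) (by omega) using 2 with i
  rw [map_neg, map_pow, expand_X, ← pow_mul]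
  ring_nf

lemma PP_neg (k : ℕ) (hk : 0 < k) : PP 1 k k * ff k = ff (2 * k) := by
  refine ((PP_spec 1 k k hk).mul (PP_spec (-1) k k hk) (k := fun i => -X ^ (2 * k * (i + 1)))
    ?_).unique (ff_spec _ (by omega))
  intro i
  ring

lemma PP_zero (k : ℕ) (hk : 0 < k) : PP 1 0 k = 2 * PP 1 k k := by
  have h := IsPr.zero_factor (Ad_pp 1 0 k hk) (h := PP 1 k k) (by
    convert PP_spec 1 k k hk using 4 with i
    ring)
  rw [(PP_spec 1 0 k hk).unique h]
  norm_num

lemma thA (a b : ℕ) (ha : Odd a) (hb : Odd b) : HasSum (th ((-X) ^ a) ((-X) ^ b))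
    (PP (-1) a (a + b) * PP (-1) b (a + b) * ff (a + b)) := by
  have pa : 0 < a := ha.pos
  have e : ((-X : R) ^ a * (-X) ^ b) = X ^ (a + b) := by
    rw [ha.neg_pow, hb.neg_pow, pow_add]; ring
  apply jtp
  · rw [ha.neg_pow]
    exact (dvd_neg).2 (dvd_pow_self _ pa.ne')
  · convert PP_spec (-1) a (a + b) (by omega) using 2 with i
    rw [e, ha.neg_pow]; ring
  · convert PP_spec (-1) b (a + b) (by omega) using 2 with i
    rw [e, hb.neg_pow]; ring
  · convert ff_spec (a + b) (by omega) using 2 with i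
    rw [e, ← pow_mul]

lemma thB (a b : ℕ) (pa : 0 < a) : HasSum (th (X ^ a) (X ^ b))
    (PP 1 a (a + b) * PP 1 b (a + b) * ff (a + b)) := by
  apply jtp
  · exact (dvd_pow_self _ pa.ne')
  · convert PP_spec 1 a (a + b) (by omega) using 2 with i
    ring
  · convert PP_spec 1 b (a + b) (by omega) using 2 with i
    ring
  · convert ff_spec (a + b) (by omega) using 2 with i
    ring

theorem I1 : ff 1 ^ 4 * ff 5 * ff 10 ^ 2 + 4 * X * ff 1 * ff 2 * ff 10 ^ 5 = ff 2 ^ 2 * ff 5 ^ 5 := by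
  have key := latticeA (Y := -X) (dvd_neg.2 dvd_rfl) (thA 1 1 (by decide) (by decide))
    (thA 5 5 (by decide) (by decide)) (thA 9 1 (by decide) (by decide))
    (thA 3 7 (by decide) (by decide))
  have s1 := PP_split (-1) 1 1 2 (by norm_num) (by norm_num)
  have s2 := PP_split (-1) 5 5 2 (by norm_num) (by norm_num)
  have s3 := PP_split (-1) 1 2 5 (by norm_num) (by norm_num)
  simp only [Finset.prod_range_succ, Finset.prod_range_zero, one_mul] at s1 s2 s3
  norm_num at s1 s2 s3 key
  simp only [ff] at *
  rw [s1, s2]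
  generalize PP (-1) 2 2 = f2 at *
  generalize PP (-1) 10 10 = f10 at *
  generalize PP (-1) 1 2 = p at *
  linear_combination (f2 ^ 2 * (PP (-1) 5 10 * f10) * f10 ^ 2) * key +
    (4 * X * f2 ^ 2 * f10 ^ 5) * s3

theorem I2 : ff 1 ^ 5 * ff 5 * ff 10 + 5 * X * ff 1 ^ 2 * ff 2 * ff 10 ^ 4 = ff 2 ^ 5 * ff 5 ^ 2 := by
  have i1 := I1
  have key := latticeB (Y := X) dvd_rfl (thB 1 0 (by decide))
    (thB 5 0 (by decide)) (thB 4 1 (by decide)) (thB 3 2 (by decide))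
  have s3 := PP_split 1 1 1 5 (by norm_num) (by norm_num)
  have n1 := PP_neg 1 (by norm_num)
  have n5 := PP_neg 5 (by norm_num)
  simp only [Finset.prod_range_succ, Finset.prod_range_zero, one_mul] at s3
  norm_num at s3 key n1 n5
  rw [PP_zero 1 (by norm_num), PP_zero 5 (by norm_num)] at key
  have c5 : PP 1 5 5 ≠ 0 := ne_of_const (PP_const _ _ _ (by norm_num) (by norm_num))
  have d5 : ff 5 ≠ 0 := ne_of_const (ff_const _ (by norm_num))
  rw [← n1, ← n5] at i1 ⊢
  generalize ff 1 = f1 at *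
  generalize ff 5 = f5 at *
  generalize PP 1 1 1 = N at *
  generalize PP 1 5 5 = N5 at *
  have key' : N ^ 4 * f1 ^ 2 = X * N5 ^ 4 * f5 ^ 2 + PP 1 1 5 * PP 1 2 5 * PP 1 3 5 * PP 1 4 5 * f5 ^ 2 := by
    have h4 : (4 : R) ≠ 0 := by
      intro h
      have h' := congrArg constantCoeff h
      rw [map_ofNat, map_zero] at h'
      norm_num at h'
    apply mul_left_cancel₀ h4
    linear_combination key
  apply mul_left_cancel₀ (mul_ne_zero c5 d5)
  linear_combination f1 * i1 - f1 ^ 3 * f5 ^ 3 * N * N5 * key' + N * f1 ^ 3 * f5 ^ 5 * s3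

end C5
end

section
open PowerSeries
open scoped PowerSeries.WithPiTopology
namespace C5

/-- multisets of coloured parts from `s` with total `n` -/
def Sm (s : Finset (ℕ × ℕ)) (n : ℕ) : Set (Multiset (ℕ × ℕ)) :=
  {m | (∀ p ∈ m, p ∈ s) ∧ (m.map Prod.fst).sum = n}

lemma le_sum_fst (m : Multiset (ℕ × ℕ)) (p : ℕ × ℕ) (hp : p ∈ m) : p.1 ≤ (m.map Prod.fst).sum :=
  Multiset.single_le_sum (fun _ _ => Nat.zero_le _) _ (Multiset.mem_map_of_mem _ hp)

lemma card_le_sum_fst (m : Multiset (ℕ × ℕ)) (h : ∀ p ∈ m, 0 < p.1) :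
    m.card ≤ (m.map Prod.fst).sum := by
  induction m using Multiset.induction with
  | empty => simp
  | cons a m ih =>
    have h1 := ih fun p hp => h p (Multiset.mem_cons_of_mem hp)
    have h2 := h a (Multiset.mem_cons_self a m)
    simp only [Multiset.card_cons, Multiset.map_cons, Multiset.sum_cons]
    omega

lemma Sm_finite (s : Finset (ℕ × ℕ)) (hs : ∀ p ∈ s, 0 < p.1) (n : ℕ) : (Sm s n).Finite := by
  classical
  refine ((n • s.val).powerset.toFinset.finite_toSet).subset ?_
  rintro m ⟨h1, h2⟩
  simp only [Finset.mem_coe, Multiset.mem_toFinset, Multiset.mem_powerset]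
  rw [Multiset.le_iff_count]
  intro a
  rw [Multiset.count_nsmul]
  by_cases ha : a ∈ m
  · have h3 : Multiset.count a s.val = 1 := Multiset.count_eq_one_of_mem s.nodup (h1 a ha)
    have h4 := Multiset.count_le_card a m
    have h5 := card_le_sum_fst m (fun p hp => hs p (h1 p hp))
    rw [h3]
    omega
  · rw [Multiset.count_eq_zero_of_notMem ha]
    exact Nat.zero_le _

lemma Sm_rec (s : Finset (ℕ × ℕ)) (p : ℕ × ℕ) (hp : p ∉ s) (hs : ∀ q ∈ insert p s, 0 < q.1) (n : ℕ) :
    (Sm (insert p s) n).ncard = (Sm s n).ncard +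
      if p.1 ≤ n then (Sm (insert p s) (n - p.1)).ncard else 0 := by
  classical
  have hfs := Sm_finite s (fun q hq => hs q (Finset.mem_insert_of_mem hq)) n
  have case1 : ∀ m ∈ Sm (insert p s) n, p ∉ m → m ∈ Sm s n := by
    rintro m ⟨h1, h2⟩ h
    refine ⟨fun q hq => ?_, h2⟩
    rcases Finset.mem_insert.1 (h1 q hq) with rfl | h3
    · exact absurd hq h
    · exact h3
  have case2 : ∀ m ∈ Sm s n, m ∈ Sm (insert p s) n := by
    rintro m ⟨h1, h2⟩
    exact ⟨fun q hq => Finset.mem_insert_of_mem (h1 q hq), h2⟩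
  split_ifs with hn
  · have hu : Sm (insert p s) n = Sm s n ∪ (fun m => p ::ₘ m) '' Sm (insert p s) (n - p.1) := by
      ext m
      constructor
      · intro hm
        by_cases h : p ∈ m
        · right
          obtain ⟨m', rfl⟩ := Multiset.exists_cons_of_mem h
          obtain ⟨h1, h2⟩ := hm
          refine ⟨m', ⟨fun q hq => h1 q (Multiset.mem_cons_of_mem hq), ?_⟩, rfl⟩
          rw [Multiset.map_cons, Multiset.sum_cons] at h2
          omega
        · exact Or.inl (case1 m hm h)
      · rintro (hm | ⟨m', ⟨h1, h2⟩, rfl⟩)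
        · exact case2 m hm
        · refine ⟨fun q hq => ?_, ?_⟩
          · rcases Multiset.mem_cons.1 hq with rfl | h3
            · exact Finset.mem_insert_self _ _
            · exact h1 q h3
          · rw [Multiset.map_cons, Multiset.sum_cons, h2]
            omega
    have hd : Disjoint (Sm s n) ((fun m => p ::ₘ m) '' Sm (insert p s) (n - p.1)) := by
      rw [Set.disjoint_left]
      rintro m ⟨h1, _⟩ ⟨m', _, rfl⟩
      exact hp (h1 p (Multiset.mem_cons_self _ _))
    conv_lhs => rw [hu]
    rw [Set.ncard_union_eq hd hfs ((Sm_finite _ hs _).image _),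
      Set.ncard_image_of_injective _ (fun _ _ h => (Multiset.cons_inj_right p).1 h)]
  · rw [add_zero]
    congr 1
    ext m
    refine ⟨fun hm => case1 m hm fun h => hn ?_, case2 m⟩
    rw [← hm.2]
    exact le_sum_fst m p h

/-- generating function -/
def gs (s : Finset (ℕ × ℕ)) : R := PowerSeries.mk fun n => ((Sm s n).ncard : ℤ)

lemma gs_insert (s : Finset (ℕ × ℕ)) (p : ℕ × ℕ) (hp : p ∉ s) (hs : ∀ q ∈ insert p s, 0 < q.1) :
    gs (insert p s) * (1 - X ^ p.1) = gs s := by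
  ext n
  rw [mul_sub, mul_one, map_sub, coeff_mul_X_pow']
  simp only [gs, coeff_mk]
  rw [Sm_rec s p hp hs n]
  split_ifs <;> simp

lemma gs_empty : gs ∅ = 1 := by
  ext n
  rw [gs, coeff_mk, coeff_one]
  have : Sm ∅ n = if n = 0 then {0} else ∅ := by
    ext m
    simp only [Sm, Set.mem_ofPred_eq, Finset.notMem_empty]
    constructor
    · rintro ⟨h1, h2⟩
      have : m = 0 := Multiset.eq_zero_of_forall_notMem h1
      subst this
      simp at h2
      simp [← h2]
    · split_ifs with h
      · rintro rfl
        simp [h]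
      · simp
  rw [this]
  split_ifs <;> simp

lemma gs_prod (s : Finset (ℕ × ℕ)) (hs : ∀ q ∈ s, 0 < q.1) : gs s * ∏ p ∈ s, (1 - X ^ p.1) = 1 := by
  classical
  induction s using Finset.induction_on with
  | empty => simp [gs_empty]
  | insert p s hp ih =>
    rw [Finset.prod_insert hp, ← mul_assoc, gs_insert s p hp hs]
    exact ih fun q hq => hs q (Finset.mem_insert_of_mem hq)

/-- all coloured parts up to `N` -/
def sN : ℕ → Finset (ℕ × ℕ)
  | 0 => ∅
  | N + 1 => if Even (N + 1) then insert (N + 1, 0) (insert (N + 1, 1) (insert (N + 1, 2) (sN N)))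
      else insert (N + 1, 0) (sN N)

lemma mem_sN (N : ℕ) (p : ℕ × ℕ) :
    p ∈ sN N ↔ (0 < p.1 ∧ p.2 < 3 ∧ (Odd p.1 → p.2 = 0)) ∧ p.1 ≤ N := by
  obtain ⟨a, c⟩ := p
  induction N with
  | zero => simp [sN]; omega
  | succ N ih =>
    rw [sN]
    split_ifs with h
    · simp only [Finset.mem_insert, ih, Prod.mk.injEq]
      by_cases ha : a = N + 1
      · subst ha
        have : ¬ Odd (N + 1) := by rwa [Nat.not_odd_iff_even]
        simp only [this]
        simp
        omega
      · have : a ≤ N + 1 ↔ a ≤ N := by omega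
        simp [ha, this]
    · simp only [Finset.mem_insert, ih, Prod.mk.injEq]
      by_cases ha : a = N + 1
      · subst ha
        have : Odd (N + 1) := by rwa [← Nat.not_even_iff_odd]
        simp only [this]
        simp
        omega
      · have : a ≤ N + 1 ↔ a ≤ N := by omega
        simp [ha, this]

/-- even factors -/
def gE (i : ℕ) : R := if Even (i + 1) then -X ^ (i + 1) else 0

lemma prod_sN (N : ℕ) : ∏ p ∈ sN N, (1 - X ^ p.1 : R) =
    (∏ i ∈ Finset.range N, (1 + -X ^ (1 * (i + 1)))) * (∏ i ∈ Finset.range N, (1 + gE i)) ^ 2 := by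
  induction N with
  | zero => simp [sN]
  | succ N ih =>
    rw [Finset.prod_range_succ, Finset.prod_range_succ, sN, gE]
    split_ifs with h
    · rw [Finset.prod_insert (by simp [mem_sN]), Finset.prod_insert (by simp [mem_sN]),
        Finset.prod_insert (by simp [mem_sN]), ih]
      ring
    · rw [Finset.prod_insert (by simp [mem_sN]), ih]
      ring

lemma gE_pr : IsPr gE (ff 2) := by
  have hg : Ad gE := by
    intro i
    rw [gE]
    split_ifs
    · exact (dvd_neg).2 (pow_dvd_pow _ (by omega))
    · exact dvd_zero _
  have := IsPr.split hg (m := 2) (by norm_num) (h := fun r => if r = 0 then 1 else ff 2) ?_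
  · simpa [Finset.prod_range_succ] using this
  · intro r hr
    interval_cases r
    · intro N
      have : ∀ i : ℕ, ¬ Even (2 * i + 1) := fun i => by rw [Nat.not_even_iff_odd]; exact odd_two_mul_add_one i
      simp [gE, this]
    · have h2 : ∀ i : ℕ, Even (2 * i + 1 + 1) := fun i => ⟨i + 1, by ring⟩
      have := ff_spec 2 (by norm_num)
      simpa [gE, h2, mul_add] using this

/-- generating function of the frozen counting function -/
def Gf : R := PowerSeries.mk fun n => (genCubic 3 n : ℤ)

lemma genCubic_eq (N n : ℕ) (h : n ≤ N) : genCubic 3 n = (Sm (sN N) n).ncard := by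
  rw [genCubic, ← Nat.card_coe_set_eq]
  have : {m : Multiset (ℕ × ℕ) | (∀ p ∈ m, 0 < p.1 ∧ p.2 < 3 ∧ (Odd p.1 → p.2 = 0)) ∧
    (m.map Prod.fst).sum = n} = Sm (sN N) n := by
    ext m
    constructor
    · rintro ⟨h1, h2⟩
      refine ⟨fun p hp => (mem_sN N p).2 ⟨h1 p hp, ?_⟩, h2⟩
      have := le_sum_fst m p hp
      omega
    · rintro ⟨h1, h2⟩
      exact ⟨fun p hp => ((mem_sN N p).1 (h1 p hp)).1, h2⟩
  rw [← this]
  rfl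

theorem Gf_eq : Gf * (ff 1 * ff 2 ^ 2) = 1 := by
  apply eq_of_dvd
  intro N
  have h1 : X ^ N ∣ Gf - gs (sN N) := by
    rw [X_pow_dvd_iff]
    intro n hn
    rw [map_sub, Gf, gs, coeff_mk, coeff_mk, genCubic_eq N n hn.le, sub_self]
  have h2 := dvd_sub_mul (ff_spec 1 (by norm_num) N) (dvd_sub_mul (gE_pr N) (gE_pr N))
  have h3 := dvd_sub_mul h1 h2
  rw [← sq, ← sq, ← prod_sN, gs_prod _ fun q hq => ((mem_sN N q).1 hq).1.1] at h3
  exact h3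

end C5
end

section
open PowerSeries
namespace C5

/-- the quotient of the two Euler products -/
def Phi : R := X ^ 5 * (ff 25 * ff 50 ^ 2) * Gf

lemma inv_of_const {f : R} (h : constantCoeff f = 1) : ∃ g, f * g = 1 := by
  have : IsUnit f := by
    rw [isUnit_iff_constantCoeff, h]
    exact isUnit_one
  obtain ⟨g, hg⟩ := this.exists_right_inv
  exact ⟨g, hg⟩

lemma exists_dat : ∃ t, Dat t Phi := by
  have c : constantCoeff (ff 1 ^ 3 * ff 5) = 1 := by
    rw [map_mul, map_pow, ff_const 1 (by norm_num), ff_const 5 (by norm_num)]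
    norm_num
  obtain ⟨g, hg⟩ := inv_of_const c
  refine ⟨X * (ff 2 * ff 10 ^ 3) * g, lev_dat (f1 := ff 1) (f2 := ff 2) (f5 := ff 5) (f10 := ff 10)
    (f25 := ff 25) (f50 := ff 50) ?_⟩
  exact {
    c1 := ff_const 1 (by norm_num)
    c2 := ff_const 2 (by norm_num)
    e1 := ff_expand 1 (by norm_num)
    e2 := ff_expand 2 (by norm_num)
    e3 := ff_expand 5 (by norm_num)
    e4 := ff_expand 10 (by norm_num)
    ht := by linear_combination (X * (ff 2 * ff 10 ^ 3)) * hg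
    hΦ := by
      rw [Phi]
      linear_combination (X ^ 5 * (ff 25 * ff 50 ^ 2)) * Gf_eq
    I1 := I1
    I2 := I2 }

lemma UU_F (h : R) : U (U ((ff 25 * ff 50 ^ 2) * h)) = ff 1 * ff 2 ^ 2 * U (U h) := by
  have e1 : ff 5 * ff 10 ^ 2 = e5 (ff 1 * ff 2 ^ 2) := by
    rw [map_mul, map_pow, ff_expand 1 (by norm_num), ff_expand 2 (by norm_num)]
  have e2 : ff 25 * ff 50 ^ 2 = e5 (ff 5 * ff 10 ^ 2) := by
    rw [map_mul, map_pow, ff_expand 5 (by norm_num), ff_expand 10 (by norm_num)]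
  rw [e2, U_expand, e1, U_expand]

/-- the progression -/
def Hk (k : ℕ) : R := PowerSeries.mk fun n => (genCubic 3 (25 ^ (k + 1) * n + gammaA (k + 1)) : ℤ)

lemma gamma_succ (k : ℕ) : gammaA (k + 2) = 25 ^ (k + 1) * 19 + gammaA (k + 1) := by
  have h : ∀ j : ℕ, ∃ c, 25 ^ j = 24 * c + 1 := by
    intro j
    induction j with
    | zero => exact ⟨0, rfl⟩
    | succ j ih =>
      obtain ⟨c, hc⟩ := ih
      exact ⟨25 * c + 1, by rw [pow_succ, hc]; ring⟩
  obtain ⟨c, hc⟩ := h k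
  simp only [gammaA, show k + 2 - 1 = k + 1 by omega, show k + 1 - 1 = k by omega, pow_succ, hc]
  omega

lemma LL_eq (k : ℕ) : LL Phi (k + 1) = ff 1 * ff 2 ^ 2 * (X * Hk k) := by
  induction k with
  | zero =>
    rw [LL, LL, mul_one, Phi, show X ^ 5 * (ff 25 * ff 50 ^ 2) * Gf =
      (ff 25 * ff 50 ^ 2) * (X ^ 5 * Gf) by ring, UU_F]
    refine congrArg (fun z => ff 1 * ff 2 ^ 2 * z) ?_
    ext n
    rw [coeff_U, coeff_U, coeff_X_pow_mul']
    rcases n with _ | n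
    · simp
    · rw [if_pos (by omega), coeff_succ_X_mul, Hk, Gf, coeff_mk, coeff_mk]
      congr 2
      simp [gammaA]
      omega
  | succ k ih =>
    rw [LL, ih, Phi, show X ^ 5 * (ff 25 * ff 50 ^ 2) * Gf * (ff 1 * ff 2 ^ 2 * (X * Hk k)) =
      (ff 25 * ff 50 ^ 2) * (X ^ 6 * Hk k) by
        linear_combination (X ^ 6 * (ff 25 * ff 50 ^ 2) * Hk k) * Gf_eq, UU_F]
    refine congrArg (fun z => ff 1 * ff 2 ^ 2 * z) ?_
    ext n
    rw [coeff_U, coeff_U, coeff_X_pow_mul']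
    rcases n with _ | n
    · simp
    · rw [if_pos (by omega), coeff_succ_X_mul, Hk, Hk, coeff_mk, coeff_mk, gamma_succ,
        show 5 * (5 * (n + 1)) - 6 = 25 * n + 19 by omega]
      rw [show 25 ^ (k + 1) * (25 * n + 19) + gammaA (k + 1) =
        25 ^ (k + 1 + 1) * n + (25 ^ (k + 1) * 19 + gammaA (k + 1)) by ring]

lemma main (k n : ℕ) : (5 : ℤ) ^ (k + 1) ∣ (genCubic 3 (25 ^ (k + 1) * n + gammaA (k + 1)) : ℤ) := by
  obtain ⟨t, d⟩ := exists_dat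
  have h1 : X * Hk k = Gf * LL Phi (k + 1) := by
    rw [LL_eq]
    linear_combination (-(X * Hk k)) * Gf_eq
  have h2 : (5 : ℤ) ^ (k + 1) ∣ coeff (n + 1) (X * Hk k) := by
    rw [h1, coeff_mul]
    exact Finset.dvd_sum fun p _ => Dvd.dvd.mul_left (LL_coeff d _ _) _
  rwa [coeff_succ_X_mul, Hk, coeff_mk] at h2

end C5
end

end

theorem stmt_1 : ∀ α : ℕ, 1 ≤ α → ∀ n : ℕ,
    5 ^ α ∣ genCubic 3 (5 ^ (2 * α) * n + gammaA α) := by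
  intro α hα n
  obtain ⟨k, rfl⟩ : ∃ k, α = k + 1 := ⟨α - 1, by omega⟩
  have h := C5.main k n
  rw [pow_mul]
  exact_mod_cast h
end
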